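/- For |q| < 1 and all k ≥ 0: ∑_{ℓ=0}^{k} (q^ℓ/(q;q)_ℓ) ∑_{μ : μ₁ = k−ℓ} b_μ(q) P_μ(x;q) P_μ(y;q) = ∑_{λ, ρ : λ₁ = k, ρ ⊆ λ} q^{|ρ|} s_{λ/ρ}(x) s_{λ/ρ}(y), relating q-Whittaker polynomials with first part constrained to skew Schur polynomials with constrained outer first row. -/

import Mathlib

/-- Integer partitions, encoded as weakly decreasing eventually-zero sequences. -/
abbrev YD : Type := {f : ℕ → ℕ // (∀ i j : ℕ, i ≤ j → f j ≤ f i) ∧ ∃ N, f N = 0}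

/-- The size of a partition. -/
noncomputable def psize (f : ℕ → ℕ) : ℕ := ∑ᶠ i, f i

/-- `conj f c` is the length of the `(c+1)`-st column of the partition `f`. -/
noncomputable def conj (f : ℕ → ℕ) (c : ℕ) : ℕ := Nat.card {r : ℕ | c + 1 ≤ f r}

/-- The q-Pochhammer symbol `(p;p)_m`. -/
def qPoch (p : ℂ) (m : ℕ) : ℂ := ∏ j ∈ Finset.range m, (1 - p ^ (j + 1))

/-- The infinite q-Pochhammer symbol `(z;q)_∞ = ∏_{k ≥ 0} (1 - q^k z)`. -/
noncomputable def qPochInf (z q : ℂ) : ℂ := ∏' k : ℕ, (1 - q ^ k * z)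

/-! ### Vertically strict tableaux, the combinatorial R-matrix and the intrinsic energy.

A column of a vertically strict tableau is encoded as a `Finset ℕ` of its (distinct)
entries; a vertically strict tableau is the list of its columns, left to right. -/

/-- The sorted parenthesis word of the pair of columns `x ⊗ y`: letters written in
increasing order, entries of `x` marked `true` ("(" ) and entries of `y` marked
`false` (")"), with the convention that at equal letters the one of `x` comes first. -/
def colPairWord (n : ℕ) (x y : Finset ℕ) : List (ℕ × Bool) :=
  (List.range (n + 1)).flatMap fun l =>
    (if l ∈ x then [(l, true)] else []) ++ (if l ∈ y then [(l, false)] else [])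

/-- Match consecutive pairs "(" ")" in the word; return the list of unmatched "("
letters (most recent first) and unmatched ")" letters (in left-to-right order). -/
def scanRS (w : List (ℕ × Bool)) : List ℕ × List ℕ :=
  w.foldl
    (fun st p =>
      if p.2 then (p.1 :: st.1, st.2)
      else
        match st.1 with
        | [] => (st.1, st.2 ++ [p.1])
        | _ :: t => (t, st.2))
    ([], [])

/-- The local energy `H(x ⊗ y)`: the number of winding pairs, i.e. of pairs matched
cyclically among unmatched parentheses. -/
def Hloc (n : ℕ) (x y : Finset ℕ) : ℕ :=
  min (scanRS (colPairWord n x y)).1.length (scanRS (colPairWord n x y)).2.length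

/-- The right output component of the combinatorial R-matrix
`R(x ⊗ y) = ỹ ⊗ x̃`: this returns `x̃` (the column of the same height as `x`),
obtained by flipping the orientation of the parentheses left unmatched after the
winding matching. -/
def Rright (n : ℕ) (x y : Finset ℕ) : Finset ℕ :=
  let st := (scanRS (colPairWord n x y)).1
  let cl := (scanRS (colPairWord n x y)).2
  let h := min st.length cl.length
  (y \ (cl.drop h).toFinset) ∪ (st.drop h).toFinset

/-- `rowE n x ys = ∑_j H(x^{(j-1)} ⊗ y_j)` where `x` is carried to the right through
the columns `ys` by the combinatorial R-matrix. -/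
def rowE (n : ℕ) : Finset ℕ → List (Finset ℕ) → ℕ
  | _, [] => 0
  | x, y :: ys => Hloc n x y + rowE n (Rright n x y) ys

/-- The intrinsic energy `𝓗` of a vertically strict tableau given by its columns. -/
def intrinsicE (n : ℕ) : List (Finset ℕ) → ℕ
  | [] => 0
  | x :: ys => rowE n x ys + intrinsicE n ys

/-- The number of `a`-cells of a vertically strict tableau. -/
def cnt (L : List (Finset ℕ)) (a : ℕ) : ℕ := (L.map fun s => if a ∈ s then 1 else 0).sum

/-- Vertically strict tableaux of shape `μ` with entries in `{1,…,n}`: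
lists of columns, the `(j+1)`-st of which is a subset of `{1,…,n}` of size `μ'_{j+1}`. -/
abbrev VSTt (n : ℕ) (μ : ℕ → ℕ) : Type :=
  {L : List (Finset ℕ) // L.length = μ 0 ∧
    ∀ j : Fin L.length, (L.get j).card = conj μ (j : ℕ) ∧ ∀ a ∈ L.get j, 1 ≤ a ∧ a ≤ n}

/-- The q-Whittaker polynomial
`P_μ(x₁,…,x_n; q) = ∑_{V ∈ VST(μ)} q^{𝓗(V)} x^V`. -/
noncomputable def qWhit (n : ℕ) (x : ℕ → ℂ) (q : ℂ) (μ : ℕ → ℕ) : ℂ :=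
  ∑' V : VSTt n μ, q ^ intrinsicE n V.val * ∏ a ∈ Finset.Icc 1 n, x a ^ cnt V.val a

/-- `b_μ(q) = ∏_{i ≥ 1} 1/(q;q)_{μ_i - μ_{i+1}}`. -/
noncomputable def bmu (q : ℂ) (μ : ℕ → ℕ) : ℂ :=
  ∏ᶠ i : ℕ, (qPoch q (μ i - μ (i + 1)))⁻¹

/-- Semistandard skew tableau of shape `lam/rho` with entries in `{1,…,n}`:
`T r c` is the entry in row `r`, column `c` (0-based), `0` meaning an empty cell. -/
def issyt (n : ℕ) (lam rho : ℕ → ℕ) (T : ℕ → ℕ → ℕ) : Prop :=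
  (∀ r c, T r c ≠ 0 ↔ rho r ≤ c ∧ c < lam r) ∧
  (∀ r c, T r c ≤ n) ∧
  (∀ r c c', rho r ≤ c → c ≤ c' → c' < lam r → T r c ≤ T r c') ∧
  (∀ r c, rho r ≤ c → c < lam r → rho (r + 1) ≤ c → c < lam (r + 1) →
    T r c < T (r + 1) c)

/-- The skew Schur polynomial `s_{λ/ρ}(x₁,…,x_n) = ∑_{T ∈ SST(λ/ρ,n)} x^T`. -/
noncomputable def skewSchur (n : ℕ) (x : ℕ → ℂ) (lam rho : ℕ → ℕ) : ℂ :=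
  ∑' T : {T : ℕ → ℕ → ℕ // issyt n lam rho T},
    ∏ a ∈ Finset.Icc 1 n, x a ^ Nat.card {p : ℕ × ℕ | T.val p.1 p.2 = a}

/-! ### The queue description of the combinatorial R-matrix -/

/-- The indicator of `l ∈ x`, as a natural number. -/
def bitOf (l : ℕ) (x : Finset ℕ) : ℕ := if l ∈ x then 1 else 0

/-- The queue length after reading the letters of `L`, starting from `c`. -/
def flow (x y : Finset ℕ) : List ℕ → ℕ → ℕ
  | [], c => c
  | l :: L, c => flow x y L (c + bitOf l y - bitOf l x)

/-- The letters put out while reading the letters of `L`, with initial queue length `c`. -/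
def outflow (x y : Finset ℕ) : List ℕ → ℕ → Finset ℕ
  | [], _ => ∅
  | l :: L, c =>
    (if l ∈ y ∨ (l ∈ x ∧ c = 0) then {l} else ∅) ∪ outflow x y L (c + bitOf l y - bitOf l x)

/-- The alphabet `m-1, …, 1, 0` in decreasing order. -/
def desc : ℕ → List ℕ
  | 0 => []
  | m + 1 => m :: desc m

theorem mem_desc {m l : ℕ} : l ∈ desc m ↔ l < m := by
  induction m with
  | zero => simp [desc]
  | succ m ih => simp only [desc, List.mem_cons, ih]; omega

theorem nodup_desc (m : ℕ) : (desc m).Nodup := by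
  induction m with
  | zero => simp [desc]
  | succ m ih => simp [desc, ih, mem_desc]

theorem outflow_subset (x y : Finset ℕ) (L : List ℕ) (c : ℕ) : outflow x y L c ⊆ L.toFinset := by
  induction L generalizing c with
  | nil => simp [outflow]
  | cons l L ih =>
    intro a ha
    simp only [outflow, Finset.mem_union] at ha
    simp only [List.toFinset_cons, Finset.mem_insert]
    rcases ha with ha | ha
    · left; split_ifs at ha <;> simp_all
    · right; exact ih _ ha

theorem outflow_subset_union (x y : Finset ℕ) (L : List ℕ) (c : ℕ) :
    outflow x y L c ⊆ x ∪ y := by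
  induction L generalizing c with
  | nil => simp [outflow]
  | cons l L ih =>
    intro a ha
    simp only [outflow, Finset.mem_union] at ha
    rcases ha with ha | ha
    · split_ifs at ha with h
      · simp only [Finset.mem_singleton] at ha
        subst ha
        simp only [Finset.mem_union]; tauto
      · simp at ha
    · exact ih _ ha

theorem flow_append (x y : Finset ℕ) (L M : List ℕ) (c : ℕ) :
    flow x y (L ++ M) c = flow x y M (flow x y L c) := by
  induction L generalizing c with
  | nil => rfl
  | cons l L ih => simp [flow, ih]

theorem outflow_append (x y : Finset ℕ) (L M : List ℕ) (c : ℕ) :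
    outflow x y (L ++ M) c = outflow x y L c ∪ outflow x y M (flow x y L c) := by
  induction L generalizing c with
  | nil => simp [flow, outflow]
  | cons l L ih => simp [flow, outflow, ih, Finset.union_assoc]

theorem flow_congr {x y x' y' : Finset ℕ} {L : List ℕ}
    (h : ∀ l ∈ L, (l ∈ x ↔ l ∈ x') ∧ (l ∈ y ↔ l ∈ y')) (c : ℕ) :
    flow x y L c = flow x' y' L c := by
  induction L generalizing c with
  | nil => rfl
  | cons l L ih =>
    have h1 := h l (by simp)
    simp only [flow, bitOf, h1]
    exact ih (fun l hl => h l (by simp [hl])) _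

theorem outflow_congr {x y x' y' : Finset ℕ} {L : List ℕ}
    (h : ∀ l ∈ L, (l ∈ x ↔ l ∈ x') ∧ (l ∈ y ↔ l ∈ y')) (c : ℕ) :
    outflow x y L c = outflow x' y' L c := by
  induction L generalizing c with
  | nil => rfl
  | cons l L ih =>
    have h1 := h l (by simp)
    simp only [outflow, bitOf, h1]
    rw [ih (fun l hl => h l (by simp [hl])) _]

theorem scan_step (x y : Finset ℕ) (m : ℕ) :
    scanRS ((List.range (m + 1)).flatMap fun l =>
      (if l ∈ x then [(l, true)] else []) ++ (if l ∈ y then [(l, false)] else [])) =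
    ((if m ∈ x then [(m, true)] else []) ++ (if m ∈ y then [(m, false)] else [])).foldl
      (fun st p =>
      if p.2 then (p.1 :: st.1, st.2)
      else
        match st.1 with
        | [] => (st.1, st.2 ++ [p.1])
        | _ :: t => (t, st.2))
      (scanRS ((List.range m).flatMap fun l =>
      (if l ∈ x then [(l, true)] else []) ++ (if l ∈ y then [(l, false)] else []))) := by
  rw [List.range_succ, List.flatMap_append, scanRS, List.foldl_append]
  simp only [List.flatMap_cons, List.flatMap_nil, List.append_nil]
  rfl

theorem scan_flow (x y : Finset ℕ) (m : ℕ) (st cl : List ℕ)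
    (h : scanRS ((List.range m).flatMap fun l =>
      (if l ∈ x then [(l, true)] else []) ++ (if l ∈ y then [(l, false)] else [])) = (st, cl)) :
    (∀ c, flow x y (desc m) c = cl.length + (c - st.length)) ∧
    (∀ c, outflow x y (desc m) c = (y.filter (· < m)) ∪ (st.drop c).toFinset) ∧
    st.length + (y.filter (· < m)).card = cl.length + (x.filter (· < m)).card := by
  induction m generalizing st cl with
  | zero =>
    simp [scanRS] at h
    obtain ⟨rfl, rfl⟩ := h
    simp [flow, desc, outflow]
  | succ m ih =>
    rw [scan_step] at h
    obtain ⟨⟨s, d⟩, hsd⟩ : ∃ p, scanRS ((List.range m).flatMap fun l =>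
      (if l ∈ x then [(l, true)] else []) ++ (if l ∈ y then [(l, false)] else [])) = p := ⟨_, rfl⟩
    obtain ⟨h1, h2, h3⟩ := ih s d hsd
    rw [hsd] at h
    have key : ∀ z : Finset ℕ, z.filter (· < m + 1) =
        (if m ∈ z then {m} else ∅) ∪ z.filter (· < m) := by
      intro z
      ext a
      by_cases hm : m ∈ z
      · simp only [hm, if_true, Finset.mem_union, Finset.mem_filter, Finset.mem_singleton,
          Nat.lt_succ_iff_lt_or_eq]
        constructor
        · tauto
        · rintro (rfl | h) <;> tauto
      · simp only [hm, if_false, Finset.mem_union, Finset.mem_filter,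
          Nat.lt_succ_iff_lt_or_eq, Finset.notMem_empty, false_or]
        constructor
        · rintro ⟨h, h' | rfl⟩ <;> tauto
        · tauto
    have keyc : ∀ z : Finset ℕ, (z.filter (· < m + 1)).card =
        bitOf m z + (z.filter (· < m)).card := by
      intro z
      rw [key, Finset.card_union_of_disjoint]
      · by_cases hm : m ∈ z <;> simp [hm, bitOf]
      · by_cases hm : m ∈ z <;> simp [hm]
    rw [keyc, keyc]
    simp only [desc, flow, outflow, h1, h2, key y]
    by_cases hx : m ∈ x <;> by_cases hy : m ∈ y
    · simp [hx, hy] at h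
      obtain ⟨rfl, rfl⟩ := h
      simp [hx, hy, bitOf]; omega
    · simp [hx, hy] at h
      obtain ⟨rfl, rfl⟩ := h
      simp only [hx, hy, bitOf, if_true, if_false]
      refine ⟨fun c => by simp; omega, fun c => ?_, by simp; omega⟩
      cases c with
      | zero => simp
      | succ c => simp
    · cases s with
      | nil =>
        simp [hx, hy] at h
        obtain ⟨rfl, rfl⟩ := h
        simp only [hx, hy, bitOf, if_true, if_false]
        refine ⟨fun c => by simp; omega, fun c => by simp, by simp at h3 ⊢; omega⟩
      | cons a t =>
        simp [hx, hy] at h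
        obtain ⟨rfl, rfl⟩ := h
        simp only [hx, hy, bitOf, if_true, if_false]
        refine ⟨fun c => by simp, fun c => by simp, by simp at h3 ⊢; omega⟩
    · simp [hx, hy] at h
      obtain ⟨rfl, rfl⟩ := h
      simp only [hx, hy, bitOf, if_false]
      refine ⟨fun c => by simp, fun c => by simp, by simp; omega⟩

theorem filter_lt_eq {n : ℕ} {x : Finset ℕ} (hx : x ⊆ Finset.Icc 1 n) :
    x.filter (· < n + 1) = x := by
  rw [Finset.filter_eq_self]
  intro a ha
  have := Finset.mem_Icc.1 (hx ha)
  omega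

theorem Hloc_eq_flow {n : ℕ} {x y : Finset ℕ} (hx : x ⊆ Finset.Icc 1 n) (hy : y ⊆ Finset.Icc 1 n)
    (hc : y.card ≤ x.card) : Hloc n x y = flow x y (desc (n + 1)) 0 := by
  obtain ⟨h1, h2, h3⟩ := scan_flow x y (n + 1) (scanRS (colPairWord n x y)).1
    (scanRS (colPairWord n x y)).2 rfl
  rw [filter_lt_eq hx, filter_lt_eq hy] at h3
  rw [h1, Hloc]
  omega

theorem Rright_eq_outflow {n : ℕ} {x y : Finset ℕ} (hx : x ⊆ Finset.Icc 1 n)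
    (hy : y ⊆ Finset.Icc 1 n) (hc : y.card ≤ x.card) :
    Rright n x y = outflow x y (desc (n + 1)) (Hloc n x y) := by
  obtain ⟨h1, h2, h3⟩ := scan_flow x y (n + 1) (scanRS (colPairWord n x y)).1
    (scanRS (colPairWord n x y)).2 rfl
  rw [filter_lt_eq hx, filter_lt_eq hy] at h3
  rw [h2, Rright, Hloc, filter_lt_eq hy]
  rw [List.drop_eq_nil_of_le (as := (scanRS (colPairWord n x y)).2)]
  · simp
  · omega

theorem flow_Hloc {n : ℕ} {x y : Finset ℕ} (hx : x ⊆ Finset.Icc 1 n) (hy : y ⊆ Finset.Icc 1 n)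
    (hc : y.card ≤ x.card) : flow x y (desc (n + 1)) (Hloc n x y) = Hloc n x y := by
  obtain ⟨h1, h2, h3⟩ := scan_flow x y (n + 1) (scanRS (colPairWord n x y)).1
    (scanRS (colPairWord n x y)).2 rfl
  rw [filter_lt_eq hx, filter_lt_eq hy] at h3
  rw [h1, Hloc]
  omega

theorem mem_outflow_cons {x y : Finset ℕ} {L : List ℕ} {l : ℕ} (hl : l ∉ L) (c : ℕ) :
    l ∈ outflow x y (l :: L) c ↔ l ∈ y ∨ (l ∈ x ∧ c = 0) := by
  have h : l ∉ outflow x y L (c + bitOf l y - bitOf l x) := fun h => hl (by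
    simpa using outflow_subset _ _ _ _ h)
  simp only [outflow, Finset.mem_union, h, or_false]
  split_ifs with h' <;> simp [h']

theorem flow_add_card (x y : Finset ℕ) (L : List ℕ) (hL : L.Nodup) (c : ℕ) :
    flow x y L c + (x ∩ L.toFinset).card = c + (outflow x y L c).card := by
  induction L generalizing c with
  | nil => simp [flow, outflow]
  | cons l L ih =>
    obtain ⟨hl, hL⟩ := List.nodup_cons.1 hL
    have hl' : l ∉ L.toFinset := by simpa using hl
    have h : l ∉ outflow x y L (c + bitOf l y - bitOf l x) := fun h => hl (by
    simpa using outflow_subset _ _ _ _ h)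
    have := ih hL (c + bitOf l y - bitOf l x)
    simp only [List.toFinset_cons, flow, outflow]
    have hcx : ∀ z : Finset ℕ, (z ∩ insert l L.toFinset).card
        = bitOf l z + (z ∩ L.toFinset).card := by
      intro z
      by_cases hz : l ∈ z
      · rw [Finset.inter_insert_of_mem hz, Finset.card_insert_of_notMem (by simp [hl])]
        simp [bitOf, hz, add_comm]
      · rw [Finset.inter_insert_of_notMem hz]; simp [bitOf, hz]
    have hout : ((if l ∈ y ∨ (l ∈ x ∧ c = 0) then {l} else ∅) ∪
        outflow x y L (c + bitOf l y - bitOf l x)).card = (if l ∈ y ∨ (l ∈ x ∧ c = 0) then 1 else 0)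
          + (outflow x y L (c + bitOf l y - bitOf l x)).card := by
      split_ifs
      · rw [Finset.singleton_union, Finset.card_insert_of_notMem h, add_comm]
      · simp
    rw [hcx, hout]
    have hb : c + (if l ∈ y ∨ (l ∈ x ∧ c = 0) then 1 else 0) =
        (c + bitOf l y - bitOf l x) + bitOf l x := by
      by_cases hx : l ∈ x <;> by_cases hy : l ∈ y <;> simp only [bitOf, hx, hy, if_true, if_false,
        true_or, false_or, true_and, false_and] <;> (try split_ifs) <;> omega
    omega

theorem inter_desc {n : ℕ} {x : Finset ℕ} (hx : x ⊆ Finset.Icc 1 n) :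
    x ∩ (desc (n + 1)).toFinset = x := by
  rw [Finset.inter_eq_left]
  intro a ha
  have := Finset.mem_Icc.1 (hx ha)
  simp only [List.mem_toFinset, mem_desc]
  omega

theorem card_Rright {n : ℕ} {x y : Finset ℕ} (hx : x ⊆ Finset.Icc 1 n)
    (hy : y ⊆ Finset.Icc 1 n) (hc : y.card ≤ x.card) : (Rright n x y).card = x.card := by
  have h := flow_add_card x y (desc (n + 1)) (nodup_desc _) (Hloc n x y)
  rw [flow_Hloc hx hy hc, ← Rright_eq_outflow hx hy hc, inter_desc hx] at h
  omega

theorem Rright_subset {n : ℕ} {x y : Finset ℕ} (hx : x ⊆ Finset.Icc 1 n)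
    (hy : y ⊆ Finset.Icc 1 n) (hc : y.card ≤ x.card) : Rright n x y ⊆ Finset.Icc 1 n := by
  rw [Rright_eq_outflow hx hy hc]
  exact (outflow_subset_union _ _ _ _).trans (Finset.union_subset hx hy)


/-! ### Rotation of the alphabet -/

/-- The relabelling `n ↦ 1`, `l ↦ l + 1` otherwise. -/
def rotLetter (n l : ℕ) : ℕ := if l = n then 1 else l + 1

/-- The column obtained from `v` by the cyclic rotation `1 ↦ n`, `l ↦ l - 1`. -/
def rotCol (n : ℕ) (v : Finset ℕ) : Finset ℕ := (Finset.Icc 1 n).filter (rotLetter n · ∈ v)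

theorem flow_rotCol (n : ℕ) (x y : Finset ℕ) (L : List ℕ) (hL : ∀ l ∈ L, l ∈ Finset.Icc 1 n)
    (c : ℕ) : flow (rotCol n x) (rotCol n y) L c = flow x y (L.map (rotLetter n)) c := by
  induction L generalizing c with
  | nil => rfl
  | cons l L ih =>
    have h : ∀ z : Finset ℕ, l ∈ rotCol n z ↔ rotLetter n l ∈ z := by
      intro z; simp only [rotCol, Finset.mem_filter, hL l (by simp), true_and]
    simp only [flow, List.map_cons, bitOf, h]
    exact ih (fun l hl => hL l (by simp [hl])) _

theorem rotLetter_inj {n a b : ℕ} (ha : a ∈ Finset.Icc 1 n) (hb : b ∈ Finset.Icc 1 n) :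
    rotLetter n a = rotLetter n b ↔ a = b := by
  rw [Finset.mem_Icc] at ha hb
  unfold rotLetter
  split_ifs <;> omega

theorem mem_outflow_rotCol (n : ℕ) (x y : Finset ℕ) (L : List ℕ)
    (hL : ∀ l ∈ L, l ∈ Finset.Icc 1 n) (c a : ℕ) (ha : a ∈ Finset.Icc 1 n) :
    a ∈ outflow (rotCol n x) (rotCol n y) L c ↔
      rotLetter n a ∈ outflow x y (L.map (rotLetter n)) c := by
  induction L generalizing c with
  | nil => simp [outflow]
  | cons l L ih =>
    have h : ∀ z : Finset ℕ, l ∈ rotCol n z ↔ rotLetter n l ∈ z := by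
      intro z; simp only [rotCol, Finset.mem_filter, hL l (by simp), true_and]
    simp only [outflow, List.map_cons, bitOf, h, Finset.mem_union]
    rw [ih (fun l hl => hL l (by simp [hl]))]
    refine or_congr ?_ Iff.rfl
    split_ifs
    · simp only [Finset.mem_singleton]
      rw [rotLetter_inj ha (hL l (by simp))]
    · simp

theorem flow_form (x y : Finset ℕ) (L : List ℕ) :
    ∃ a b : ℤ, 0 ≤ a ∧ b ≤ a ∧ ∀ c : ℕ, (flow x y L c : ℤ) = max a (c + b) := by
  induction L with
  | nil => exact ⟨0, 0, le_rfl, le_rfl, fun c => by simp [flow]⟩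
  | cons l L ih =>
    obtain ⟨a, b, h0, h1, h2⟩ := ih
    refine ⟨max a (b + (bitOf l y - bitOf l x : ℤ)), b + (bitOf l y - bitOf l x : ℤ),
      by omega, by omega, fun c => ?_⟩
    simp only [flow, h2]
    omega

theorem desc_map_two (m : ℕ) : desc (m + 2) = (desc m).map (· + 2) ++ [1, 0] := by
  induction m with
  | zero => rfl
  | succ m ih => rw [show desc (m + 1 + 2) = (m + 2) :: desc (m + 2) from rfl, ih]; simp [desc]

theorem desc_map_one (m : ℕ) : desc (m + 1) = (desc m).map (· + 1) ++ [0] := by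
  induction m with
  | zero => rfl
  | succ m ih =>
    conv_lhs => rw [desc, ih]
    simp [desc]

theorem map_rotLetter (m : ℕ) :
    ((desc (m + 1)).map (· + 1)).map (rotLetter (m + 1)) = 1 :: (desc m).map (· + 2) := by
  simp only [desc, List.map_cons, List.map_map]
  congr 1
  · simp [rotLetter]
  · apply List.map_congr_left
    intro a ha
    rw [mem_desc] at ha
    simp [rotLetter]; omega

theorem flow_append_zero {x y : Finset ℕ} (hx : 0 ∉ x) (hy : 0 ∉ y) (L : List ℕ) (c : ℕ) :
    flow x y (L ++ [0]) c = flow x y L c := by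
  rw [flow_append]; simp [flow, bitOf, hx, hy]

theorem outflow_append_zero {x y : Finset ℕ} (hx : 0 ∉ x) (hy : 0 ∉ y) (L : List ℕ) (c : ℕ) :
    outflow x y (L ++ [0]) c = outflow x y L c := by
  rw [outflow_append]; simp [outflow, hx, hy]

theorem zero_notMem {n : ℕ} {x : Finset ℕ} (hx : x ⊆ Finset.Icc 1 n) : 0 ∉ x := fun h => by
  have := Finset.mem_Icc.1 (hx h); omega

theorem rotCol_subset (n : ℕ) (x : Finset ℕ) : rotCol n x ⊆ Finset.Icc 1 n :=
  Finset.filter_subset _ _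

theorem exists_rotLetter {n a : ℕ} (ha : a ∈ Finset.Icc 1 n) :
    ∃ b ∈ Finset.Icc 1 n, rotLetter n b = a := by
  rw [Finset.mem_Icc] at ha
  by_cases h : a = 1
  · exact ⟨n, Finset.mem_Icc.2 ⟨by omega, le_rfl⟩, by simp [rotLetter, h]⟩
  · exact ⟨a - 1, Finset.mem_Icc.2 ⟨by omega, by omega⟩, by unfold rotLetter; split_ifs <;> omega⟩

theorem map_rotCol {n : ℕ} {x : Finset ℕ} (hx : x ⊆ Finset.Icc 1 n) :
    (rotCol n x).image (rotLetter n) = x := by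
  ext a
  simp only [Finset.mem_image, rotCol, Finset.mem_filter]
  constructor
  · rintro ⟨b, ⟨_, hb⟩, rfl⟩; exact hb
  · intro ha
    obtain ⟨b, hb, rfl⟩ := exists_rotLetter (hx ha)
    exact ⟨b, ⟨hb, ha⟩, rfl⟩

theorem card_rotCol {n : ℕ} {x : Finset ℕ} (hx : x ⊆ Finset.Icc 1 n) :
    (rotCol n x).card = x.card := by
  conv_rhs => rw [← map_rotCol hx]
  rw [Finset.card_image_of_injOn]
  intro a ha b hb h
  exact (rotLetter_inj (rotCol_subset n x ha) (rotCol_subset n x hb)).1 h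

theorem rotation_local {n : ℕ} (hn : 1 ≤ n) {x y : Finset ℕ} (hx : x ⊆ Finset.Icc 1 n)
    (hy : y ⊆ Finset.Icc 1 n) (hc : y.card ≤ x.card) :
    Hloc n (rotCol n x) (rotCol n y) + bitOf 1 (Rright n x y) = Hloc n x y + bitOf 1 x ∧
    Rright n (rotCol n x) (rotCol n y) = rotCol n (Rright n x y) := by
  obtain ⟨m, rfl⟩ : ∃ m, n = m + 1 := ⟨n - 1, by omega⟩
  have hc' : (rotCol (m + 1) y).card ≤ (rotCol (m + 1) x).card := by
    rwa [card_rotCol hx, card_rotCol hy]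
  have hx0 := zero_notMem hx
  have hy0 := zero_notMem hy
  have hrx := rotCol_subset (m + 1) x
  have hry := rotCol_subset (m + 1) y
  set hi := (desc m).map (· + 2) with hhi
  have hsplit : desc (m + 2) = (hi ++ [1]) ++ [0] := by rw [desc_map_two]; simp [hhi]
  have hsplit' : desc (m + 2) = (desc (m + 1)).map (· + 1) ++ [0] := desc_map_one _
  have hL : ∀ l ∈ (desc (m + 1)).map (· + 1), l ∈ Finset.Icc 1 (m + 1) := by
    intro l hl
    simp only [List.mem_map, mem_desc] at hl
    obtain ⟨a, ha, rfl⟩ := hl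
    simp; omega
  obtain ⟨a, b, a0, ab, hv⟩ := flow_form x y hi
  obtain ⟨a', b', a0', ab', hu⟩ := flow_form x y [1]
  have hf : ∀ c, flow x y (desc (m + 2)) c = flow x y [1] (flow x y hi c) := by
    intro c; rw [hsplit, flow_append_zero hx0 hy0, flow_append]
  have hfr : ∀ c, flow (rotCol (m + 1) x) (rotCol (m + 1) y) (desc (m + 2)) c
      = flow x y hi (flow x y [1] c) := by
    intro c
    rw [hsplit', flow_append_zero (zero_notMem hrx) (zero_notMem hry), flow_rotCol _ _ _ _ hL,
      map_rotLetter, ← flow_append]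
    rfl
  have hH : Hloc (m + 1) x y = flow x y [1] (flow x y hi 0) := by
    rw [Hloc_eq_flow hx hy hc, hf]
  have hH' : Hloc (m + 1) (rotCol (m + 1) x) (rotCol (m + 1) y)
      = flow x y hi (flow x y [1] 0) := by
    rw [Hloc_eq_flow hrx hry hc', hfr]
  have hbb : b + b' ≤ 0 := by
    obtain ⟨h1, h2, h3⟩ := scan_flow x y (m + 2) (scanRS (colPairWord (m + 1) x y)).1
      (scanRS (colPairWord (m + 1) x y)).2 rfl
    rw [filter_lt_eq hx, filter_lt_eq hy] at h3
    have := h1 (scanRS (colPairWord (m + 1) x y)).1.length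
    rw [hf] at this
    have e1 := hv (scanRS (colPairWord (m + 1) x y)).1.length
    have e2 := hu (flow x y hi (scanRS (colPairWord (m + 1) x y)).1.length)
    omega
  have hfix : flow x y [1] (flow x y hi (Hloc (m + 1) x y)) = Hloc (m + 1) x y := by
    rw [← hf, flow_Hloc hx hy hc]
  have hkey : flow x y hi (Hloc (m + 1) x y) =
      Hloc (m + 1) (rotCol (m + 1) x) (rotCol (m + 1) y) := by
    rw [hH, hH']
    have e1 := hv 0
    have e2 := hu 0
    have e3 := hv (flow x y [1] 0)
    have e4 := hu (flow x y hi 0)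
    have e5 := hv (flow x y [1] (flow x y hi 0))
    omega
  have h1mem : 1 ∉ hi := by simp [hhi]
  have hout : Rright (m + 1) x y = outflow x y hi (Hloc (m + 1) x y) ∪
      outflow x y [1] (Hloc (m + 1) (rotCol (m + 1) x) (rotCol (m + 1) y)) := by
    rw [Rright_eq_outflow hx hy hc, hsplit, outflow_append_zero hx0 hy0, outflow_append, hkey]
  have h1out : 1 ∈ Rright (m + 1) x y ↔
      1 ∈ y ∨ (1 ∈ x ∧ Hloc (m + 1) (rotCol (m + 1) x) (rotCol (m + 1) y) = 0) := by
    have h : 1 ∉ outflow x y hi (Hloc (m + 1) x y) := fun h => h1mem (by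
      simpa using outflow_subset _ _ _ _ h)
    rw [hout, Finset.mem_union, mem_outflow_cons (by simp)]
    simp [h]
  constructor
  · rw [hkey] at hfix
    simp only [flow] at hfix
    generalize Hloc (m + 1) (rotCol (m + 1) x) (rotCol (m + 1) y) = H' at hfix h1out ⊢
    by_cases hx1 : 1 ∈ x <;> by_cases hy1 : 1 ∈ y <;> by_cases hH1 : H' = 0 <;>
      simp only [bitOf, h1out, hx1, hy1, hH1, if_true, if_false, true_or, false_or, true_and,
        false_and] at hfix ⊢ <;> omega
  · ext l
    by_cases hl : l ∈ Finset.Icc 1 (m + 1)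
    · rw [Rright_eq_outflow hrx hry hc', hsplit', outflow_append_zero (zero_notMem hrx)
        (zero_notMem hry), mem_outflow_rotCol _ _ _ _ hL _ _ hl, map_rotLetter, ← hhi]
      have : outflow x y (1 :: hi) (Hloc (m + 1) (rotCol (m + 1) x) (rotCol (m + 1) y)) =
          Rright (m + 1) x y := by
        rw [hout, ← List.singleton_append, outflow_append, Finset.union_comm]
        congr 2
        rw [← hfix, hkey]
      rw [this]
      simp only [rotCol, Finset.mem_filter, hl, true_and]
    · exact iff_of_false (fun h => hl (Rright_subset hrx hry hc' h))
        (fun h => hl (rotCol_subset _ _ h))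


/-! ### Lists of columns -/

/-- The lists of columns with entries in `{1,…,n}` and prescribed heights. -/
def colsOf (n : ℕ) : List ℕ → Finset (List (Finset ℕ))
  | [] => {[]}
  | h :: s => (Finset.powersetCard h (Finset.Icc 1 n) ×ˢ colsOf n s).image fun p => p.1 :: p.2

theorem mem_colsOf {n : ℕ} {s : List ℕ} {V : List (Finset ℕ)} :
    V ∈ colsOf n s ↔ (∀ v ∈ V, v ⊆ Finset.Icc 1 n) ∧ V.map Finset.card = s := by
  induction s generalizing V with
  | nil =>
    simp only [colsOf, Finset.mem_singleton, List.map_eq_nil_iff]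
    constructor
    · rintro rfl; simp
    · exact fun h => h.2
  | cons h s ih =>
    simp only [colsOf, Finset.mem_image, Finset.mem_product, Finset.mem_powersetCard, Prod.exists]
    constructor
    · rintro ⟨v, W, ⟨⟨hv, hc⟩, hW⟩, rfl⟩
      rw [ih] at hW
      simp [hv, hc, hW.2]
      exact hW.1
    · rintro ⟨h1, h2⟩
      cases V with
      | nil => simp at h2
      | cons v W =>
        simp only [List.map_cons, List.cons.injEq] at h2
        exact ⟨v, W, ⟨⟨h1 v (by simp), h2.1⟩, ih.2 ⟨fun w hw => h1 w (by simp [hw]), h2.2⟩⟩, rfl⟩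

/-- The monomial of a list of columns. -/
def mon (x : ℕ → ℂ) (V : List (Finset ℕ)) : ℂ := (V.map fun v => ∏ a ∈ v, x a).prod

@[simp] theorem mon_nil (x : ℕ → ℂ) : mon x [] = 1 := rfl

@[simp] theorem mon_cons (x : ℕ → ℂ) (v : Finset ℕ) (V : List (Finset ℕ)) :
    mon x (v :: V) = (∏ a ∈ v, x a) * mon x V := rfl

/-- The generating function of the intrinsic energy over lists of columns of heights `s`. -/
noncomputable def wsum (n : ℕ) (q : ℂ) (s : List ℕ) (x : ℕ → ℂ) : ℂ :=
  ∑ V ∈ colsOf n s, q ^ intrinsicE n V * mon x V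

/-- The generating function of the energy after appending the column `{a}`. -/
noncomputable def gsum (n : ℕ) (q : ℂ) (s : List ℕ) (a : ℕ) (x : ℕ → ℂ) : ℂ :=
  ∑ V ∈ colsOf n s, q ^ intrinsicE n (V ++ [{a}]) * mon x V

/-- The column obtained by carrying `x` through the columns of a list. -/
def carry (n : ℕ) : Finset ℕ → List (Finset ℕ) → Finset ℕ
  | x, [] => x
  | x, y :: ys => carry n (Rright n x y) ys

/-- The contribution of an appended column `z` to the intrinsic energy. -/
def tailE (n : ℕ) (z : Finset ℕ) : List (Finset ℕ) → ℕ
  | [] => 0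
  | y :: ys => Hloc n (carry n y ys) z + tailE n z ys

theorem rowE_append (n : ℕ) (x z : Finset ℕ) (ys : List (Finset ℕ)) :
    rowE n x (ys ++ [z]) = rowE n x ys + Hloc n (carry n x ys) z := by
  induction ys generalizing x with
  | nil => simp [rowE, carry]
  | cons y ys ih => simp [rowE, carry, ih, add_assoc]

theorem intrinsicE_append (n : ℕ) (z : Finset ℕ) (ys : List (Finset ℕ)) :
    intrinsicE n (ys ++ [z]) = intrinsicE n ys + tailE n z ys := by
  induction ys with
  | nil => simp [intrinsicE, tailE, rowE]
  | cons y ys ih => simp [intrinsicE, tailE, rowE_append, ih]; omega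

theorem carry_wf {n : ℕ} {x : Finset ℕ} {ys : List (Finset ℕ)} (hx : x ⊆ Finset.Icc 1 n)
    (hys : ∀ y ∈ ys, y ⊆ Finset.Icc 1 n ∧ y.card ≤ x.card) :
    carry n x ys ⊆ Finset.Icc 1 n ∧ (carry n x ys).card = x.card := by
  induction ys generalizing x with
  | nil => exact ⟨hx, rfl⟩
  | cons y ys ih =>
    obtain ⟨h1, h2⟩ := hys y (by simp)
    have := ih (Rright_subset hx h1 h2) (by
      rw [card_Rright hx h1 h2]; exact fun y hy => hys y (by simp [hy]))
    rwa [card_Rright hx h1 h2] at this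

theorem rotation_row {n : ℕ} (hn : 1 ≤ n) {x : Finset ℕ} {ys : List (Finset ℕ)}
    (hx : x ⊆ Finset.Icc 1 n) (hys : ∀ y ∈ ys, y ⊆ Finset.Icc 1 n ∧ y.card ≤ x.card) :
    rowE n (rotCol n x) (ys.map (rotCol n)) + bitOf 1 (carry n x ys) =
      rowE n x ys + bitOf 1 x := by
  induction ys generalizing x with
  | nil => simp [rowE, carry]
  | cons y ys ih =>
    obtain ⟨h1, h2⟩ := hys y (by simp)
    obtain ⟨e1, e2⟩ := rotation_local hn hx h1 h2
    have := ih (Rright_subset hx h1 h2) (by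
      rw [card_Rright hx h1 h2]; exact fun y hy => hys y (by simp [hy]))
    simp only [List.map_cons, rowE, carry, e2]
    omega

theorem flow_no_arrival {x y : Finset ℕ} {L : List ℕ} (hL : L.Nodup) (hy : ∀ l ∈ L, l ∉ y)
    (c : ℕ) : flow x y L c = c - (x ∩ L.toFinset).card := by
  induction L generalizing c with
  | nil => simp [flow]
  | cons l L ih =>
    obtain ⟨hl, hL⟩ := List.nodup_cons.1 hL
    rw [flow, ih hL (fun l hl => hy l (by simp [hl]))]
    have : bitOf l y = 0 := by simp [bitOf, hy l (by simp)]
    rw [this, List.toFinset_cons]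
    by_cases hx : l ∈ x
    · rw [Finset.inter_insert_of_mem hx, Finset.card_insert_of_notMem (by simp [hl])]
      simp [bitOf, hx]; omega
    · rw [Finset.inter_insert_of_notMem hx]; simp [bitOf, hx]

theorem Hloc_singleton {n a : ℕ} (ha : a ∈ Finset.Icc 1 n) {c : Finset ℕ}
    (hc : c ⊆ Finset.Icc 1 n) (h1 : 1 ≤ c.card) :
    Hloc n c {a} = 1 - (c ∩ (desc (a + 1)).toFinset).card := by
  rw [Hloc_eq_flow hc (by simpa using ha) (by simpa using h1)]
  obtain ⟨d, hd⟩ : ∃ d, n + 1 = a + 1 + d := ⟨n - a, by have := Finset.mem_Icc.1 ha; omega⟩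
  rw [hd]
  clear hd
  induction d with
  | zero =>
    simp only [desc, flow]
    rw [flow_no_arrival (nodup_desc a) (fun l hl => by rw [mem_desc] at hl; simp; omega)]
    rw [List.toFinset_cons]
    by_cases hx : a ∈ c
    · rw [Finset.inter_insert_of_mem hx, Finset.card_insert_of_notMem (by simp [mem_desc])]
      simp [bitOf, hx]
    · rw [Finset.inter_insert_of_notMem hx]; simp [bitOf, hx]
  | succ d ih =>
    rw [← ih, ← add_assoc, desc, flow]
    congr 1
    have : bitOf (a + 1 + d) {a} = 0 := by
      have : a + 1 + d ≠ a := by omega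
      simp [bitOf, this]
    rw [this, add_zero, Nat.zero_sub]

theorem Hloc_singleton_top {n : ℕ} (hn : 1 ≤ n) {c : Finset ℕ}
    (hc : c ⊆ Finset.Icc 1 n) (h1 : 1 ≤ c.card) : Hloc n c {n} = 0 := by
  rw [Hloc_singleton (by simp [hn]) hc h1, inter_desc hc]; omega

theorem Hloc_singleton_one {n : ℕ} (hn : 1 ≤ n) {c : Finset ℕ}
    (hc : c ⊆ Finset.Icc 1 n) (h1 : 1 ≤ c.card) : Hloc n c {1} + bitOf 1 c = 1 := by
  rw [Hloc_singleton (by simp [hn]) hc h1]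
  have : (desc (1 + 1)).toFinset = {1, 0} := by simp [desc]
  rw [this]
  have h0 := zero_notMem hc
  by_cases h : 1 ∈ c
  · have : c ∩ {1, 0} = {1} := by
      ext a; simp only [Finset.mem_inter, Finset.mem_insert, Finset.mem_singleton]
      constructor
      · rintro ⟨ha, rfl | rfl⟩
        · rfl
        · exact absurd ha h0
      · rintro rfl; simp [h]
    simp [this, bitOf, h]
  · have : c ∩ {1, 0} = ∅ := by
      ext a; simp only [Finset.mem_inter, Finset.mem_insert, Finset.mem_singleton,
        Finset.notMem_empty, iff_false]
      rintro ⟨ha, rfl | rfl⟩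
      · exact h ha
      · exact h0 ha
    simp [this, bitOf, h]

/-- Columns in `{1,…,n}` with weakly decreasing heights. -/
def IsTab (n : ℕ) (V : List (Finset ℕ)) : Prop :=
  (∀ v ∈ V, v ⊆ Finset.Icc 1 n) ∧ (V.map Finset.card).Pairwise (· ≥ ·)

theorem IsTab.cons {n : ℕ} {v : Finset ℕ} {V : List (Finset ℕ)} (h : IsTab n (v :: V)) :
    v ⊆ Finset.Icc 1 n ∧ (∀ y ∈ V, y ⊆ Finset.Icc 1 n ∧ y.card ≤ v.card) ∧ IsTab n V := by
  obtain ⟨h1, h2⟩ := h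
  simp only [List.map_cons, List.pairwise_cons, List.mem_map, forall_exists_index, and_imp,
    forall_apply_eq_imp_iff₂] at h2
  exact ⟨h1 v (by simp), fun y hy => ⟨h1 y (by simp [hy]), h2.1 y hy⟩,
    fun y hy => h1 y (by simp [hy]), h2.2⟩

theorem isTab_of_mem {n : ℕ} {s : List ℕ} (hs : s.Pairwise (· ≥ ·)) {V : List (Finset ℕ)}
    (hV : V ∈ colsOf n s) : IsTab n V := by
  rw [mem_colsOf] at hV
  exact ⟨hV.1, hV.2 ▸ hs⟩

theorem tailE_top {n : ℕ} (hn : 1 ≤ n) {V : List (Finset ℕ)} (hV : IsTab n V)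
    (h1 : ∀ v ∈ V, 1 ≤ v.card) : tailE n {n} V = 0 := by
  induction V with
  | nil => rfl
  | cons v V ih =>
    obtain ⟨a, b, c⟩ := hV.cons
    obtain ⟨d, e⟩ := carry_wf a b
    rw [tailE, ih c (fun v hv => h1 v (by simp [hv])), Hloc_singleton_top hn d
      (e ▸ h1 v (by simp))]

theorem gsum_top {n : ℕ} (hn : 1 ≤ n) (q : ℂ) {s : List ℕ} (hs : s.Pairwise (· ≥ ·))
    (h1 : ∀ h ∈ s, 1 ≤ h) (x : ℕ → ℂ) : gsum n q s n x = wsum n q s x := by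
  refine Finset.sum_congr rfl fun V hV => ?_
  have hm := mem_colsOf.1 hV
  rw [intrinsicE_append, tailE_top hn (isTab_of_mem hs hV), add_zero]
  intro v hv
  exact h1 _ (hm.2 ▸ List.mem_map_of_mem hv)

theorem rotation_tab {n : ℕ} (hn : 1 ≤ n) {V : List (Finset ℕ)} (hV : IsTab n V)
    (h1 : ∀ v ∈ V, 1 ≤ v.card) :
    intrinsicE n (V ++ [{1}]) + (V.map (bitOf 1)).sum =
      intrinsicE n (V.map (rotCol n)) + V.length := by
  rw [intrinsicE_append]
  induction V with
  | nil => rfl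
  | cons v V ih =>
    obtain ⟨a, b, c⟩ := hV.cons
    obtain ⟨d, e⟩ := carry_wf a b
    have := ih c (fun v hv => h1 v (by simp [hv]))
    have h2 := Hloc_singleton_one hn d (e ▸ h1 v (by simp))
    have h3 := rotation_row hn a b
    simp only [intrinsicE, tailE, List.map_cons, List.sum_cons, List.length_cons]
    omega

theorem mon_rotCol {n : ℕ} (hn : 1 ≤ n) {V : List (Finset ℕ)} (hV : ∀ v ∈ V, v ⊆ Finset.Icc 1 n)
    (x : ℕ → ℂ) {q : ℂ} (hq : q ≠ 0) :
    mon x V = q ^ (V.map (bitOf 1)).sum *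
      mon (fun l => if l = n then x 1 / q else x (l + 1)) (V.map (rotCol n)) := by
  induction V with
  | nil => simp
  | cons v V ih =>
    rw [mon_cons, ih fun v hv => hV v (by simp [hv])]
    simp only [List.map_cons, mon_cons, List.sum_cons, pow_add]
    have : ∏ a ∈ v, x a = q ^ bitOf 1 v *
        ∏ a ∈ rotCol n v, (if a = n then x 1 / q else x (a + 1)) := by
      have hv := hV v (by simp)
      have e1 : q ^ bitOf 1 v = ∏ a ∈ rotCol n v, (if a = n then q else 1) := by
        have hm : n ∈ rotCol n v ↔ 1 ∈ v := by
          rw [rotCol, Finset.mem_filter]; simp [rotLetter, hn]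
        rw [Finset.prod_ite_eq']
        simp only [hm, bitOf]
        split_ifs <;> simp
      rw [e1, ← Finset.prod_mul_distrib]
      conv_lhs => rw [← map_rotCol hv]
      rw [Finset.prod_image fun a ha b hb h =>
        (rotLetter_inj (rotCol_subset n v ha) (rotCol_subset n v hb)).1 h]
      refine Finset.prod_congr rfl fun a _ => ?_
      unfold rotLetter
      split_ifs
      · field_simp
      · simp
    rw [this]; ring

theorem gsum_one {n : ℕ} (hn : 1 ≤ n) {q : ℂ} (hq : q ≠ 0) {s : List ℕ}
    (hs : s.Pairwise (· ≥ ·)) (h1 : ∀ h ∈ s, 1 ≤ h) (x : ℕ → ℂ) :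
    gsum n q s 1 x =
      q ^ s.length * wsum n q s (fun l => if l = n then x 1 / q else x (l + 1)) := by
  rw [gsum, wsum, Finset.mul_sum]
  have hmap : Set.MapsTo (List.map (rotCol n)) (colsOf n s : Set (List (Finset ℕ)))
      (colsOf n s) := by
    intro V hV
    rw [Finset.mem_coe, mem_colsOf] at hV ⊢
    constructor
    · simp only [List.mem_map]
      rintro _ ⟨v, _, rfl⟩
      exact rotCol_subset _ _
    · rw [← hV.2, List.map_map]
      exact List.map_congr_left fun v hv => card_rotCol (hV.1 v hv)
  have hinj : Set.InjOn (List.map (rotCol n)) (colsOf n s : Set (List (Finset ℕ))) := by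
    intro V hV W hW h
    rw [Finset.mem_coe, mem_colsOf] at hV hW
    have h2 := congrArg (List.map (Finset.image (rotLetter n))) h
    rw [List.map_map, List.map_map] at h2
    have e : ∀ U : List (Finset ℕ), (∀ v ∈ U, v ⊆ Finset.Icc 1 n) →
        U.map (Finset.image (rotLetter n) ∘ rotCol n) = U := by
      intro U hU
      conv_rhs => rw [← List.map_id U]
      exact List.map_congr_left fun v hv => map_rotCol (hU v hv)
    rwa [e V hV.1, e W hW.1] at h2
  refine Finset.sum_nbij (List.map (rotCol n)) hmap hinj
    (Finset.surjOn_of_injOn_of_card_le _ hmap hinj le_rfl) fun V hV => ?_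
  have hm := mem_colsOf.1 hV
  have hlen : V.length = s.length := by rw [← hm.2, List.length_map]
  have := rotation_tab hn (isTab_of_mem hs hV) (fun v hv => h1 _ (hm.2 ▸ List.mem_map_of_mem hv))
  rw [mon_rotCol hn hm.1 x hq, ← mul_assoc, ← pow_add, this, pow_add, hlen]
  ring


/-! ### Crystal operators -/

/-- The number of times the lowering operator acts on a column. -/
def phiCol (i : ℕ) (v : Finset ℕ) : ℕ := if i ∈ v ∧ i + 1 ∉ v then 1 else 0

/-- The number of times the raising operator acts on a column. -/
def epsCol (i : ℕ) (v : Finset ℕ) : ℕ := if i + 1 ∈ v ∧ i ∉ v then 1 else 0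

/-- Replace the letter `i` by `i + 1`. -/
def lowerCol (i : ℕ) (v : Finset ℕ) : Finset ℕ := insert (i + 1) (v.erase i)

/-- Replace the letter `i + 1` by `i`. -/
def raiseCol (i : ℕ) (v : Finset ℕ) : Finset ℕ := insert i (v.erase (i + 1))

/-- The number of times the lowering operator acts on a list of columns. -/
def phiL (i : ℕ) : List (Finset ℕ) → ℕ
  | [] => 0
  | x :: ys => phiCol i x + (phiL i ys - epsCol i x)

/-- The number of times the raising operator acts on a list of columns. -/
def epsL (i : ℕ) : List (Finset ℕ) → ℕ
  | [] => 0
  | x :: ys => epsL i ys + (epsCol i x - phiL i ys)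

/-- The lowering operator on lists of columns. -/
def lowerL (i : ℕ) : List (Finset ℕ) → List (Finset ℕ)
  | [] => []
  | x :: ys => if epsCol i x < phiL i ys then x :: lowerL i ys else lowerCol i x :: ys

/-- The raising operator on lists of columns. -/
def raiseL (i : ℕ) : List (Finset ℕ) → List (Finset ℕ)
  | [] => []
  | x :: ys => if phiL i ys < epsCol i x then raiseCol i x :: ys else x :: raiseL i ys

theorem phiCol_eq_one {i : ℕ} {v : Finset ℕ} : phiCol i v = 1 ↔ i ∈ v ∧ i + 1 ∉ v := by
  unfold phiCol; split_ifs <;> simp_all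

theorem epsCol_eq_one {i : ℕ} {v : Finset ℕ} : epsCol i v = 1 ↔ i + 1 ∈ v ∧ i ∉ v := by
  unfold epsCol; split_ifs <;> simp_all

theorem epsCol_le (i : ℕ) (v : Finset ℕ) : epsCol i v ≤ 1 := by unfold epsCol; split_ifs <;> simp

theorem phiCol_add_epsCol (i : ℕ) (v : Finset ℕ) : phiCol i v + epsCol i v ≤ 1 := by
  by_cases h : i ∈ v <;> by_cases h' : i + 1 ∈ v <;> simp [phiCol, epsCol, h, h']

theorem phiCol_bitOf (i : ℕ) (v : Finset ℕ) :
    phiCol i v + bitOf (i + 1) v = epsCol i v + bitOf i v := by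
  by_cases h : i ∈ v <;> by_cases h' : i + 1 ∈ v <;> simp [phiCol, epsCol, bitOf, h, h']

theorem mem_lowerCol {i l : ℕ} {v : Finset ℕ} :
    l ∈ lowerCol i v ↔ l = i + 1 ∨ (l ≠ i ∧ l ∈ v) := by simp [lowerCol]

theorem mem_raiseCol {i l : ℕ} {v : Finset ℕ} :
    l ∈ raiseCol i v ↔ l = i ∨ (l ≠ i + 1 ∧ l ∈ v) := by simp [raiseCol]

theorem raise_lowerCol {i : ℕ} {v : Finset ℕ} (h : phiCol i v = 1) :
    raiseCol i (lowerCol i v) = v := by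
  rw [phiCol_eq_one] at h
  ext l
  rw [mem_raiseCol, mem_lowerCol]
  by_cases h1 : l = i
  · subst h1; simp [h.1]
  · by_cases h2 : l = i + 1
    · subst h2; simp [h.2]
    · simp [h1, h2]

theorem lower_raiseCol {i : ℕ} {v : Finset ℕ} (h : epsCol i v = 1) :
    lowerCol i (raiseCol i v) = v := by
  rw [epsCol_eq_one] at h
  ext l
  rw [mem_lowerCol, mem_raiseCol]
  by_cases h1 : l = i
  · subst h1; simp [h.2]
  · by_cases h2 : l = i + 1
    · subst h2; simp [h.1]
    · simp [h1, h2]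

theorem phi_lowerCol (i : ℕ) (v : Finset ℕ) : phiCol i (lowerCol i v) = 0 := by
  simp [phiCol, mem_lowerCol]

theorem eps_lowerCol (i : ℕ) (v : Finset ℕ) : epsCol i (lowerCol i v) = 1 := by
  simp [epsCol, mem_lowerCol]

theorem phi_raiseCol (i : ℕ) (v : Finset ℕ) : phiCol i (raiseCol i v) = 1 := by
  simp [phiCol, mem_raiseCol]

theorem eps_raiseCol (i : ℕ) (v : Finset ℕ) : epsCol i (raiseCol i v) = 0 := by
  simp [epsCol, mem_raiseCol]

theorem lowerL_spec {i : ℕ} {V : List (Finset ℕ)} (h : 0 < phiL i V) :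
    phiL i (lowerL i V) + 1 = phiL i V ∧ epsL i (lowerL i V) = epsL i V + 1 ∧
      raiseL i (lowerL i V) = V := by
  induction V with
  | nil => simp [phiL] at h
  | cons x ys ih =>
    have hle := phiCol_add_epsCol i x
    simp only [phiL] at h
    by_cases hc : epsCol i x < phiL i ys
    · obtain ⟨h1, h2, h3⟩ := ih (by omega)
      have : ¬ phiL i (lowerL i ys) < epsCol i x := by omega
      simp only [lowerL, hc, if_true, phiL, epsL, raiseL, this, if_false, h3, and_true]
      omega
    · have hx : phiCol i x = 1 := by omega
      have hy : phiL i ys = 0 := by omega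
      simp [lowerL, phiL, epsL, raiseL, phi_lowerCol, eps_lowerCol, hy, raise_lowerCol hx, hx]
      omega

theorem raiseL_spec {i : ℕ} {V : List (Finset ℕ)} (h : 0 < epsL i V) :
    phiL i (raiseL i V) = phiL i V + 1 ∧ epsL i (raiseL i V) + 1 = epsL i V ∧
      lowerL i (raiseL i V) = V := by
  induction V with
  | nil => simp [epsL] at h
  | cons x ys ih =>
    have hle := phiCol_add_epsCol i x
    simp only [epsL] at h
    by_cases hc : phiL i ys < epsCol i x
    · have hx : epsCol i x = 1 := by omega
      have hy : phiL i ys = 0 := by omega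
      simp [lowerL, phiL, epsL, raiseL, phi_raiseCol, eps_raiseCol, hy, lower_raiseCol hx, hx]
      omega
    · obtain ⟨h1, h2, h3⟩ := ih (by omega)
      have : epsCol i x < phiL i (raiseL i ys) := by omega
      simp only [lowerL, hc, if_true, phiL, epsL, raiseL, this, if_false, h3, and_true]
      omega

theorem phiL_bitOf (i : ℕ) (V : List (Finset ℕ)) :
    phiL i V + (V.map (bitOf (i + 1))).sum = epsL i V + (V.map (bitOf i)).sum := by
  induction V with
  | nil => rfl
  | cons x ys ih =>
    have := phiCol_bitOf i x
    simp only [phiL, epsL, List.map_cons, List.sum_cons]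
    omega

theorem desc_split {n i : ℕ} (hi : i + 1 ≤ n) :
    ∃ A : List ℕ, desc (n + 1) = A ++ (i + 1) :: i :: desc i ∧ ∀ l ∈ A, i + 1 < l := by
  obtain ⟨d, rfl⟩ : ∃ d, n = i + 1 + d := ⟨n - (i + 1), by omega⟩
  clear hi
  induction d with
  | zero => exact ⟨[], rfl, by simp⟩
  | succ d ih =>
    obtain ⟨A, h1, h2⟩ := ih
    refine ⟨(i + 1 + d + 1) :: A, ?_, ?_⟩
    · rw [← add_assoc, desc, h1]; rfl
    · simp only [List.mem_cons, forall_eq_or_imp]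
      exact ⟨by omega, h2⟩

theorem two_letter {n i : ℕ} (hi : i + 1 ≤ n) {x y x' y' : Finset ℕ} (hx : x ⊆ Finset.Icc 1 n)
    (hy : y ⊆ Finset.Icc 1 n) (hc : y.card ≤ x.card) (hx' : x' ⊆ Finset.Icc 1 n)
    (hy' : y' ⊆ Finset.Icc 1 n) (hc' : y'.card ≤ x'.card)
    (hxx : ∀ l, l ≠ i → l ≠ i + 1 → (l ∈ x ↔ l ∈ x'))
    (hyy : ∀ l, l ≠ i → l ≠ i + 1 → (l ∈ y ↔ l ∈ y'))
    (hf : ∀ c, flow x y [i + 1, i] c = flow x' y' [i + 1, i] c) :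
    Hloc n x y = Hloc n x' y' ∧ (∀ l, l ≠ i → l ≠ i + 1 → (l ∈ Rright n x y ↔ l ∈ Rright n x' y')) ∧
    ∃ c, (i + 1 ∈ Rright n x y ↔ i + 1 ∈ y ∨ (i + 1 ∈ x ∧ c = 0)) ∧
      (i + 1 ∈ Rright n x' y' ↔ i + 1 ∈ y' ∨ (i + 1 ∈ x' ∧ c = 0)) ∧
      (i ∈ Rright n x y ↔ i ∈ y ∨ (i ∈ x ∧ c + bitOf (i + 1) y - bitOf (i + 1) x = 0)) ∧
      (i ∈ Rright n x' y' ↔ i ∈ y' ∨ (i ∈ x' ∧ c + bitOf (i + 1) y' - bitOf (i + 1) x' = 0)) := by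
  obtain ⟨A, hA, hA'⟩ := desc_split hi
  have hAc : ∀ l ∈ A, (l ∈ x ↔ l ∈ x') ∧ (l ∈ y ↔ l ∈ y') := by
    intro l hl
    have := hA' l hl
    exact ⟨hxx l (by omega) (by omega), hyy l (by omega) (by omega)⟩
  have hBc : ∀ l ∈ desc i, (l ∈ x ↔ l ∈ x') ∧ (l ∈ y ↔ l ∈ y') := by
    intro l hl
    rw [mem_desc] at hl
    exact ⟨hxx l (by omega) (by omega), hyy l (by omega) (by omega)⟩
  have hfl : ∀ c, flow x y (desc (n + 1)) c = flow x' y' (desc (n + 1)) c := by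
    intro c
    rw [hA, show (i + 1) :: i :: desc i = [i + 1, i] ++ desc i from rfl]
    simp only [flow_append]
    rw [flow_congr hAc, hf, flow_congr hBc]
  have hH : Hloc n x y = Hloc n x' y' := by
    rw [Hloc_eq_flow hx hy hc, Hloc_eq_flow hx' hy' hc', hfl]
  set c := flow x y A (Hloc n x y) with hcdef
  have hcdef' : flow x' y' A (Hloc n x y) = c := by rw [hcdef, flow_congr hAc]
  have hR : Rright n x y = outflow x y A (Hloc n x y) ∪ (outflow x y [i + 1, i] c ∪
      outflow x y (desc i) (flow x y [i + 1, i] c)) := by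
    rw [Rright_eq_outflow hx hy hc, hA, show (i + 1) :: i :: desc i = [i + 1, i] ++ desc i from rfl]
    simp only [outflow_append, hcdef]
  have hR' : Rright n x' y' = outflow x y A (Hloc n x y) ∪ (outflow x' y' [i + 1, i] c ∪
      outflow x y (desc i) (flow x y [i + 1, i] c)) := by
    rw [Rright_eq_outflow hx' hy' hc', hA,
      show (i + 1) :: i :: desc i = [i + 1, i] ++ desc i from rfl]
    simp only [outflow_append, ← hH, hcdef']
    rw [outflow_congr hAc, outflow_congr hBc, hf]
  have hnA : ∀ l, l = i ∨ l = i + 1 → l ∉ outflow x y A (Hloc n x y) := by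
    intro l hl h
    have h2 := hA' l (by simpa using outflow_subset _ _ _ _ h)
    omega
  have hnB : ∀ l, l = i ∨ l = i + 1 → l ∉ outflow x y (desc i) (flow x y [i + 1, i] c) := by
    intro l hl h
    have : l ∈ desc i := by simpa using outflow_subset _ _ _ _ h
    rw [mem_desc] at this
    omega
  have hmid : ∀ x y : Finset ℕ, ∀ l, l ≠ i → l ≠ i + 1 → l ∉ outflow x y [i + 1, i] c := by
    intro x y l h1 h2 h
    have := outflow_subset _ _ _ _ h
    simp [h1, h2] at this
  have hmidi : ∀ x y : Finset ℕ, (i ∈ outflow x y [i + 1, i] c ↔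
      i ∈ y ∨ (i ∈ x ∧ c + bitOf (i + 1) y - bitOf (i + 1) x = 0)) := by
    intro x y
    rw [outflow, Finset.mem_union, mem_outflow_cons (by simp)]
    have : i ∉ (if i + 1 ∈ y ∨ (i + 1 ∈ x ∧ c = 0) then {i + 1} else ∅ : Finset ℕ) := by
      split_ifs <;> simp
    simp only [this, false_or]
  refine ⟨hH, fun l h1 h2 => ?_, c, ?_, ?_, ?_, ?_⟩
  · rw [hR, hR']
    simp only [Finset.mem_union, hmid _ _ l h1 h2]
  · rw [hR]
    simp only [Finset.mem_union, hnA _ (Or.inr rfl), hnB _ (Or.inr rfl), false_or, or_false]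
    rw [mem_outflow_cons (by simp)]
  · rw [hR']
    simp only [Finset.mem_union, hnA _ (Or.inr rfl), hnB _ (Or.inr rfl), false_or, or_false]
    rw [mem_outflow_cons (by simp)]
  · rw [hR]
    simp only [Finset.mem_union, hnA _ (Or.inl rfl), hnB _ (Or.inl rfl), false_or, or_false, hmidi]
  · rw [hR']
    simp only [Finset.mem_union, hnA _ (Or.inl rfl), hnB _ (Or.inl rfl), false_or, or_false, hmidi]

theorem lowerCol_subset {n i : ℕ} (hi : i + 1 ≤ n) {v : Finset ℕ} (hv : v ⊆ Finset.Icc 1 n) :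
    lowerCol i v ⊆ Finset.Icc 1 n := by
  intro l hl
  rw [mem_lowerCol] at hl
  rcases hl with rfl | ⟨_, hl⟩
  · simp; omega
  · exact hv hl

theorem raiseCol_subset {n i : ℕ} (h1 : 1 ≤ i) (hi : i + 1 ≤ n) {v : Finset ℕ}
    (hv : v ⊆ Finset.Icc 1 n) : raiseCol i v ⊆ Finset.Icc 1 n := by
  intro l hl
  rw [mem_raiseCol] at hl
  rcases hl with rfl | ⟨_, hl⟩
  · simp; omega
  · exact hv hl

theorem card_lowerCol {i : ℕ} {v : Finset ℕ} (h : phiCol i v = 1) :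
    (lowerCol i v).card = v.card := by
  rw [phiCol_eq_one] at h
  rw [lowerCol, Finset.card_insert_of_notMem (by simp [h.2]), Finset.card_erase_add_one h.1]

theorem lowerL_map_card {i : ℕ} {V : List (Finset ℕ)} (h : 0 < phiL i V) :
    (lowerL i V).map Finset.card = V.map Finset.card := by
  induction V with
  | nil => rfl
  | cons x ys ih =>
    have hle := phiCol_add_epsCol i x
    simp only [phiL] at h
    by_cases hc : epsCol i x < phiL i ys
    · simp [lowerL, hc, ih (by omega)]
    · simp [lowerL, hc, card_lowerCol (i := i) (v := x) (by omega)]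

theorem raiseL_map_card {i : ℕ} {V : List (Finset ℕ)} (h : 0 < epsL i V) :
    (raiseL i V).map Finset.card = V.map Finset.card := by
  rw [← (raiseL_spec h).2.2, lowerL_map_card (by rw [(raiseL_spec h).1]; omega),
    (raiseL_spec h).2.2]

theorem lowerL_subset {n i : ℕ} (hi : i + 1 ≤ n) {V : List (Finset ℕ)}
    (hV : ∀ v ∈ V, v ⊆ Finset.Icc 1 n) : ∀ v ∈ lowerL i V, v ⊆ Finset.Icc 1 n := by
  induction V with
  | nil => simp [lowerL]
  | cons x ys ih =>
    simp only [List.forall_mem_cons] at hV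
    rw [lowerL]
    split_ifs
    · simp only [List.forall_mem_cons]; exact ⟨hV.1, ih hV.2⟩
    · simp only [List.forall_mem_cons]; exact ⟨lowerCol_subset hi hV.1, hV.2⟩

theorem raiseL_subset {n i : ℕ} (h1 : 1 ≤ i) (hi : i + 1 ≤ n) {V : List (Finset ℕ)}
    (hV : ∀ v ∈ V, v ⊆ Finset.Icc 1 n) : ∀ v ∈ raiseL i V, v ⊆ Finset.Icc 1 n := by
  induction V with
  | nil => simp [raiseL]
  | cons x ys ih =>
    simp only [List.forall_mem_cons] at hV
    rw [raiseL]
    split_ifs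
    · simp only [List.forall_mem_cons]; exact ⟨raiseCol_subset h1 hi hV.1, hV.2⟩
    · simp only [List.forall_mem_cons]; exact ⟨hV.1, ih hV.2⟩

theorem lowerL_mem {n i : ℕ} (hi : i + 1 ≤ n) {s : List ℕ} {V : List (Finset ℕ)}
    (hV : V ∈ colsOf n s) (h : 0 < phiL i V) : lowerL i V ∈ colsOf n s := by
  rw [mem_colsOf] at hV ⊢
  exact ⟨lowerL_subset hi hV.1, by rw [lowerL_map_card h, hV.2]⟩

theorem raiseL_mem {n i : ℕ} (h1 : 1 ≤ i) (hi : i + 1 ≤ n) {s : List ℕ} {V : List (Finset ℕ)}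
    (hV : V ∈ colsOf n s) (h : 0 < epsL i V) : raiseL i V ∈ colsOf n s := by
  rw [mem_colsOf] at hV ⊢
  exact ⟨raiseL_subset h1 hi hV.1, by rw [raiseL_map_card h, hV.2]⟩

theorem eq_or_lower {i : ℕ} {u v : Finset ℕ} (h : ∀ l, l ≠ i → l ≠ i + 1 → (l ∈ u ↔ l ∈ v))
    (h' : ((i ∈ u ↔ i ∈ v) ∧ (i + 1 ∈ u ↔ i + 1 ∈ v)) ∨
      (i ∈ u ∧ i + 1 ∉ u ∧ i ∉ v ∧ i + 1 ∈ v)) :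
    v = u ∨ (phiCol i u = 1 ∧ v = lowerCol i u) := by
  rcases h' with h' | h'
  · left
    ext l
    by_cases h1 : l = i
    · subst h1; exact h'.1.symm
    · by_cases h2 : l = i + 1
      · subst h2; exact h'.2.symm
      · exact (h l h1 h2).symm
  · right
    refine ⟨phiCol_eq_one.2 ⟨h'.1, h'.2.1⟩, ?_⟩
    ext l
    rw [mem_lowerCol]
    by_cases h1 : l = i
    · subst h1; simp [h'.2.2.1]
    · by_cases h2 : l = i + 1
      · subst h2; simp [h'.2.2.2]
      · simp [h1, h2, h l h1 h2]


theorem local_inner {n i : ℕ} (hi : i + 1 ≤ n) {x y : Finset ℕ} (hx : x ⊆ Finset.Icc 1 n)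
    (hy : y ⊆ Finset.Icc 1 n) (hc : y.card ≤ x.card) {p : ℕ} (h1 : epsCol i y < p)
    (h2 : epsCol i x < phiCol i y + (p - epsCol i y)) : epsCol i (Rright n x y) < p := by
  obtain ⟨-, -, c, e1, -, e2, -⟩ := two_letter hi hx hy hc hx hy hc (fun _ _ _ => Iff.rfl)
    (fun _ _ _ => Iff.rfl) (fun _ => rfl)
  have := epsCol_le i (Rright n x y)
  by_contra hcon
  have h3 : epsCol i (Rright n x y) = 1 := by omega
  have h4 : p = 1 := by omega
  have h5 : epsCol i y = 0 := by omega
  subst h4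
  rw [epsCol_eq_one, e1, e2] at h3
  by_cases hx1 : i ∈ x <;> by_cases hx2 : i + 1 ∈ x <;> by_cases hy1 : i ∈ y <;>
    by_cases hy2 : i + 1 ∈ y <;> simp [epsCol, phiCol, bitOf, *] at h2 h3 h5
  omega

theorem flow_pair (x y : Finset ℕ) (i c : ℕ) : flow x y [i + 1, i] c =
    c + bitOf (i + 1) y - bitOf (i + 1) x + bitOf i y - bitOf i x := rfl

theorem local_right {n i : ℕ} (hi : i + 1 ≤ n) {x y : Finset ℕ} (hx : x ⊆ Finset.Icc 1 n)
    (hy : y ⊆ Finset.Icc 1 n) (hc : y.card ≤ x.card) (h1 : phiCol i y = 1)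
    (h2 : epsCol i x = 0) : Hloc n x (lowerCol i y) = Hloc n x y ∧
      (Rright n x (lowerCol i y) = Rright n x y ∨ (phiCol i (Rright n x y) = 1 ∧
        Rright n x (lowerCol i y) = lowerCol i (Rright n x y))) := by
  have hy' := phiCol_eq_one.1 h1
  obtain ⟨e0, er, c, e1, e1', e2, e2'⟩ := two_letter hi hx hy hc hx (lowerCol_subset hi hy)
    (by rwa [card_lowerCol h1]) (fun _ _ _ => Iff.rfl)
    (fun l a b => by rw [mem_lowerCol]; simp [a, b]) (fun c => by
      simp only [flow_pair]
      by_cases hx1 : i ∈ x <;> by_cases hx2 : i + 1 ∈ x <;>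
        simp [epsCol, hx1, hx2] at h2 <;> simp [bitOf, mem_lowerCol, *])
  refine ⟨e0.symm, eq_or_lower er ?_⟩
  rw [e1, e2, e1', e2']
  by_cases hx1 : i ∈ x <;> by_cases hx2 : i + 1 ∈ x <;> by_cases hc0 : c = 0 <;>
    simp [epsCol, hx1, hx2] at h2 <;> simp [bitOf, mem_lowerCol, *]

theorem local_left {n i : ℕ} (hi : i + 1 ≤ n) {x y : Finset ℕ} (hx : x ⊆ Finset.Icc 1 n)
    (hy : y ⊆ Finset.Icc 1 n) (hc : y.card ≤ x.card) (h1 : phiCol i x = 1)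
    (h2 : phiCol i y = 0) : Hloc n (lowerCol i x) y = Hloc n x y ∧
      (Rright n (lowerCol i x) y = Rright n x y ∨ (phiCol i (Rright n x y) = 1 ∧ epsCol i y = 0 ∧
        Rright n (lowerCol i x) y = lowerCol i (Rright n x y))) := by
  have hx' := phiCol_eq_one.1 h1
  obtain ⟨e0, er, c, e1, e1', e2, e2'⟩ := two_letter hi hx hy hc (lowerCol_subset hi hx) hy
    (by rwa [card_lowerCol h1])
    (fun l a b => by rw [mem_lowerCol]; simp [a, b]) (fun _ _ _ => Iff.rfl) (fun c => by
      simp only [flow_pair]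
      by_cases hy1 : i ∈ y <;> by_cases hy2 : i + 1 ∈ y <;>
        simp [phiCol, hy1, hy2] at h2 <;> simp [bitOf, mem_lowerCol, *])
  refine ⟨e0.symm, ?_⟩
  have key : Rright n (lowerCol i x) y = Rright n x y ∨ (phiCol i (Rright n x y) = 1 ∧
        Rright n (lowerCol i x) y = lowerCol i (Rright n x y)) := by
    refine eq_or_lower er ?_
    rw [e1, e2, e1', e2']
    by_cases hy1 : i ∈ y <;> by_cases hy2 : i + 1 ∈ y <;> by_cases hc0 : c = 0 <;>
      simp [phiCol, hy1, hy2] at h2 <;> simp [bitOf, mem_lowerCol, *]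
  rcases key with key | ⟨k1, k2⟩
  · exact Or.inl key
  · refine Or.inr ⟨k1, ?_, k2⟩
    by_contra hcon
    have h3 : epsCol i y = 1 := by have := epsCol_le i y; omega
    rw [phiCol_eq_one, e1] at k1
    rw [epsCol_eq_one] at h3
    exact k1.2 (Or.inl h3.1)

theorem rowE_lower {n i : ℕ} (hi : i + 1 ≤ n) {ys : List (Finset ℕ)} {x : Finset ℕ}
    (hx : x ⊆ Finset.Icc 1 n) (hys : ∀ y ∈ ys, y ⊆ Finset.Icc 1 n ∧ y.card ≤ x.card) :
    (epsCol i x < phiL i ys → rowE n x (lowerL i ys) = rowE n x ys) ∧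
    (phiCol i x = 1 → phiL i ys = 0 → rowE n (lowerCol i x) ys = rowE n x ys) := by
  induction ys generalizing x with
  | nil => simp [rowE, lowerL]
  | cons y zs ih =>
    obtain ⟨h1, h2⟩ := hys y (by simp)
    have ih' := ih (Rright_subset hx h1 h2) (by
      rw [card_Rright hx h1 h2]; exact fun y hy => hys y (by simp [hy]))
    constructor
    · intro h
      simp only [phiL] at h
      by_cases hc : epsCol i y < phiL i zs
      · simp only [lowerL, hc, if_true, rowE]
        rw [ih'.1 (local_inner hi hx h1 h2 hc h)]
      · simp only [lowerL, hc, if_false, rowE]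
        have hle := phiCol_add_epsCol i y
        obtain ⟨e1, e2⟩ := local_right hi hx h1 h2 (i := i) (by omega) (by omega)
        rw [e1]
        rcases e2 with e2 | ⟨e2, e3⟩
        · rw [e2]
        · rw [e3, ih'.2 e2 (by omega)]
    · intro h h'
      simp only [phiL] at h'
      simp only [rowE]
      obtain ⟨e1, e2⟩ := local_left hi hx h1 h2 (i := i) h (by omega)
      rw [e1]
      rcases e2 with e2 | ⟨e2, e3, e4⟩
      · rw [e2]
      · rw [e4, ih'.2 e2 (by omega)]

theorem intrinsicE_lowerL {n i : ℕ} (hi : i + 1 ≤ n) {V : List (Finset ℕ)} (hV : IsTab n V)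
    (h : 0 < phiL i V) : intrinsicE n (lowerL i V) = intrinsicE n V := by
  induction V with
  | nil => rfl
  | cons x ys ih =>
    obtain ⟨a, b, c⟩ := hV.cons
    obtain ⟨r1, r2⟩ := rowE_lower hi a b (i := i)
    have hle := phiCol_add_epsCol i x
    simp only [phiL] at h
    by_cases hc : epsCol i x < phiL i ys
    · simp only [lowerL, hc, if_true, intrinsicE]
      rw [r1 hc, ih c (by omega)]
    · simp only [lowerL, hc, if_false, intrinsicE]
      rw [r2 (by omega) (by omega)]

/-- The monomial in the letters different from `i` and `i + 1`. -/
def restMon (i : ℕ) (x : ℕ → ℂ) (V : List (Finset ℕ)) : ℂ :=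
  (V.map fun v => ∏ a ∈ v with a ≠ i ∧ a ≠ i + 1, x a).prod

theorem mon_eq_restMon (i : ℕ) (x : ℕ → ℂ) (V : List (Finset ℕ)) :
    mon x V = x i ^ (V.map (bitOf i)).sum * x (i + 1) ^ (V.map (bitOf (i + 1))).sum *
      restMon i x V := by
  induction V with
  | nil => simp [restMon]
  | cons v V ih =>
    rw [mon_cons, ih]
    simp only [restMon, List.map_cons, List.prod_cons, List.sum_cons, pow_add]
    have : ∏ a ∈ v, x a = x i ^ bitOf i v * x (i + 1) ^ bitOf (i + 1) v *
        ∏ a ∈ v with a ≠ i ∧ a ≠ i + 1, x a := by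
      have e : ∀ j : ℕ, x j ^ bitOf j v = ∏ a ∈ v, if a = j then x j else 1 := by
        intro j
        rw [Finset.prod_ite_eq']
        unfold bitOf; split_ifs <;> simp
      rw [e, e, Finset.prod_filter, ← Finset.prod_mul_distrib, ← Finset.prod_mul_distrib]
      refine Finset.prod_congr rfl fun a _ => ?_
      by_cases h1 : a = i
      · simp [h1]
      · by_cases h2 : a = i + 1 <;> simp [h1, h2]
    rw [this]; ring

theorem restMon_lowerL (i : ℕ) (x : ℕ → ℂ) (V : List (Finset ℕ)) :
    restMon i x (lowerL i V) = restMon i x V := by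
  induction V with
  | nil => rfl
  | cons v V ih =>
    rw [lowerL]
    split_ifs
    · simp only [restMon, List.map_cons, List.prod_cons] at ih ⊢
      rw [ih]
    · simp only [restMon, List.map_cons, List.prod_cons]
      congr 2
      ext a
      simp only [Finset.mem_filter, mem_lowerCol]
      constructor
      · rintro ⟨h | h, h1, h2⟩ <;> tauto
      · tauto

theorem bitSum_lowerL {i : ℕ} {V : List (Finset ℕ)} (h : 0 < phiL i V) :
    ((lowerL i V).map (bitOf i)).sum + ((lowerL i V).map (bitOf (i + 1))).sum =
      (V.map (bitOf i)).sum + (V.map (bitOf (i + 1))).sum := by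
  induction V with
  | nil => rfl
  | cons x ys ih =>
    have hle := phiCol_add_epsCol i x
    simp only [phiL] at h
    by_cases hc : epsCol i x < phiL i ys
    · have := ih (by omega)
      simp only [lowerL, hc, if_true, List.map_cons, List.sum_cons]; omega
    · have hx := phiCol_eq_one.1 (show phiCol i x = 1 by omega)
      simp only [lowerL, hc, if_false, List.map_cons, List.sum_cons]
      have e1 : bitOf i (lowerCol i x) = 0 := by simp [bitOf, mem_lowerCol]
      have e2 : bitOf (i + 1) (lowerCol i x) = 1 := by simp [bitOf, mem_lowerCol]
      have e3 : bitOf i x = 1 := by simp [bitOf, hx.1]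
      have e4 : bitOf (i + 1) x = 0 := by simp [bitOf, hx.2]
      omega

/-- Crystal reflection symmetry: a sum over a set of lists closed under the crystal operators,
with weights invariant under them, is symmetric in `x i` and `x (i + 1)`. -/
theorem crystal_symm {i : ℕ} (T : Finset (List (Finset ℕ))) (w : List (Finset ℕ) → ℂ)
    (hT : ∀ V ∈ T, 0 < phiL i V → lowerL i V ∈ T) (hT' : ∀ V ∈ T, 0 < epsL i V → raiseL i V ∈ T)
    (hw : ∀ V ∈ T, 0 < phiL i V → w (lowerL i V) = w V) (x : ℕ → ℂ) :
    ∑ V ∈ T, w V * mon (x ∘ Equiv.swap i (i + 1)) V = ∑ V ∈ T, w V * mon x V := by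
  let inv : List (Finset ℕ) → ℂ × ℕ := fun V =>
    (restMon i x V, (V.map (bitOf i)).sum + (V.map (bitOf (i + 1))).sum)
  have hinv : ∀ V, 0 < phiL i V → inv (lowerL i V) = inv V := fun V hV =>
    Prod.ext (restMon_lowerL i x V) (bitSum_lowerL hV)
  have low : ∀ k, ∀ V ∈ T, k ≤ phiL i V → (lowerL i)^[k] V ∈ T ∧
      phiL i ((lowerL i)^[k] V) + k = phiL i V ∧ epsL i ((lowerL i)^[k] V) = epsL i V + k ∧
      (raiseL i)^[k] ((lowerL i)^[k] V) = V ∧ w ((lowerL i)^[k] V) = w V ∧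
      inv ((lowerL i)^[k] V) = inv V := by
    intro k
    induction k with
    | zero => intro V hV _; exact ⟨hV, rfl, rfl, rfl, rfl, rfl⟩
    | succ k ih =>
      intro V hV hk
      obtain ⟨a1, a2, a3⟩ := lowerL_spec (i := i) (V := V) (by omega)
      obtain ⟨b1, b2, b3, b4, b5, b6⟩ := ih (lowerL i V) (hT V hV (by omega)) (by omega)
      rw [Function.iterate_succ_apply, Function.iterate_succ_apply', b4]
      exact ⟨b1, by omega, by omega, a3, by rw [b5, hw V hV (by omega)],
        by rw [b6, hinv _ (by omega)]⟩
  have up : ∀ k, ∀ V ∈ T, k ≤ epsL i V → (raiseL i)^[k] V ∈ T ∧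
      phiL i ((raiseL i)^[k] V) = phiL i V + k ∧ epsL i ((raiseL i)^[k] V) + k = epsL i V ∧
      (lowerL i)^[k] ((raiseL i)^[k] V) = V ∧ w ((raiseL i)^[k] V) = w V ∧
      inv ((raiseL i)^[k] V) = inv V := by
    intro k
    induction k with
    | zero => intro V hV _; exact ⟨hV, rfl, rfl, rfl, rfl, rfl⟩
    | succ k ih =>
      intro V hV hk
      obtain ⟨a1, a2, a3⟩ := raiseL_spec (i := i) (V := V) (by omega)
      obtain ⟨b1, b2, b3, b4, b5, b6⟩ := ih (raiseL i V) (hT' V hV (by omega)) (by omega)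
      rw [Function.iterate_succ_apply, Function.iterate_succ_apply', b4]
      refine ⟨b1, by omega, by omega, a3, ?_, ?_⟩
      · rw [b5, ← hw _ (hT' V hV (by omega)) (by omega), a3]
      · rw [b6, ← hinv _ (by omega), a3]
  let θ : List (Finset ℕ) → List (Finset ℕ) := fun V =>
    if epsL i V ≤ phiL i V then (lowerL i)^[phiL i V - epsL i V] V
    else (raiseL i)^[epsL i V - phiL i V] V
  have spec : ∀ V ∈ T, θ V ∈ T ∧ phiL i (θ V) = epsL i V ∧ epsL i (θ V) = phiL i V ∧
      θ (θ V) = V ∧ w (θ V) = w V ∧ inv (θ V) = inv V := by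
    intro V hV
    by_cases h : epsL i V ≤ phiL i V
    · obtain ⟨b1, b2, b3, b4, b5, b6⟩ := low (phiL i V - epsL i V) V hV (by omega)
      have e1 : θ V = (lowerL i)^[phiL i V - epsL i V] V := if_pos h
      rw [← e1] at b1 b2 b3 b4 b5 b6
      refine ⟨b1, by omega, by omega, ?_, b5, b6⟩
      by_cases h' : epsL i (θ V) ≤ phiL i (θ V)
      · have : θ (θ V) = (lowerL i)^[phiL i (θ V) - epsL i (θ V)] (θ V) := if_pos h'
        have z : phiL i (θ V) - epsL i (θ V) = 0 := by omega
        have z' : phiL i V - epsL i V = 0 := by omega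
        rw [this, z, e1, z']; rfl
      · have : θ (θ V) = (raiseL i)^[epsL i (θ V) - phiL i (θ V)] (θ V) := if_neg h'
        rw [this]
        convert b4 using 2
        congr 1 <;> omega
    · obtain ⟨b1, b2, b3, b4, b5, b6⟩ := up (epsL i V - phiL i V) V hV (by omega)
      have e1 : θ V = (raiseL i)^[epsL i V - phiL i V] V := if_neg h
      rw [← e1] at b1 b2 b3 b4 b5 b6
      refine ⟨b1, by omega, by omega, ?_, b5, b6⟩
      have : θ (θ V) = (lowerL i)^[phiL i (θ V) - epsL i (θ V)] (θ V) := if_pos (by omega)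
      rw [this]
      convert b4 using 2
      congr 1 <;> omega
  refine Finset.sum_nbij' θ θ (fun V hV => (spec V hV).1) (fun V hV => (spec V hV).1)
    (fun V hV => (spec V hV).2.2.2.1) (fun V hV => (spec V hV).2.2.2.1) fun V hV => ?_
  obtain ⟨b1, b2, b3, b4, b5, b6⟩ := spec V hV
  have c1 := phiL_bitOf i V
  have c2 := phiL_bitOf i (θ V)
  have c4 : restMon i x (θ V) = restMon i x V := congrArg Prod.fst b6
  have c5 : ((θ V).map (bitOf i)).sum + ((θ V).map (bitOf (i + 1))).sum =
      (V.map (bitOf i)).sum + (V.map (bitOf (i + 1))).sum := congrArg Prod.snd b6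
  have c3 : restMon i (x ∘ Equiv.swap i (i + 1)) V = restMon i x V := by
    unfold restMon
    congr 1
    refine List.map_congr_left fun v _ => Finset.prod_congr rfl fun a ha => ?_
    rw [Finset.mem_filter] at ha
    simp [Equiv.swap_apply_of_ne_of_ne ha.2.1 ha.2.2]
  rw [mon_eq_restMon i, mon_eq_restMon i x, c3, c4, b5]
  have d1 : ((θ V).map (bitOf i)).sum = (V.map (bitOf (i + 1))).sum := by omega
  have d2 : ((θ V).map (bitOf (i + 1))).sum = (V.map (bitOf i)).sum := by omega
  rw [d1, d2]
  simp only [Function.comp_apply, Equiv.swap_apply_left, Equiv.swap_apply_right]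
  ring

theorem wsum_swap {n i : ℕ} (h1 : 1 ≤ i) (hi : i + 1 ≤ n) (q : ℂ) {s : List ℕ}
    (hs : s.Pairwise (· ≥ ·)) (x : ℕ → ℂ) :
    wsum n q s (x ∘ Equiv.swap i (i + 1)) = wsum n q s x :=
  crystal_symm _ _ (fun _ hV h => lowerL_mem hi hV h) (fun _ hV h => raiseL_mem h1 hi hV h)
    (fun _ hV h => by rw [intrinsicE_lowerL hi (isTab_of_mem hs hV) h]) x

theorem phiL_append_singleton {i a : ℕ} (ha : a ≠ i) (V : List (Finset ℕ)) :
    phiL i (V ++ [{a}]) = phiL i V := by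
  induction V with
  | nil => simp [phiL, phiCol, Ne.symm ha]
  | cons x ys ih => simp [phiL, ih]

theorem lowerL_append {i : ℕ} (z : Finset ℕ) {V : List (Finset ℕ)} (h : 0 < phiL i V)
    (hap : ∀ U : List (Finset ℕ), phiL i (U ++ [z]) = phiL i U) :
    lowerL i (V ++ [z]) = lowerL i V ++ [z] := by
  induction V with
  | nil => simp [phiL] at h
  | cons x ys ih =>
    simp only [List.cons_append, lowerL, hap]
    by_cases hc : epsCol i x < phiL i ys
    · rw [if_pos hc, if_pos hc, ih (by omega)]; rfl
    · rw [if_neg hc, if_neg hc]; rfl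

theorem isTab_append {n a : ℕ} (ha : a ∈ Finset.Icc 1 n) {V : List (Finset ℕ)} (hV : IsTab n V)
    (h1 : ∀ v ∈ V, 1 ≤ v.card) : IsTab n (V ++ [{a}]) := by
  constructor
  · simp only [List.mem_append, List.mem_singleton]
    rintro v (hv | rfl)
    · exact hV.1 v hv
    · simpa using ha
  · rw [List.map_append, List.pairwise_append]
    refine ⟨hV.2, by simp, ?_⟩
    simpa using h1

theorem gsum_swap {n i a : ℕ} (h1 : 1 ≤ i) (hi : i + 1 ≤ n) (ha : a ∈ Finset.Icc 1 n)
    (hai : a ≠ i) (q : ℂ) {s : List ℕ} (hs : s.Pairwise (· ≥ ·)) (hs1 : ∀ h ∈ s, 1 ≤ h)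
    (x : ℕ → ℂ) : gsum n q s a (x ∘ Equiv.swap i (i + 1)) = gsum n q s a x := by
  refine crystal_symm _ _ (fun _ hV h => lowerL_mem hi hV h)
    (fun _ hV h => raiseL_mem h1 hi hV h) (fun V hV h => ?_) x
  have hm := mem_colsOf.1 hV
  have hap := phiL_append_singleton (i := i) hai
  rw [← lowerL_append {a} h hap,
    intrinsicE_lowerL hi (isTab_append ha (isTab_of_mem hs hV) fun v hv =>
      hs1 _ (hm.2 ▸ List.mem_map_of_mem hv)) (by rw [hap]; exact h)]

theorem lowerL_last (i : ℕ) (z : Finset ℕ) (V : List (Finset ℕ)) :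
    ∃ U, lowerL i (V ++ [z]) = U ++ [z] ∨ lowerL i (V ++ [z]) = U ++ [lowerCol i z] := by
  induction V with
  | nil => exact ⟨[], Or.inr (by simp [lowerL, phiL])⟩
  | cons x ys ih =>
    obtain ⟨U, hU⟩ := ih
    simp only [List.cons_append, lowerL]
    split_ifs
    · refine ⟨x :: U, hU.imp (fun h => ?_) (fun h => ?_)⟩ <;> rw [h] <;> rfl
    · exact ⟨lowerCol i x :: ys, Or.inl rfl⟩

theorem raiseL_last (i : ℕ) (z : Finset ℕ) (V : List (Finset ℕ)) :
    ∃ U, raiseL i (V ++ [z]) = U ++ [z] ∨ raiseL i (V ++ [z]) = U ++ [raiseCol i z] := by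
  induction V with
  | nil => exact ⟨[], by simp only [List.nil_append, raiseL]; split_ifs <;> simp⟩
  | cons x ys ih =>
    obtain ⟨U, hU⟩ := ih
    simp only [List.cons_append, raiseL]
    split_ifs
    · exact ⟨raiseCol i x :: ys, Or.inl rfl⟩
    · refine ⟨x :: U, hU.imp (fun h => ?_) (fun h => ?_)⟩ <;> rw [h] <;> rfl

theorem append_mem_colsOf {n a : ℕ} {s : List ℕ} {V : List (Finset ℕ)} :
    V ++ [{a}] ∈ colsOf n (s ++ [1]) ↔ V ∈ colsOf n s ∧ a ∈ Finset.Icc 1 n := by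
  simp only [mem_colsOf, List.map_append, List.map_cons, List.map_nil, Finset.card_singleton,
    List.append_left_inj, List.mem_append, List.mem_singleton]
  constructor
  · rintro ⟨h, h'⟩
    exact ⟨⟨fun v hv => h v (Or.inl hv), h'⟩, by simpa using h {a} (Or.inr rfl)⟩
  · rintro ⟨⟨h, h'⟩, ha⟩
    refine ⟨?_, h'⟩
    rintro v (hv | rfl)
    exacts [h v hv, by simpa using ha]

theorem mon_append_singleton (x : ℕ → ℂ) (V : List (Finset ℕ)) (a : ℕ) :
    mon x (V ++ [{a}]) = mon x V * x a := by
  simp [mon]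

theorem gsum_pair_swap {n i : ℕ} (h1 : 1 ≤ i) (hi : i + 1 ≤ n) (q : ℂ) {s : List ℕ}
    (hs : s.Pairwise (· ≥ ·)) (hs1 : ∀ h ∈ s, 1 ≤ h) (x : ℕ → ℂ) :
    x (i + 1) * gsum n q s i (x ∘ Equiv.swap i (i + 1)) +
      x i * gsum n q s (i + 1) (x ∘ Equiv.swap i (i + 1)) =
    x i * gsum n q s i x + x (i + 1) * gsum n q s (i + 1) x := by
  let f : ℕ × List (Finset ℕ) → List (Finset ℕ) := fun p => p.2 ++ [{p.1}]
  let T := (({i, i + 1} : Finset ℕ) ×ˢ colsOf n s).image f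
  have hf : Function.Injective f := by
    rintro ⟨a, U⟩ ⟨b, V⟩ h
    have h' : U ++ [{a}] = V ++ [({b} : Finset ℕ)] := h
    simpa [and_comm] using h'
  have hexp : ∀ z : ℕ → ℂ, ∑ V ∈ T, q ^ intrinsicE n V * mon z V =
      z i * gsum n q s i z + z (i + 1) * gsum n q s (i + 1) z := by
    intro z
    rw [Finset.sum_image hf.injOn, Finset.sum_product, Finset.sum_pair (by omega)]
    simp only [f, gsum, mon_append_singleton, Finset.mul_sum]
    congr 1 <;> exact Finset.sum_congr rfl fun V _ => by ring
  have hIcc : ∀ a, a = i ∨ a = i + 1 → a ∈ Finset.Icc 1 n := by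
    rintro a (rfl | rfl) <;> rw [Finset.mem_Icc] <;> omega
  have hT : ∀ V, V ∈ T ↔ V ∈ colsOf n (s ++ [1]) ∧ ∃ a U, (a = i ∨ a = i + 1) ∧ V = U ++ [{a}] := by
    intro V
    simp only [T, f, Finset.mem_image, Finset.mem_product, Finset.mem_insert, Finset.mem_singleton,
      Prod.exists]
    constructor
    · rintro ⟨a, U, ⟨ha, hU⟩, rfl⟩
      exact ⟨append_mem_colsOf.2 ⟨hU, hIcc a ha⟩, a, U, ha, rfl⟩
    · rintro ⟨hV, a, U, ha, rfl⟩
      exact ⟨a, U, ⟨ha, (append_mem_colsOf.1 hV).1⟩, rfl⟩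
  have hlow : ∀ a, a = i ∨ a = i + 1 → lowerCol i {a} = {i + 1} := by
    rintro a (rfl | rfl) <;> ext l <;> simp [mem_lowerCol]
  have hraise : ∀ a, a = i ∨ a = i + 1 → raiseCol i {a} = {i} := by
    rintro a (rfl | rfl) <;> ext l <;> simp [mem_raiseCol]
  have key := crystal_symm (i := i) T (fun V => q ^ intrinsicE n V) (fun V hV h => ?_)
    (fun V hV h => ?_) (fun V hV h => ?_) x
  · rw [hexp, hexp] at key
    simpa using key
  · obtain ⟨hV, a, U, ha, rfl⟩ := (hT V).1 hV
    refine (hT _).2 ⟨lowerL_mem hi hV h, ?_⟩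
    obtain ⟨U', h' | h'⟩ := lowerL_last i {a} U
    · exact ⟨a, U', ha, h'⟩
    · exact ⟨i + 1, U', Or.inr rfl, by rw [h', hlow a ha]⟩
  · obtain ⟨hV, a, U, ha, rfl⟩ := (hT V).1 hV
    refine (hT _).2 ⟨raiseL_mem h1 hi hV h, ?_⟩
    obtain ⟨U', h' | h'⟩ := raiseL_last i {a} U
    · exact ⟨a, U', ha, h'⟩
    · exact ⟨i, U', Or.inl rfl, by rw [h', hraise a ha]⟩
  · obtain ⟨hV, a, U, ha, rfl⟩ := (hT V).1 hV
    have hm := append_mem_colsOf.1 hV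
    have hm' := mem_colsOf.1 hm.1
    rw [intrinsicE_lowerL hi (isTab_append hm.2 (isTab_of_mem hs hm.1) fun v hv =>
      hs1 _ (hm'.2 ▸ List.mem_map_of_mem hv)) h]


/-! ### The `q`-difference eigenvalue equation -/

theorem mon_congr {n : ℕ} {s : List ℕ} {V : List (Finset ℕ)} (hV : V ∈ colsOf n s)
    {x y : ℕ → ℂ} (h : ∀ l ∈ Finset.Icc 1 n, x l = y l) : mon x V = mon y V := by
  unfold mon
  congr 1
  exact List.map_congr_left fun v hv => Finset.prod_congr rfl fun a ha =>
    h a ((mem_colsOf.1 hV).1 v hv ha)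

theorem wsum_congr {n : ℕ} {q : ℂ} {s : List ℕ} {x y : ℕ → ℂ}
    (h : ∀ l ∈ Finset.Icc 1 n, x l = y l) : wsum n q s x = wsum n q s y :=
  Finset.sum_congr rfl fun V hV => by rw [mon_congr hV h]

theorem wsum_cycle {n : ℕ} (hn : 1 ≤ n) (q : ℂ) {s : List ℕ} (hs : s.Pairwise (· ≥ ·))
    (x : ℕ → ℂ) : wsum n q s (fun l => if l = n then x 1 else x (l + 1)) = wsum n q s x := by
  have key : ∀ j, 1 ≤ j → j ≤ n →
      wsum n q s (fun l => if l < j then x (l + 1) else if l = j then x 1 else x l) =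
        wsum n q s x := by
    intro j h1
    induction j, h1 using Nat.le_induction with
    | base =>
      intro _
      refine wsum_congr fun l hl => ?_
      rw [Finset.mem_Icc] at hl
      rw [if_neg (by omega)]
      split_ifs with h
      · rw [h]
      · rfl
    | succ j h1 ih =>
      intro hj
      rw [← ih (by omega), ← wsum_swap h1 hj q hs]
      refine wsum_congr fun l hl => ?_
      simp only [Function.comp_apply]
      by_cases e1 : l = j
      · subst e1; simp
      · by_cases e2 : l = j + 1
        · subst e2; simp
        · rw [Equiv.swap_apply_of_ne_of_ne e1 e2]
          by_cases e3 : l < j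
          · rw [if_pos e3, if_pos (by omega)]
          · rw [if_neg e3, if_neg e1, if_neg (by omega), if_neg e2]
  rw [← key n hn le_rfl]
  refine wsum_congr fun l hl => ?_
  rw [Finset.mem_Icc] at hl
  by_cases h : l = n
  · simp [h]
  · simp [h, show l < n by omega]

/-- The coefficient `∏_{j ≠ i} x_i / (x_i - x_j)`. -/
noncomputable def lagC (x : ℕ → ℂ) (n i : ℕ) : ℂ :=
  ∏ j ∈ Finset.Icc 1 n, if j = i then 1 else x i / (x i - x j)

/-- The `q`-difference operator. -/
noncomputable def qDiff (n : ℕ) (q : ℂ) (f : (ℕ → ℂ) → ℂ) (x : ℕ → ℂ) : ℂ :=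
  ∑ i ∈ Finset.Icc 1 n, lagC x n i * f (Function.update x i (x i / q))

theorem update_comp_swap {i a b : ℕ} (x : ℕ → ℂ) (c : ℂ) :
    Function.update (x ∘ Equiv.swap a b) i c =
      Function.update x (Equiv.swap a b i) c ∘ Equiv.swap a b := by
  ext l
  by_cases h : l = i
  · simp [h]
  · have : Equiv.swap a b l ≠ Equiv.swap a b i := fun h' => h ((Equiv.swap a b).injective h')
    simp [h, this]

theorem swap_mem_Icc {n i l : ℕ} (h1 : 1 ≤ i) (hi : i + 1 ≤ n) (hl : l ∈ Finset.Icc 1 n) :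
    Equiv.swap i (i + 1) l ∈ Finset.Icc 1 n := by
  by_cases e1 : l = i
  · subst e1; simp; omega
  · by_cases e2 : l = i + 1
    · subst e2; simp; omega
    · rwa [Equiv.swap_apply_of_ne_of_ne e1 e2]

theorem lagC_succ_of_le (x : ℕ → ℂ) {n i : ℕ} (h : i ≤ n) :
    lagC x (n + 1) i = lagC x n i * (x i / (x i - x (n + 1))) := by
  rw [lagC, Finset.prod_Icc_succ_top (by omega), if_neg (by omega), lagC]

theorem gsum_expand {n : ℕ} {q : ℂ} (hq : q ≠ 0) {s : List ℕ}
    (hs : s.Pairwise (· ≥ ·)) (hs1 : ∀ h ∈ s, 1 ≤ h) {a : ℕ} (ha1 : 1 ≤ a) (han : a ≤ n)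
    {x : ℕ → ℂ} (hx : Set.InjOn x (Finset.Icc 1 n)) :
    gsum n q s a x = q ^ s.length *
      ∑ i ∈ Finset.Icc 1 a, lagC x a i * wsum n q s (Function.update x i (x i / q)) := by
  induction a, ha1 using Nat.le_induction generalizing x with
  | base =>
    rw [gsum_one han hq hs hs1, Finset.Icc_self, Finset.sum_singleton, lagC, Finset.Icc_self,
      Finset.prod_singleton, if_pos rfl, one_mul, ← wsum_cycle han q hs (Function.update x 1 _)]
    congr 1
    refine wsum_congr fun l hl => ?_
    rw [Finset.mem_Icc] at hl
    simp [show l ≠ 0 by omega]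
  | succ a ha ih =>
    have hσ : Set.InjOn (x ∘ Equiv.swap a (a + 1)) (Finset.Icc 1 n) :=
      hx.comp (Equiv.injective _).injOn fun l hl => swap_mem_Icc ha han hl
    have hne : ∀ i ∈ Finset.Icc 1 n, ∀ j ∈ Finset.Icc 1 n, i ≠ j → x i - x j ≠ 0 :=
      fun i hi j hj hij h => hij (hx hi hj (sub_eq_zero.1 h))
    have hma : a ∈ Finset.Icc 1 n := by rw [Finset.mem_Icc]; omega
    have hma' : a + 1 ∈ Finset.Icc 1 n := by rw [Finset.mem_Icc]; omega
    have h0 := hne a hma (a + 1) hma' (by omega)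
    have h1 := gsum_pair_swap ha han q hs hs1 x
    rw [gsum_swap ha han hma' (by omega) q hs hs1, ih (by omega) hx, ih (by omega) hσ] at h1
    obtain ⟨b, rfl⟩ : ∃ b, a = b + 1 := ⟨a - 1, by omega⟩
    have hlt : ∀ i ∈ Finset.Icc 1 b, i ≠ b + 1 ∧ i ≠ b + 2 := fun i hi => by
      rw [Finset.mem_Icc] at hi; omega
    have hL : ∀ i ∈ Finset.Icc 1 b, lagC (x ∘ Equiv.swap (b + 1) (b + 1 + 1)) b i = lagC x b i := by
      intro i hi
      refine Finset.prod_congr rfl fun j hj => ?_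
      simp only [Function.comp_apply]
      rw [Equiv.swap_apply_of_ne_of_ne (hlt i hi).1 (hlt i hi).2,
        Equiv.swap_apply_of_ne_of_ne (hlt j hj).1 (hlt j hj).2]
    have hlast : ∀ c, lagC x (c + 1) (c + 1) =
        ∏ j ∈ Finset.Icc 1 c, x (c + 1) / (x (c + 1) - x j) := by
      intro c
      rw [lagC, Finset.prod_Icc_succ_top (by omega), if_pos rfl, mul_one]
      exact Finset.prod_congr rfl fun j hj => by rw [if_neg (by rw [Finset.mem_Icc] at hj; omega)]
    have hlast' : lagC (x ∘ Equiv.swap (b + 1) (b + 1 + 1)) (b + 1) (b + 1) =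
        ∏ j ∈ Finset.Icc 1 b, x (b + 1 + 1) / (x (b + 1 + 1) - x j) := by
      rw [lagC, Finset.prod_Icc_succ_top (by omega), if_pos rfl, mul_one]
      refine Finset.prod_congr rfl fun j hj => ?_
      rw [if_neg (hlt j hj).1]
      simp [Equiv.swap_apply_of_ne_of_ne (hlt j hj).1 (hlt j hj).2]
    have hF : ∀ i c, wsum n q s (Function.update (x ∘ Equiv.swap (b + 1) (b + 1 + 1)) i c) =
        wsum n q s (Function.update x (Equiv.swap (b + 1) (b + 1 + 1) i) c) := fun i c => by
      rw [update_comp_swap, wsum_swap ha han q hs]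
    rw [Finset.sum_Icc_succ_top (by omega), Finset.sum_Icc_succ_top (by omega), hlast,
      hlast', hF] at h1
    rw [Finset.sum_Icc_succ_top (by omega), Finset.sum_Icc_succ_top (by omega), hlast,
      lagC_succ_of_le x le_rfl, hlast, Finset.prod_Icc_succ_top (by omega)]
    simp only [Function.comp_apply, Equiv.swap_apply_left] at h1
    have e1 : ∑ i ∈ Finset.Icc 1 b, lagC (x ∘ Equiv.swap (b + 1) (b + 1 + 1)) (b + 1) i *
        wsum n q s (Function.update (x ∘ Equiv.swap (b + 1) (b + 1 + 1)) i
          (x (Equiv.swap (b + 1) (b + 1 + 1) i) / q)) =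
        ∑ i ∈ Finset.Icc 1 b, lagC x b i * (x i / (x i - x (b + 1 + 1))) *
          wsum n q s (Function.update x i (x i / q)) := by
      refine Finset.sum_congr rfl fun i hi => ?_
      rw [hF, lagC_succ_of_le _ (Finset.mem_Icc.1 hi).2, hL i hi]
      simp [Equiv.swap_apply_of_ne_of_ne (hlt i hi).1 (hlt i hi).2]
    have e2 : ∑ i ∈ Finset.Icc 1 b, lagC x (b + 1) i *
          wsum n q s (Function.update x i (x i / q)) =
        ∑ i ∈ Finset.Icc 1 b, lagC x b i * (x i / (x i - x (b + 1))) *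
          wsum n q s (Function.update x i (x i / q)) := by
      refine Finset.sum_congr rfl fun i hi => ?_
      rw [lagC_succ_of_le _ (Finset.mem_Icc.1 hi).2]
    have e3 : (x (b + 1) - x (b + 1 + 1)) * ∑ i ∈ Finset.Icc 1 b, lagC x (b + 1 + 1) i *
          wsum n q s (Function.update x i (x i / q)) =
        x (b + 1) * ∑ i ∈ Finset.Icc 1 b, lagC x b i * (x i / (x i - x (b + 1))) *
          wsum n q s (Function.update x i (x i / q)) -
        x (b + 1 + 1) * ∑ i ∈ Finset.Icc 1 b, lagC x b i * (x i / (x i - x (b + 1 + 1))) *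
          wsum n q s (Function.update x i (x i / q)) := by
      rw [Finset.mul_sum, Finset.mul_sum, Finset.mul_sum, ← Finset.sum_sub_distrib]
      refine Finset.sum_congr rfl fun i hi => ?_
      have hi' := Finset.mem_Icc.1 hi
      rw [lagC_succ_of_le _ (by omega), lagC_succ_of_le _ hi'.2]
      have k1 := hne i (by rw [Finset.mem_Icc]; omega) _ hma (hlt i hi).1
      have k2 := hne i (by rw [Finset.mem_Icc]; omega) _ hma' (hlt i hi).2
      field_simp
      ring
    rw [e1, e2] at h1
    have h0' : x (b + 1 + 1) - x (b + 1) ≠ 0 := fun h => h0 (by linear_combination -h)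
    apply mul_left_cancel₀ h0
    rw [show ∀ A B C Q d : ℂ, d * (Q * (A + B + C)) = Q * (d * A) + Q * (d * B) + Q * (d * C) from
      fun _ _ _ _ _ => by ring, e3]
    have e4 : ∀ P F : ℂ,
        (x (b + 1) - x (b + 1 + 1)) * (P * (x (b + 1) / (x (b + 1) - x (b + 1 + 1))) * F)
        = x (b + 1) * P * F := fun P F => by field_simp
    have e5 : ∀ P F : ℂ,
        (x (b + 1) - x (b + 1 + 1)) * (P * (x (b + 1 + 1) / (x (b + 1 + 1) - x (b + 1))) * F)
        = - (x (b + 1 + 1) * P * F) := fun P F => by field_simp; ring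
    rw [e4, e5]
    linear_combination h1

theorem qDiff_wsum_of_pos {n : ℕ} (hn : 1 ≤ n) {q : ℂ} (hq : q ≠ 0) {s : List ℕ}
    (hs : s.Pairwise (· ≥ ·)) (hs1 : ∀ h ∈ s, 1 ≤ h) {x : ℕ → ℂ}
    (hx : Set.InjOn x (Finset.Icc 1 n)) :
    q ^ s.length * qDiff n q (wsum n q s) x = wsum n q s x := by
  rw [qDiff, ← gsum_expand hq hs hs1 hn le_rfl hx, gsum_top hn q hs hs1]


theorem scanRS_snd_eq_nil {w : List (ℕ × Bool)} (h : ∀ p ∈ w, p.2 = true) :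
    (scanRS w).2 = [] := by
  induction w using List.reverseRecOn with
  | nil => rfl
  | append_singleton w p ih =>
    have hp : p.2 = true := h p (by simp)
    have ih' := ih fun p hp => h p (by simp [hp])
    simp only [scanRS, List.foldl_append, List.foldl_cons, List.foldl_nil, hp, if_true] at ih' ⊢
    exact ih'

theorem Hloc_empty (n : ℕ) (x : Finset ℕ) : Hloc n x ∅ = 0 := by
  have : (scanRS (colPairWord n x ∅)).2 = [] := by
    refine scanRS_snd_eq_nil fun p hp => ?_
    simp only [colPairWord, List.mem_flatMap] at hp
    obtain ⟨l, -, hl⟩ := hp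
    by_cases h : l ∈ x
    · simp [h] at hl; rw [hl]
    · simp [h] at hl
  simp [Hloc, this]

theorem tailE_empty (n : ℕ) (ys : List (Finset ℕ)) : tailE n ∅ ys = 0 := by
  induction ys with
  | nil => rfl
  | cons y ys ih => simp [tailE, Hloc_empty, ih]

theorem append_empty_mem_colsOf {n : ℕ} {s : List ℕ} {V : List (Finset ℕ)} :
    V ++ [∅] ∈ colsOf n (s ++ [0]) ↔ V ∈ colsOf n s := by
  simp only [mem_colsOf, List.map_append, List.map_cons, List.map_nil, Finset.card_empty,
    List.append_left_inj, List.mem_append, List.mem_singleton]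
  refine and_congr_left fun _ => ⟨fun h v hv => h v (Or.inl hv), ?_⟩
  rintro h v (hv | rfl)
  exacts [h v hv, Finset.empty_subset _]

theorem wsum_append_zero (n : ℕ) (q : ℂ) (s : List ℕ) (x : ℕ → ℂ) :
    wsum n q (s ++ [0]) x = wsum n q s x := by
  symm
  refine Finset.sum_bij (fun V _ => V ++ [∅]) (fun V hV => append_empty_mem_colsOf.2 hV)
    (fun U _ V _ h => by simpa using h) (fun V hV => ?_) fun V _ => ?_
  · have hc := (mem_colsOf.1 hV).2
    rcases List.eq_nil_or_concat V with rfl | ⟨U, v, rfl⟩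
    · simp at hc
    · simp only [List.concat_eq_append] at hc hV ⊢
      rw [List.map_append] at hc
      have hv := (List.append_inj' hc rfl).2
      simp only [List.map_cons, List.map_nil, List.cons.injEq, Finset.card_eq_zero, and_true] at hv
      subst hv
      exact ⟨U, append_empty_mem_colsOf.1 hV, rfl⟩
  · simp [intrinsicE_append, tailE_empty, mon]

theorem wsum_append_zeros (n : ℕ) (q : ℂ) (s : List ℕ) (j : ℕ) (x : ℕ → ℂ) :
    wsum n q (s ++ List.replicate j 0) x = wsum n q s x := by
  induction j with
  | zero => simp
  | succ j ih => rw [List.replicate_succ', ← List.append_assoc, wsum_append_zero, ih]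

theorem wsum_zero_eq_zero {q : ℂ} {s : List ℕ} {h : ℕ} (hs : h ∈ s) (h0 : 1 ≤ h) (x : ℕ → ℂ) :
    wsum 0 q s x = 0 := by
  rw [wsum, Finset.sum_eq_zero]
  intro V hV
  rw [mem_colsOf] at hV
  rw [← hV.2] at hs
  obtain ⟨v, hv, rfl⟩ := List.mem_map.1 hs
  have := hV.1 v hv
  simp at this
  simp [this] at h0

theorem wsum_nil (n : ℕ) (q : ℂ) (x : ℕ → ℂ) : wsum n q [] x = 1 := by
  simp [wsum, colsOf, intrinsicE]

theorem continuous_mon (V : List (Finset ℕ)) : Continuous fun x : ℕ → ℂ => mon x V := by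
  induction V with
  | nil => exact continuous_const
  | cons v V ih =>
    exact (continuous_finsetProd _ fun a _ => continuous_apply a).mul ih

/-! ### Leading coefficients -/

/-- `f` is a polynomial of degree at most `k` in `x n` with continuous coefficients
independent of `x n`, and `g` is the coefficient of `x n ^ k`. -/
def HasTop (n k : ℕ) (f g : (ℕ → ℂ) → ℂ) : Prop :=
  ∃ δ : ℕ → (ℕ → ℂ) → ℂ, (∀ d, Continuous (δ d)) ∧
    (∀ d x c, δ d (Function.update x n c) = δ d x) ∧
    (∀ x, f x = ∑ d ∈ Finset.range (k + 1), x n ^ d * δ d x) ∧ δ k = g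

theorem HasTop.congr {n k : ℕ} {f g f' g' : (ℕ → ℂ) → ℂ} (h : HasTop n k f g)
    (hf : ∀ x, f' x = f x) (hg : ∀ x, g' x = g x) : HasTop n k f' g' := by
  rwa [show f' = f from funext hf, show g' = g from funext hg]

theorem HasTop.zero (n k : ℕ) : HasTop n k (fun _ => 0) (fun _ => 0) :=
  ⟨fun _ _ => 0, fun _ => continuous_const, fun _ _ _ => rfl, fun x => by simp, rfl⟩

theorem HasTop.add {n k : ℕ} {f g f' g' : (ℕ → ℂ) → ℂ} (h : HasTop n k f g)
    (h' : HasTop n k f' g') : HasTop n k (fun x => f x + f' x) (fun x => g x + g' x) := by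
  obtain ⟨δ, a1, a2, a3, rfl⟩ := h
  obtain ⟨ε, b1, b2, b3, rfl⟩ := h'
  refine ⟨fun d x => δ d x + ε d x, fun d => (a1 d).add (b1 d), fun d x c => ?_, fun x => ?_, rfl⟩
  · simp only [a2, b2]
  · simp only [a3, b3]
    rw [← Finset.sum_add_distrib]
    exact Finset.sum_congr rfl fun d _ => by ring

theorem HasTop.const_mul {n k : ℕ} {f g : (ℕ → ℂ) → ℂ} (h : HasTop n k f g) (c : ℂ) :
    HasTop n k (fun x => c * f x) (fun x => c * g x) := by
  obtain ⟨δ, a1, a2, a3, rfl⟩ := h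
  refine ⟨fun d x => c * δ d x, fun d => continuous_const.mul (a1 d), fun d x c => ?_,
    fun x => ?_, rfl⟩
  · simp only [a2]
  · simp only [a3]
    rw [Finset.mul_sum]
    exact Finset.sum_congr rfl fun d _ => by ring

theorem HasTop.sub {n k : ℕ} {f g f' g' : (ℕ → ℂ) → ℂ} (h : HasTop n k f g)
    (h' : HasTop n k f' g') : HasTop n k (fun x => f x - f' x) (fun x => g x - g' x) :=
  (h.add (h'.const_mul (-1))).congr (fun x => by ring) (fun x => by ring)

theorem HasTop.sum {n k : ℕ} {ι : Type*} {t : Finset ι} {f g : ι → (ℕ → ℂ) → ℂ}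
    (h : ∀ i ∈ t, HasTop n k (f i) (g i)) :
    HasTop n k (fun x => ∑ i ∈ t, f i x) (fun x => ∑ i ∈ t, g i x) := by
  classical
  induction t using Finset.induction_on with
  | empty => simpa using HasTop.zero n k
  | insert a t ha ih =>
    simp only [Finset.sum_insert ha]
    exact (h a (by simp)).add (ih fun i hi => h i (by simp [hi]))

/-- A monomial in `x n` with continuous coefficient independent of `x n`. -/
theorem HasTop.pow_mul {n k d : ℕ} (hd : d ≤ k) {g : (ℕ → ℂ) → ℂ} (hg : Continuous g)
    (hn : ∀ x c, g (Function.update x n c) = g x) :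
    HasTop n k (fun x => x n ^ d * g x) (fun x => if d = k then g x else 0) := by
  refine ⟨fun e x => if d = e then g x else 0, fun e => ?_, fun e x c => ?_, fun x => ?_, rfl⟩
  · by_cases h : d = e
    · simpa [h] using hg
    · simpa [h] using continuous_const
  · simp only [hn]
  · simp [Nat.lt_succ_of_le hd]

theorem mon_eq_erase (n : ℕ) (x : ℕ → ℂ) (V : List (Finset ℕ)) :
    mon x V = x n ^ (V.map (bitOf n)).sum * mon x (V.map fun v => v.erase n) := by
  induction V with
  | nil => simp
  | cons v V ih =>
    rw [mon_cons, ih, List.map_cons, List.map_cons, List.sum_cons, mon_cons, pow_add]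
    have : ∏ a ∈ v, x a = x n ^ bitOf n v * ∏ a ∈ v.erase n, x a := by
      by_cases h : n ∈ v
      · simp [bitOf, h, Finset.mul_prod_erase]
      · simp [bitOf, h]
    rw [this]; ring

theorem bitSum_le (n : ℕ) (V : List (Finset ℕ)) : (V.map (bitOf n)).sum ≤ V.length := by
  induction V with
  | nil => simp
  | cons v V ih =>
    have : bitOf n v ≤ 1 := by unfold bitOf; split_ifs <;> simp
    simp only [List.map_cons, List.sum_cons, List.length_cons]; omega

theorem bitSum_eq_length {n : ℕ} {V : List (Finset ℕ)} :
    (V.map (bitOf n)).sum = V.length ↔ ∀ v ∈ V, n ∈ v := by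
  induction V with
  | nil => simp
  | cons v V ih =>
    have := bitSum_le n V
    simp only [List.map_cons, List.sum_cons, List.length_cons, List.forall_mem_cons, ← ih]
    by_cases h : n ∈ v <;> simp [bitOf, h] <;> omega

theorem mon_update_erase (n : ℕ) (x : ℕ → ℂ) (c : ℂ) (V : List (Finset ℕ)) :
    mon (Function.update x n c) (V.map fun v => v.erase n) = mon x (V.map fun v => v.erase n) := by
  unfold mon
  rw [List.map_map, List.map_map]
  congr 1
  refine List.map_congr_left fun v _ => Finset.prod_congr rfl fun a ha => ?_
  rw [Function.update_of_ne (Finset.ne_of_mem_erase ha)]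

theorem length_of_mem_colsOf {n : ℕ} {s : List ℕ} {V : List (Finset ℕ)} (hV : V ∈ colsOf n s) :
    V.length = s.length := by
  rw [← (mem_colsOf.1 hV).2, List.length_map]

open Classical in
theorem hasTop_wsum (n : ℕ) (q : ℂ) (s : List ℕ) : HasTop n s.length (wsum n q s) (fun x =>
    ∑ V ∈ colsOf n s with (∀ v ∈ V, n ∈ v), q ^ intrinsicE n V *
      mon x (V.map fun v => v.erase n)) := by
  have key : ∀ V ∈ colsOf n s, HasTop n s.length (fun x => q ^ intrinsicE n V * mon x V)
      (fun x => q ^ intrinsicE n V * if (∀ v ∈ V, n ∈ v) then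
        mon x (V.map fun v => v.erase n) else 0) := by
    intro V hV
    have hl := length_of_mem_colsOf hV
    refine HasTop.const_mul ((HasTop.pow_mul (hl ▸ bitSum_le n V)
      (continuous_mon (V.map fun v => v.erase n)) (mon_update_erase n · · V)).congr
      (fun x => mon_eq_erase n x V) fun x => ?_) _
    simp only [← hl, bitSum_eq_length]
  refine (HasTop.sum key).congr (fun x => rfl) fun x => ?_
  rw [Finset.sum_filter]
  exact Finset.sum_congr rfl fun V _ => by split_ifs <;> simp


theorem local_insert {n : ℕ} {x y : Finset ℕ} (hx : x ⊆ Finset.Icc 1 n) (hy : y ⊆ Finset.Icc 1 n)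
    (hc : y.card ≤ x.card) :
    Hloc (n + 1) (insert (n + 1) x) (insert (n + 1) y) = Hloc n x y ∧
    Rright (n + 1) (insert (n + 1) x) (insert (n + 1) y) = insert (n + 1) (Rright n x y) := by
  have hins : ∀ {z : Finset ℕ}, z ⊆ Finset.Icc 1 n →
      insert (n + 1) z ⊆ Finset.Icc 1 (n + 1) ∧ (insert (n + 1) z).card = z.card + 1 := by
    intro z hz
    refine ⟨Finset.insert_subset (by simp) (hz.trans (Finset.Icc_subset_Icc_right (by omega))),
      Finset.card_insert_of_notMem fun h => ?_⟩
    have := Finset.mem_Icc.1 (hz h); omega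
  have hagree : ∀ l ∈ desc (n + 1), (l ∈ insert (n + 1) x ↔ l ∈ x) ∧
      (l ∈ insert (n + 1) y ↔ l ∈ y) := by
    intro l hl
    rw [mem_desc] at hl
    simp [show l ≠ n + 1 by omega]
  have hb : ∀ z : Finset ℕ, bitOf (n + 1) (insert (n + 1) z) = 1 := fun z => by simp [bitOf]
  have hle : (insert (n + 1) y).card ≤ (insert (n + 1) x).card := by
    rw [(hins hx).2, (hins hy).2]; omega
  have hH : Hloc (n + 1) (insert (n + 1) x) (insert (n + 1) y) = Hloc n x y := by
    rw [Hloc_eq_flow (hins hx).1 (hins hy).1 hle, Hloc_eq_flow hx hy hc]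
    show flow _ _ (desc (n + 1)) (0 + _ - _) = _
    rw [hb, hb, flow_congr hagree]
  refine ⟨hH, ?_⟩
  rw [Rright_eq_outflow (hins hx).1 (hins hy).1 hle, Rright_eq_outflow hx hy hc, hH]
  show (if _ then _ else _) ∪ outflow _ _ (desc (n + 1)) (_ + _ - _) = _
  rw [hb, hb, Nat.add_sub_cancel, outflow_congr hagree, if_pos (Or.inl (by simp))]
  rfl

theorem rowE_insert {n : ℕ} {x : Finset ℕ} {ys : List (Finset ℕ)}
    (hx : x ⊆ Finset.Icc 1 n) (hys : ∀ y ∈ ys, y ⊆ Finset.Icc 1 n ∧ y.card ≤ x.card) :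
    rowE (n + 1) (insert (n + 1) x) (ys.map (insert (n + 1))) = rowE n x ys := by
  induction ys generalizing x with
  | nil => rfl
  | cons y ys ih =>
    obtain ⟨h1, h2⟩ := hys y (by simp)
    obtain ⟨e1, e2⟩ := local_insert hx h1 h2
    rw [List.map_cons, rowE, rowE, e1, e2, ih (Rright_subset hx h1 h2) (by
      rw [card_Rright hx h1 h2]; exact fun y hy => hys y (by simp [hy]))]

theorem intrinsicE_insert {n : ℕ} {V : List (Finset ℕ)} (hV : IsTab n V) :
    intrinsicE (n + 1) (V.map (insert (n + 1))) = intrinsicE n V := by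
  induction V with
  | nil => rfl
  | cons x ys ih =>
    obtain ⟨a, b, c⟩ := hV.cons
    rw [List.map_cons, intrinsicE, intrinsicE, rowE_insert a b, ih c]

theorem hasTop_wsum_succ (n : ℕ) (q : ℂ) {s : List ℕ} (hs : s.Pairwise (· ≥ ·)) :
    HasTop (n + 1) s.length (wsum (n + 1) q (s.map (· + 1))) (wsum n q s) := by
  classical
  have key := hasTop_wsum (n + 1) q (s.map (· + 1))
  rw [List.length_map] at key
  refine key.congr (fun _ => rfl) fun x => ?_
  have hnot : ∀ V ∈ colsOf n s, ∀ v ∈ V, n + 1 ∉ v := fun V hV v hv h => by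
    have := Finset.mem_Icc.1 ((mem_colsOf.1 hV).1 v hv h); omega
  have herase : ∀ V ∈ colsOf n s,
      (V.map (insert (n + 1))).map (fun v => v.erase (n + 1)) = V := fun V hV => by
    rw [List.map_map]
    conv_rhs => rw [← List.map_id V]
    exact List.map_congr_left fun v hv => Finset.erase_insert (hnot V hV v hv)
  have hinsert : ∀ V : List (Finset ℕ), (∀ v ∈ V, n + 1 ∈ v) →
      (V.map (fun v => v.erase (n + 1))).map (insert (n + 1)) = V := fun V hV => by
    rw [List.map_map]
    conv_rhs => rw [← List.map_id V]
    exact List.map_congr_left fun v hv => Finset.insert_erase (hV v hv)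
  refine Finset.sum_nbij' (fun V => V.map (insert (n + 1)))
    (fun V => V.map fun v => v.erase (n + 1)) (fun V hV => ?_) (fun V hV => ?_) herase
    (fun V hV => hinsert V (Finset.mem_filter.1 hV).2) (fun V hV => ?_)
  · rw [Finset.mem_filter, mem_colsOf]
    have hV' := mem_colsOf.1 hV
    refine ⟨⟨fun v hv => ?_, ?_⟩, fun v hv => ?_⟩
    · obtain ⟨u, hu, rfl⟩ := List.mem_map.1 hv
      exact Finset.insert_subset (by simp)
        ((hV'.1 u hu).trans (Finset.Icc_subset_Icc_right (by omega)))
    · rw [← hV'.2, List.map_map, List.map_map]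
      exact List.map_congr_left fun v hv => Finset.card_insert_of_notMem (hnot V hV v hv)
    · obtain ⟨u, hu, rfl⟩ := List.mem_map.1 hv
      simp
  · rw [Finset.mem_filter, mem_colsOf] at hV
    obtain ⟨⟨h1, h2⟩, h3⟩ := hV
    rw [mem_colsOf]
    constructor
    · intro v hv
      obtain ⟨u, hu, rfl⟩ := List.mem_map.1 hv
      intro l hl
      have := Finset.mem_Icc.1 (h1 u hu (Finset.mem_of_mem_erase hl))
      have := Finset.ne_of_mem_erase hl
      rw [Finset.mem_Icc]; omega
    · have h4 := congrArg (List.map (· - 1)) h2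
      rw [List.map_map, List.map_map] at h4
      rw [List.map_map]
      convert h4 using 1
      · exact List.map_congr_left fun v hv => by simp [Finset.card_erase_of_mem (h3 v hv)]
      · conv_lhs => rw [← List.map_id s]
        exact List.map_congr_left fun a _ => by simp
  · rw [herase V hV, intrinsicE_insert (isTab_of_mem hs hV)]

theorem hasTop_wsum_zero_mem {n : ℕ} (q : ℂ) {s : List ℕ} (hs : 0 ∈ s) :
    HasTop n s.length (wsum n q s) (fun _ => 0) := by
  classical
  refine (hasTop_wsum n q s).congr (fun _ => rfl) fun x => ?_
  rw [Finset.sum_eq_zero]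
  intro V hV
  rw [Finset.mem_filter, mem_colsOf] at hV
  rw [← hV.1.2] at hs
  obtain ⟨v, hv, h0⟩ := List.mem_map.1 hs
  have := hV.2 v hv
  rw [Finset.card_eq_zero.1 h0] at this
  simp at this


/-! ### Uniqueness for the eigenvalue equation -/

open Filter Topology in
theorem exists_injOn_ne_zero {δ : (ℕ → ℂ) → ℂ} (hc : Continuous δ) {x₀ : ℕ → ℂ} (h : δ x₀ ≠ 0)
    (s : Finset ℕ) : ∃ x, Set.InjOn x s ∧ δ x ≠ 0 := by
  let p : ℂ → ℕ → ℂ := fun ε l => x₀ l + ε * l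
  have hp : Continuous p := continuous_pi fun l => by fun_prop
  have h1 : ∀ᶠ ε in 𝓝[≠] (0 : ℂ), δ (p ε) ≠ 0 := by
    have : Tendsto (fun ε => δ (p ε)) (𝓝[≠] 0) (𝓝 (δ (p 0))) :=
      ((hc.comp hp).tendsto 0).mono_left nhdsWithin_le_nhds
    refine this.eventually_ne ?_
    simpa [p] using h
  have h2 : ∀ᶠ ε in 𝓝[≠] (0 : ℂ), ∀ i ∈ s, ∀ j ∈ s, i ≠ j → p ε i ≠ p ε j := by
    rw [eventually_all_finset]
    intro i _
    rw [eventually_all_finset]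
    intro j _
    by_cases hij : i = j
    · simp [hij]
    have hne : (i : ℂ) - j ≠ 0 := sub_ne_zero.2 (Nat.cast_injective.ne hij)
    by_cases h0 : x₀ i = x₀ j
    · filter_upwards [self_mem_nhdsWithin] with ε hε _ he
      apply hε
      have : ε * ((i : ℂ) - j) = 0 := by
        simp only [p] at he; linear_combination he - h0
      simpa [hne] using this
    · have : Tendsto (fun ε => p ε i - p ε j) (𝓝[≠] 0) (𝓝 (p 0 i - p 0 j)) :=
        ((((continuous_apply i).comp hp).sub ((continuous_apply j).comp hp)).tendsto 0).mono_left
          nhdsWithin_le_nhds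
      filter_upwards [this.eventually_ne (b₂ := 0) (by simpa [p, sub_eq_zero] using h0)]
        with ε hε _ he
      exact hε (sub_eq_zero.2 he)
  obtain ⟨ε, e1, e2⟩ := (h1.and h2).exists
  refine ⟨p ε, fun i hi j hj hij => ?_, e1⟩
  by_contra hne
  exact e2 i hi j hj hne hij

open Filter Topology in
theorem tendsto_top_coeff {n d : ℕ} {δ : ℕ → (ℕ → ℂ) → ℂ}
    (x : ℕ → ℂ) (hδ : ∀ d x c, δ d (Function.update x n c) = δ d x) (c : ℂ) :
    Tendsto (fun u : ℂ => u ^ d * ∑ e ∈ Finset.range (d + 1),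
      (Function.update x n (c * u⁻¹)) n ^ e * δ e (Function.update x n (c * u⁻¹)))
      (𝓝[≠] 0) (𝓝 (c ^ d * δ d x)) := by
  have h : Tendsto (fun u : ℂ => ∑ e ∈ Finset.range (d + 1), u ^ (d - e) * (c ^ e * δ e x))
      (𝓝[≠] 0) (𝓝 (c ^ d * δ d x)) := by
    have : Continuous fun u : ℂ => ∑ e ∈ Finset.range (d + 1), u ^ (d - e) * (c ^ e * δ e x) := by
      fun_prop
    convert (this.tendsto 0).mono_left nhdsWithin_le_nhds using 2
    rw [Finset.sum_range_succ, Finset.sum_eq_zero]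
    · simp
    · intro e he
      rw [Finset.mem_range] at he
      rw [zero_pow (by omega), zero_mul]
  refine h.congr' ?_
  filter_upwards [self_mem_nhdsWithin] with u hu
  have hu : u ≠ 0 := hu
  rw [Finset.mul_sum]
  refine Finset.sum_congr rfl fun e he => ?_
  rw [Finset.mem_range] at he
  rw [hδ, Function.update_self, mul_pow, inv_pow, show u ^ d = u ^ (d - e) * u ^ e by
    rw [← pow_add]; congr 1; omega]
  field_simp

open Filter Topology in
theorem eigen_unique {n k : ℕ} (hn : 1 ≤ n) {q : ℂ} (hq : q ≠ 0) (hq1 : ‖q‖ < 1)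
    {f : (ℕ → ℂ) → ℂ} (hf : HasTop n k f (fun _ => 0))
    (h : ∀ x, Set.InjOn x (Finset.Icc 1 n) → q ^ k * qDiff n q f x = f x) (x : ℕ → ℂ) :
    f x = 0 := by
  obtain ⟨δ, hc, hδ, hsum, htop⟩ := hf
  by_contra hx
  have hex : ∃ d, d ≤ k ∧ ∃ x, δ d x ≠ 0 := by
    by_contra! hcon
    exact hx (by
      rw [hsum]
      exact Finset.sum_eq_zero fun d hd => by
        rw [hcon d (by rw [Finset.mem_range] at hd; omega), mul_zero])
  classical
  let d := Nat.findGreatest (fun d => ∃ x, δ d x ≠ 0) k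
  obtain ⟨d₀, hd₀, hx₀⟩ := hex
  obtain ⟨x₁, hx₁⟩ : ∃ x, δ d x ≠ 0 :=
    Nat.findGreatest_spec (P := fun d => ∃ x, δ d x ≠ 0) hd₀ hx₀
  have hdk : d ≤ k := Nat.findGreatest_le k
  have hlt : d < k := lt_of_le_of_ne hdk fun he => hx₁ (by rw [he, htop])
  have hmax : ∀ e, d < e → e ≤ k → ∀ x, δ e x = 0 := fun e h1 h2 x => by
    by_contra hcon
    exact Nat.findGreatest_is_greatest (P := fun d => ∃ x, δ d x ≠ 0) h1 h2 ⟨x, hcon⟩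
  have hsum' : ∀ x, f x = ∑ e ∈ Finset.range (d + 1), x n ^ e * δ e x := fun x => by
    rw [hsum]
    symm
    apply Finset.sum_subset (Finset.range_subset_range.2 (by omega))
    intro e he he'
    rw [Finset.mem_range] at he he'
    rw [hmax e (by omega) (by omega), mul_zero]
  obtain ⟨x, hxi, hxd⟩ := exists_injOn_ne_zero (hc d) hx₁ (Finset.Icc 1 n)
  obtain ⟨m, rfl⟩ : ∃ m, n = m + 1 := ⟨n - 1, by omega⟩
  have T : ∀ (y : ℕ → ℂ) (c : ℂ), Tendsto
      (fun u : ℂ => u ^ d * f (Function.update y (m + 1) (c * u⁻¹)))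
      (𝓝[≠] 0) (𝓝 (c ^ d * δ d y)) := fun y c => by
    simp only [hsum']
    exact tendsto_top_coeff y hδ c
  have hne : ∀ i ∈ Finset.Icc 1 m, i ≠ m + 1 := fun i hi => by
    rw [Finset.mem_Icc] at hi; omega
  -- the terms with `i ≤ m` vanish in the limit
  have T1 : ∀ i ∈ Finset.Icc 1 m, Tendsto (fun u : ℂ =>
      lagC (Function.update x (m + 1) u⁻¹) (m + 1) i *
        (u ^ d * f (Function.update (Function.update x (m + 1) u⁻¹) i
          (Function.update x (m + 1) u⁻¹ i / q)))) (𝓝[≠] 0) (𝓝 0) := by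
    intro i hi
    have a1 : Tendsto (fun u : ℂ => lagC x m i * (u * x i / (u * x i - 1))) (𝓝[≠] 0) (𝓝 0) := by
      have : ContinuousAt (fun u : ℂ => lagC x m i * (u * x i / (u * x i - 1))) 0 := by
        refine continuousAt_const.mul (ContinuousAt.div (by fun_prop) (by fun_prop) (by simp))
      convert this.tendsto.mono_left nhdsWithin_le_nhds using 2
      simp
    have a2 := T (Function.update x i (x i / q)) 1
    have a3 := a1.mul a2
    rw [zero_mul] at a3
    refine a3.congr' ?_
    filter_upwards [self_mem_nhdsWithin] with u hu
    have hu : u ≠ 0 := hu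
    rw [lagC_succ_of_le _ (Finset.mem_Icc.1 hi).2, Function.update_of_ne (hne i hi),
      Function.update_self, one_mul, Function.update_comm (hne i hi)]
    have e1 : lagC (Function.update x (m + 1) u⁻¹) m i = lagC x m i :=
      Finset.prod_congr rfl fun j hj => by
        rw [Function.update_of_ne (hne i hi), Function.update_of_ne (hne j hj)]
    have e2 : x i / (x i - u⁻¹) = u * x i / (u * x i - 1) := by
      rw [show u * x i - 1 = u * (x i - u⁻¹) by field_simp, mul_div_mul_left _ _ hu]
    rw [e1, e2]
  have T2 : Tendsto (fun u : ℂ => lagC (Function.update x (m + 1) u⁻¹) (m + 1) (m + 1) *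
        (u ^ d * f (Function.update (Function.update x (m + 1) u⁻¹) (m + 1)
          (Function.update x (m + 1) u⁻¹ (m + 1) / q)))) (𝓝[≠] 0) (𝓝 (q⁻¹ ^ d * δ d x)) := by
    have a1 : Tendsto (fun u : ℂ => ∏ j ∈ Finset.Icc 1 m, 1 / (1 - u * x j)) (𝓝[≠] 0) (𝓝 1) := by
      have : ContinuousAt (fun u : ℂ => ∏ j ∈ Finset.Icc 1 m, 1 / (1 - u * x j)) 0 := by
        refine tendsto_finsetProd _ fun j _ => ?_
        exact ContinuousAt.div (by fun_prop) (by fun_prop) (by simp)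
      convert this.tendsto.mono_left nhdsWithin_le_nhds using 2
      simp
    have a3 := a1.mul (T x q⁻¹)
    rw [one_mul] at a3
    refine a3.congr' ?_
    filter_upwards [self_mem_nhdsWithin] with u hu
    have hu : u ≠ 0 := hu
    rw [Function.update_idem, Function.update_self, lagC, Finset.prod_Icc_succ_top (by omega),
      if_pos rfl, mul_one, div_eq_inv_mul]
    congr 1
    refine Finset.prod_congr rfl fun j hj => ?_
    rw [if_neg (hne j hj), Function.update_self, Function.update_of_ne (hne j hj),
      show u⁻¹ - x j = u⁻¹ * (1 - u * x j) by field_simp]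
    rw [← mul_div_mul_left 1 (1 - u * x j) (inv_ne_zero hu), mul_one]
  have hinj : ∀ᶠ u : ℂ in 𝓝[≠] 0,
      Set.InjOn (Function.update x (m + 1) u⁻¹) (Finset.Icc 1 (m + 1)) := by
    have : ∀ᶠ u : ℂ in 𝓝[≠] 0, ∀ i ∈ Finset.Icc 1 m, u⁻¹ ≠ x i := by
      rw [eventually_all_finset]
      intro i _
      by_cases h0 : x i = 0
      · filter_upwards [self_mem_nhdsWithin] with u hu
        rw [h0]; exact inv_ne_zero hu
      · have h1 : ∀ᶠ u : ℂ in 𝓝[≠] 0, u ≠ (x i)⁻¹ :=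
          nhdsWithin_le_nhds (eventually_ne_nhds (inv_ne_zero h0).symm)
        filter_upwards [h1] with u hu he
        exact hu (by rw [← he, inv_inv])
    filter_upwards [this] with u hu i hi j hj hij
    have hm : ∀ l ∈ Finset.Icc 1 (m + 1), l ≠ m + 1 → l ∈ Finset.Icc 1 m := fun l hl hl' => by
      rw [Finset.mem_Icc] at hl ⊢; omega
    by_cases e1 : i = m + 1 <;> by_cases e2 : j = m + 1
    · rw [e1, e2]
    · rw [e1, Function.update_self, Function.update_of_ne e2] at hij
      exact absurd hij (hu j (hm j hj e2))
    · rw [e2, Function.update_self, Function.update_of_ne e1] at hij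
      exact absurd hij.symm (hu i (hm i hi e1))
    · rw [Function.update_of_ne e1, Function.update_of_ne e2] at hij
      exact hxi hi hj hij
  have L1 := (((tendsto_finsetSum _ T1).add T2).const_mul (q ^ k))
  have L2 := T x 1
  have heq := tendsto_nhds_unique (L1.congr' ?_) L2
  · simp only [Finset.sum_const_zero, zero_add, one_pow, one_mul] at heq
    have h3 : q ^ (k - d) = 1 := by
      apply mul_right_cancel₀ hxd
      rw [one_mul]
      refine Eq.trans ?_ heq
      rw [show q ^ k = q ^ (k - d) * q ^ d by rw [← pow_add]; congr 1; omega,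
        inv_pow]
      field_simp
    have h4 : ‖q‖ ^ (k - d) < 1 := pow_lt_one₀ (norm_nonneg _) hq1 (by omega)
    rw [← norm_pow, h3, norm_one] at h4
    exact lt_irrefl _ h4
  · filter_upwards [hinj] with u hu
    rw [one_mul, ← h _ hu, qDiff, Finset.sum_Icc_succ_top (by omega)]
    simp only [mul_add, Finset.mul_sum]
    congr 1
    · exact Finset.sum_congr rfl fun i _ => by ring
    · ring


/-! ### Weighted sums over partitions with a fixed number of parts -/

/-- The sum of `f s` over weakly decreasing lists `s` of length `k` with entries in `{0,…,N}`,
weighted by the product of `1 / (q;q)_m` over the multiplicities `m` of the entries. -/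
noncomputable def qSum (q : ℂ) : ℕ → ℕ → (List ℕ → ℂ) → ℂ
  | 0, k, f => (qPoch q k)⁻¹ * f (List.replicate k 0)
  | N + 1, k, f => ∑ j ∈ Finset.range (k + 1), (qPoch q j)⁻¹ *
      qSum q N (k - j) fun s => f (s.map (· + 1) ++ List.replicate j 0)

theorem pairwise_map_succ {s : List ℕ} (a : ℕ) (hs : s.Pairwise (· ≥ ·)) :
    (s.map (· + a)).Pairwise (· ≥ ·) := by
  rw [List.pairwise_map]
  exact hs.imp fun h => by omega

theorem pairwise_succ_append {s : List ℕ} (j : ℕ) (hs : s.Pairwise (· ≥ ·)) :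
    (s.map (· + 1) ++ List.replicate j 0).Pairwise (· ≥ ·) := by
  rw [List.pairwise_append]
  refine ⟨pairwise_map_succ 1 hs, List.pairwise_replicate.2 (Or.inr le_rfl), ?_⟩
  intro a _ b hb
  rw [(List.mem_replicate.1 hb).2]
  exact Nat.zero_le a

theorem length_succ_append {s : List ℕ} {j k : ℕ} (hj : j ∈ Finset.range (k + 1))
    (hs : s.length = k - j) : (s.map (· + 1) ++ List.replicate j 0).length = k := by
  rw [Finset.mem_range] at hj
  simp; omega

theorem qSum_congr {q : ℂ} {N k : ℕ} {f g : List ℕ → ℂ}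
    (h : ∀ s : List ℕ, s.Pairwise (· ≥ ·) → s.length = k → f s = g s) :
    qSum q N k f = qSum q N k g := by
  induction N generalizing k f g with
  | zero => simp only [qSum]; rw [h _ (List.pairwise_replicate.2 (Or.inr le_rfl)) (by simp)]
  | succ N ih =>
    refine Finset.sum_congr rfl fun j hj => ?_
    rw [ih fun s hs hl => h _ (pairwise_succ_append j hs) (length_succ_append hj hl)]

theorem qSum_const_mul (q c : ℂ) (N k : ℕ) (f : List ℕ → ℂ) :
    qSum q N k (fun s => c * f s) = c * qSum q N k f := by
  induction N generalizing k f with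
  | zero => simp only [qSum]; ring
  | succ N ih =>
    simp only [qSum, ih, Finset.mul_sum]
    exact Finset.sum_congr rfl fun j _ => by ring

theorem qSum_zero_length (q : ℂ) (N : ℕ) (f : List ℕ → ℂ) : qSum q N 0 f = f [] := by
  induction N generalizing f with
  | zero => simp [qSum, qPoch]
  | succ N ih => simp [qSum, qPoch, ih]

theorem qDiff_qSum (n : ℕ) (q : ℂ) (N k : ℕ) (F : List ℕ → (ℕ → ℂ) → ℂ) (x : ℕ → ℂ) :
    qDiff n q (fun x => qSum q N k fun s => F s x) x =
      qSum q N k fun s => qDiff n q (F s) x := by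
  induction N generalizing k F with
  | zero =>
    simp only [qSum, qDiff, Finset.mul_sum]
    exact Finset.sum_congr rfl fun j _ => by ring
  | succ N ih =>
    simp only [qSum, ← ih]
    simp only [qDiff, Finset.mul_sum]
    rw [Finset.sum_comm]
    exact Finset.sum_congr rfl fun j _ => Finset.sum_congr rfl fun i _ => by ring

theorem HasTop.qSum {n d : ℕ} {q : ℂ} {N k : ℕ} {F G : List ℕ → (ℕ → ℂ) → ℂ}
    (h : ∀ s : List ℕ, s.Pairwise (· ≥ ·) → s.length = k → HasTop n d (F s) (G s)) :
    HasTop n d (fun x => _root_.qSum q N k fun s => F s x)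
      (fun x => _root_.qSum q N k fun s => G s x) := by
  induction N generalizing k F G with
  | zero => exact (h _ (List.pairwise_replicate.2 (Or.inr le_rfl)) (by simp)).const_mul _
  | succ N ih =>
    exact HasTop.sum fun j hj => HasTop.const_mul (ih fun s hs hl =>
      h _ (pairwise_succ_append j hs) (length_succ_append hj hl)) _

theorem qPoch_ne_zero {q : ℂ} (hq : ‖q‖ < 1) (m : ℕ) : qPoch q m ≠ 0 := by
  rw [qPoch, Finset.prod_ne_zero_iff]
  intro j _ h
  have h1 : q ^ (j + 1) = 1 := (sub_eq_zero.1 h).symm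
  have h2 : ‖q‖ ^ (j + 1) < 1 := pow_lt_one₀ (norm_nonneg _) hq (by omega)
  rw [← norm_pow, h1, norm_one] at h2
  exact lt_irrefl _ h2

theorem qPoch_conv {q : ℂ} (hq : ‖q‖ < 1) (A : ℕ → ℂ) (k : ℕ) :
    ∑ j ∈ Finset.range (k + 2), (qPoch q j)⁻¹ * A (k + 1 - j) -
      ∑ j ∈ Finset.range (k + 1), (qPoch q j)⁻¹ * A (k - j) =
    ∑ j ∈ Finset.range (k + 2), q ^ j / qPoch q j * A (k + 1 - j) := by
  rw [Finset.sum_range_succ', Finset.sum_range_succ' _ (k + 1), add_sub_right_comm,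
    ← Finset.sum_sub_distrib]
  congr 1
  · refine Finset.sum_congr rfl fun j _ => ?_
    have h0 := qPoch_ne_zero hq j
    have h1 := qPoch_ne_zero hq (j + 1)
    have h2 : qPoch q (j + 1) = qPoch q j * (1 - q ^ (j + 1)) := Finset.prod_range_succ _ _
    have h3 : (1 - q ^ (j + 1)) ≠ 0 := right_ne_zero_of_mul (h2 ▸ h1)
    rw [Nat.add_sub_add_right, h2]
    field_simp
    ring
  · simp [qPoch]

/-- The weighted sum over partitions `s` with `k` parts of `W_s(x) W_{s + a^k}(y)`. -/
noncomputable def colSum (q : ℂ) (N n m a k : ℕ) (x y : ℕ → ℂ) : ℂ :=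
  qSum q N k fun s => wsum n q s x * wsum m q (s.map (· + a)) y

theorem colSum_zero (q : ℂ) (N n m a : ℕ) (x y : ℕ → ℂ) : colSum q N n m a 0 x y = 1 := by
  simp [colSum, qSum_zero_length, wsum_nil]

theorem hasTop_colSum_left (q : ℂ) (N n m a k : ℕ) (y : ℕ → ℂ) :
    HasTop (n + 1) k (fun x => colSum q (N + 1) (n + 1) m a k x y)
      (fun x => colSum q N n m (a + 1) k x y) := by
  let G : ℕ → (ℕ → ℂ) → ℂ := fun j x =>
    if j = 0 then qSum q N k fun s => wsum n q s x * wsum m q (s.map (· + (a + 1))) y else 0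
  have key : ∀ j ∈ Finset.range (k + 1), HasTop (n + 1) k (fun x => (qPoch q j)⁻¹ *
      qSum q N (k - j) fun s => wsum (n + 1) q (s.map (· + 1) ++ List.replicate j 0) x *
        wsum m q ((s.map (· + 1) ++ List.replicate j 0).map (· + a)) y)
      (fun x => (qPoch q j)⁻¹ * G j x) := by
    intro j hj
    refine HasTop.const_mul ?_ _
    rcases Nat.eq_zero_or_pos j with rfl | hj0
    · refine HasTop.qSum fun s hs hl => ?_
      have h1 := (hasTop_wsum_succ n q hs).const_mul (wsum m q (s.map (· + (a + 1))) y)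
      rw [hl] at h1
      refine h1.congr (fun x => ?_) (fun x => ?_)
      · simp only [List.replicate_zero, List.append_nil, List.map_map]
        rw [mul_comm]
        congr 2
        exact List.map_congr_left fun l _ => by simp; omega
      · rw [mul_comm]
    · have h1 : HasTop (n + 1) k (fun x => qSum q N (k - j) fun s =>
          wsum (n + 1) q (s.map (· + 1) ++ List.replicate j 0) x *
          wsum m q ((s.map (· + 1) ++ List.replicate j 0).map (· + a)) y)
          (fun _ => qSum q N (k - j) fun s => 0) := by
        refine HasTop.qSum fun s hs hl => ?_
        have h2 := (hasTop_wsum_zero_mem (n := n + 1) q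
          (s := s.map (· + 1) ++ List.replicate j 0) (by
            simp [List.mem_replicate]; omega)).const_mul
          (wsum m q ((s.map (· + 1) ++ List.replicate j 0).map (· + a)) y)
        rw [length_succ_append hj hl] at h2
        exact h2.congr (fun x => mul_comm _ _) (fun x => by simp)
      refine h1.congr (fun x => rfl) (fun x => ?_)
      have h0 := qSum_const_mul q 0 N (k - j) (fun _ => 0)
      simp only [zero_mul] at h0
      simp only [G, if_neg hj0.ne', h0]
  refine (HasTop.sum key).congr (fun x => rfl) fun x => ?_
  rw [Finset.sum_range_succ', Finset.sum_eq_zero fun j _ => by simp [G]]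
  simp [G, qPoch, colSum]

theorem hasTop_colSum_right (q : ℂ) (N n m a k : ℕ) (x : ℕ → ℂ) :
    HasTop (m + 1) k (fun y => colSum q N n (m + 1) (a + 1) k x y)
      (fun y => colSum q N n m a k x y) := by
  refine HasTop.qSum fun s hs hl => ?_
  have h1 := (hasTop_wsum_succ m q (pairwise_map_succ a hs)).const_mul (wsum n q s x)
  rw [List.length_map, hl, List.map_map] at h1
  exact h1

theorem qDiff_mul_const (n : ℕ) (q c : ℂ) (f : (ℕ → ℂ) → ℂ) (x : ℕ → ℂ) :
    qDiff n q (fun x => f x * c) x = qDiff n q f x * c := by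
  simp only [qDiff, Finset.sum_mul, mul_assoc]

theorem qDiff_const_mul (n : ℕ) (q c : ℂ) (f : (ℕ → ℂ) → ℂ) (x : ℕ → ℂ) :
    qDiff n q (fun x => c * f x) x = c * qDiff n q f x := by
  simp only [qDiff, Finset.mul_sum]
  exact Finset.sum_congr rfl fun i _ => by ring

theorem qDiff_sub (n : ℕ) (q : ℂ) (f g : (ℕ → ℂ) → ℂ) (x : ℕ → ℂ) :
    qDiff n q (fun x => f x - g x) x = qDiff n q f x - qDiff n q g x := by
  simp only [qDiff, ← Finset.sum_sub_distrib, mul_sub]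

theorem eigen_colSum_right {m : ℕ} (hm : 1 ≤ m) {q : ℂ} (hq : q ≠ 0) (N n a k : ℕ) (x : ℕ → ℂ)
    {y : ℕ → ℂ} (hy : Set.InjOn y (Finset.Icc 1 m)) :
    q ^ k * qDiff m q (fun y => colSum q N n m (a + 1) k x y) y = colSum q N n m (a + 1) k x y := by
  unfold colSum
  rw [qDiff_qSum, ← qSum_const_mul]
  refine qSum_congr fun s hs hl => ?_
  rw [qDiff_const_mul]
  have h1 := qDiff_wsum_of_pos hm hq (pairwise_map_succ (a + 1) hs) (by simp; omega) hy
  rw [List.length_map, hl] at h1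
  linear_combination (wsum n q s x) * h1

/-- The part of `colSum` coming from partitions without zero parts. -/
noncomputable def posSum (q : ℂ) (N n m k : ℕ) (x y : ℕ → ℂ) : ℂ :=
  qSum q N k fun s => wsum n q (s.map (· + 1)) x * wsum m q (s.map (· + 1)) y

theorem colSum_eq_posSum (q : ℂ) (N n m k : ℕ) (x y : ℕ → ℂ) : colSum q (N + 1) n m 0 k x y =
    ∑ j ∈ Finset.range (k + 1), (qPoch q j)⁻¹ * posSum q N n m (k - j) x y := by
  rw [colSum, qSum]
  refine Finset.sum_congr rfl fun j _ => ?_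
  congr 1
  refine qSum_congr fun s _ _ => ?_
  simp [wsum_append_zeros, Function.comp_def]

theorem eigen_colSum_left {n : ℕ} (hn : 1 ≤ n) {q : ℂ} (hq : q ≠ 0) (hq1 : ‖q‖ < 1) (N m k : ℕ)
    (y : ℕ → ℂ) {x : ℕ → ℂ} (hx : Set.InjOn x (Finset.Icc 1 n)) :
    q ^ (k + 1) * qDiff n q (fun x => colSum q (N + 1) n m 0 (k + 1) x y) x =
      colSum q (N + 1) n m 0 (k + 1) x y - colSum q (N + 1) n m 0 k x y := by
  have hpos : ∀ r, q ^ r * qDiff n q (fun x => posSum q N n m r x y) x = posSum q N n m r x y := by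
    intro r
    unfold posSum
    rw [qDiff_qSum, ← qSum_const_mul]
    refine qSum_congr fun s hs hl => ?_
    rw [qDiff_mul_const]
    have h1 := qDiff_wsum_of_pos hn hq (pairwise_map_succ 1 hs) (by simp) hx
    rw [List.length_map, hl] at h1
    linear_combination (wsum m q (s.map (· + 1)) y) * h1
  have hlin : qDiff n q (fun x => colSum q (N + 1) n m 0 (k + 1) x y) x =
      ∑ j ∈ Finset.range (k + 2), (qPoch q j)⁻¹ *
        qDiff n q (fun x => posSum q N n m (k + 1 - j) x y) x := by
    simp only [colSum_eq_posSum]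
    simp only [qDiff, Finset.mul_sum]
    rw [Finset.sum_comm]
    exact Finset.sum_congr rfl fun j _ => Finset.sum_congr rfl fun i _ => by ring
  rw [hlin, colSum_eq_posSum, colSum_eq_posSum, qPoch_conv hq1 (fun r => posSum q N n m r x y),
    Finset.mul_sum]
  refine Finset.sum_congr rfl fun j hj => ?_
  rw [Finset.mem_range] at hj
  rw [← hpos (k + 1 - j), show q ^ (k + 1) = q ^ j * q ^ (k + 1 - j) by
    rw [← pow_add]; congr 1; omega]
  ring

theorem colSum_left_zero (q : ℂ) (N m k : ℕ) (x y : ℕ → ℂ) :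
    colSum q N 0 m 0 k x y = (qPoch q k)⁻¹ := by
  cases N with
  | zero =>
    have h : ∀ n (z : ℕ → ℂ), wsum n q (List.replicate k 0) z = 1 := fun n z => by
      simpa [wsum_nil] using wsum_append_zeros n q [] k z
    simp [colSum, qSum, h]
  | succ N =>
    rw [colSum_eq_posSum, Finset.sum_range_succ, Finset.sum_eq_zero]
    · simp [posSum, qSum_zero_length, wsum_nil]
    · intro j hj
      rw [Finset.mem_range] at hj
      have h0 := qSum_const_mul q 0 N (k - j) (fun _ => 0)
      simp only [zero_mul] at h0
      rw [posSum, ← mul_zero (qPoch q j)⁻¹, ← h0]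
      congr 1
      refine qSum_congr fun s _ hl => ?_
      cases s with
      | nil => simp at hl; omega
      | cons h s => rw [wsum_zero_eq_zero (h := h + 1) (by simp) (by omega), zero_mul]

theorem colSum_right_zero (q : ℂ) (N n a k : ℕ) (x y : ℕ → ℂ) :
    colSum q N n 0 (a + 1) (k + 1) x y = 0 := by
  have h0 := qSum_const_mul q 0 N (k + 1) (fun _ => 0)
  simp only [zero_mul] at h0
  rw [colSum, ← h0]
  refine qSum_congr fun s _ hl => ?_
  cases s with
  | nil => simp at hl
  | cons h s => rw [wsum_zero_eq_zero (h := h + (a + 1)) (by simp) (by omega), mul_zero]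

/-- `colSum` is determined by its leading coefficients and its eigenvalue equations. -/
theorem colSum_unique {q : ℂ} (hq : q ≠ 0) (hq1 : ‖q‖ < 1)
    {J : ℕ → ℕ → ℕ → ℕ → (ℕ → ℂ) → (ℕ → ℂ) → ℂ}
    (hJ0 : ∀ n m a x y, J n m a 0 x y = 1)
    (hJl : ∀ m k x y, J 0 m 0 k x y = (qPoch q k)⁻¹)
    (hJr : ∀ n a k x y, J n 0 (a + 1) (k + 1) x y = 0)
    (htl : ∀ n m k y, HasTop (n + 1) k (J (n + 1) m 0 k · y) (J n m 1 k · y))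
    (htr : ∀ n m a k x, HasTop (m + 1) k (J n (m + 1) (a + 1) k x ·) (J n m a k x ·))
    (hel : ∀ n m k y x, Set.InjOn x (Finset.Icc 1 (n + 1)) →
      q ^ (k + 1) * qDiff (n + 1) q (J (n + 1) m 0 (k + 1) · y) x =
        J (n + 1) m 0 (k + 1) x y - J (n + 1) m 0 k x y)
    (her : ∀ n m a k x y, Set.InjOn y (Finset.Icc 1 (m + 1)) →
      q ^ (k + 1) * qDiff (m + 1) q (J n (m + 1) (a + 1) (k + 1) x ·) y =
        J n (m + 1) (a + 1) (k + 1) x y)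
    {N n : ℕ} (hN : n ≤ N) (m a k : ℕ) (x y : ℕ → ℂ) :
    colSum q N n m a k x y = J n m a k x y := by
  suffices H : ∀ t n m, n + m = t → ∀ k a N, n ≤ N → ∀ x y,
      colSum q N n m a k x y = J n m a k x y from H _ n m rfl k a N hN x y
  intro t
  induction t using Nat.strong_induction_on with
  | _ t iht =>
    intro n m hnm k
    induction k with
    | zero => intro a N _ x y; rw [colSum_zero, hJ0]
    | succ k ihk =>
      intro a N hN x y
      cases a with
      | zero =>
        cases n with
        | zero => rw [colSum_left_zero, hJl]
        | succ n =>
          obtain ⟨N, rfl⟩ : ∃ M, N = M + 1 := ⟨N - 1, by omega⟩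
          rw [← sub_eq_zero]
          refine eigen_unique (n := n + 1) (k := k + 1) (by omega) hq hq1
            (f := fun x => colSum q (N + 1) (n + 1) m 0 (k + 1) x y - J (n + 1) m 0 (k + 1) x y)
            (((hasTop_colSum_left q N n m 0 (k + 1) y).sub (htl n m (k + 1) y)).congr
              (fun _ => rfl) fun x => ?_) (fun x hx => ?_) x
          · rw [iht (n + m) (by omega) n m rfl (k + 1) (0 + 1) N (by omega) x y, sub_self]
          · rw [qDiff_sub, mul_sub, eigen_colSum_left (by omega) hq hq1 N m k y hx,
              hel n m k y x hx, ihk 0 (N + 1) hN]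
            ring
      | succ a =>
        cases m with
        | zero => rw [colSum_right_zero, hJr]
        | succ m =>
          rw [← sub_eq_zero]
          refine eigen_unique (n := m + 1) (k := k + 1) (by omega) hq hq1
            (f := fun y => colSum q N n (m + 1) (a + 1) (k + 1) x y -
              J n (m + 1) (a + 1) (k + 1) x y)
            (((hasTop_colSum_right q N n m a (k + 1) x).sub (htr n m a (k + 1) x)).congr
              (fun _ => rfl) fun y => ?_) (fun y hy => ?_) y
          · rw [iht (n + m) (by omega) n m rfl (k + 1) a N hN x y, sub_self]
          · rw [qDiff_sub, mul_sub, eigen_colSum_right (by omega) hq N n a (k + 1) x hy,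
              her n m a k x y hy]


/-! ### Integration over a compact torus -/

/-- The unit circle, embedded in the complex plane. -/
noncomputable def circ (θ : UnitAddCircle) : ℂ := (AddCircle.toCircle θ : ℂ)

@[fun_prop]
theorem continuous_circ : Continuous circ :=
  continuous_subtype_val.comp AddCircle.continuous_toCircle

theorem norm_circ (θ : UnitAddCircle) : ‖circ θ‖ = 1 := Circle.norm_coe _

theorem circ_ne_zero (θ : UnitAddCircle) : circ θ ≠ 0 := Circle.coe_ne_zero _

theorem circ_neg (θ : UnitAddCircle) : circ (-θ) = (circ θ)⁻¹ := by
  simp [circ, AddCircle.toCircle_neg]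

/-- Mean value property on the unit circle. -/
theorem integral_circ {f : ℂ → ℂ} (hf : DiffContOnCl ℂ f (Metric.ball 0 1)) :
    ∫ θ : UnitAddCircle, f (circ θ) = f 0 := by
  have h := DiffContOnCl.circleAverage (f := f) (c := 0) (R := 1) (by simpa using hf)
  rw [← h, Real.circleAverage_def, ← UnitAddCircle.intervalIntegral_preimage 0]
  have h2 : ∀ a : ℝ, f (circ (a : UnitAddCircle)) = f (circleMap 0 1 (2 * Real.pi * a)) := by
    intro a
    simp [circ, AddCircle.toCircle_apply_mk, circleMap]
  simp only [h2]
  rw [intervalIntegral.integral_comp_mul_left (fun t => f (circleMap 0 1 t)) (by positivity)]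
  simp

theorem integral_circ_inv (f : ℂ → ℂ) :
    ∫ θ : UnitAddCircle, f (circ θ)⁻¹ = ∫ θ : UnitAddCircle, f (circ θ) := by
  simp only [← circ_neg]
  exact MeasureTheory.integral_neg_eq_self (fun θ => f (circ θ)) MeasureTheory.volume

theorem integrable_of_continuous {T : Type*} [TopologicalSpace T] [CompactSpace T]
    [MeasurableSpace T] [BorelSpace T] (μ : MeasureTheory.Measure T)
    [MeasureTheory.IsFiniteMeasure μ] {f : T → ℂ}
    (hf : Continuous f) : MeasureTheory.Integrable f μ :=
  hf.integrable_of_hasCompactSupport (HasCompactSupport.of_compactSpace f)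

theorem continuous_integral_param {T X : Type*} [TopologicalSpace T] [CompactSpace T]
    [MeasurableSpace T] [BorelSpace T] (μ : MeasureTheory.Measure T)
    [MeasureTheory.IsFiniteMeasure μ] [TopologicalSpace X] {f : X → T → ℂ}
    (hf : Continuous (Function.uncurry f)) : Continuous fun x => ∫ t, f x t ∂μ := by
  rw [continuous_iff_continuousAt]
  intro x₀
  rw [ContinuousAt, tendsto_iff_norm_sub_tendsto_zero, Metric.tendsto_nhds]
  intro ε hε
  set δ := ε / (μ.real Set.univ + 1) with hδ
  have hM : 0 < μ.real Set.univ + 1 := by positivity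
  have hδ0 : 0 < δ := by positivity
  have h1 : ∀ᶠ x in nhds x₀, ∀ t ∈ (Set.univ : Set T), dist (f x t) (f x₀ t) < δ := by
    have hc : Continuous fun p : X × T => dist (f p.1 p.2) (f x₀ p.2) := by fun_prop
    refine isCompact_univ.eventually_forall_of_forall_eventually fun t _ => ?_
    refine hc.continuousAt.eventually_lt continuousAt_const ?_
    simpa using hδ0
  filter_upwards [h1] with x hx
  have i1 : MeasureTheory.Integrable (f x) μ := integrable_of_continuous μ (by fun_prop)
  have i2 : MeasureTheory.Integrable (f x₀) μ := integrable_of_continuous μ (by fun_prop)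
  rw [dist_zero_right, norm_norm, ← MeasureTheory.integral_sub i1 i2]
  calc _ ≤ δ * μ.real Set.univ :=
        MeasureTheory.norm_integral_le_of_norm_le_const (Filter.Eventually.of_forall fun t => by
          rw [← dist_eq_norm]; exact (hx t (Set.mem_univ t)).le)
    _ < δ * (μ.real Set.univ + 1) := by nlinarith
    _ = ε := by rw [hδ]; field_simp

/-- Fubini for one distinguished coordinate of the torus. -/
theorem integral_insertNth {k : ℕ} (m : Fin (k + 1)) {f : (Fin (k + 1) → UnitAddCircle) → ℂ}
    (hf : Continuous f) : ∫ θ, f θ = ∫ η : Fin k → UnitAddCircle, ∫ t, f (m.insertNth t η) := by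
  have h := ((MeasureTheory.volume_preserving_piFinSuccAbove
    (fun _ : Fin (k + 1) => UnitAddCircle) m).symm).integral_comp' f
  rw [← h, MeasureTheory.Measure.volume_eq_prod, MeasureTheory.integral_prod_symm]
  · rfl
  · rw [← MeasureTheory.Measure.volume_eq_prod]
    exact integrable_of_continuous _
      (hf.comp (Continuous.finInsertNth (A := fun _ => UnitAddCircle) m continuous_fst
        continuous_snd))

theorem integral_neg_torus {k : ℕ} (f : (Fin k → UnitAddCircle) → ℂ) :
    ∫ θ, f (-θ) = ∫ θ, f θ :=
  have : (MeasureTheory.volume : MeasureTheory.Measure (Fin k → UnitAddCircle)).IsNegInvariant :=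
    MeasureTheory.Measure.pi.isNegInvariant _
  MeasureTheory.integral_neg_eq_self f MeasureTheory.volume


/-! ### The torus weight and its behaviour under the `q`-difference operator -/

/-- The product `∏_{i ≤ n} (1 + x_i z)`. -/
noncomputable def facX (n : ℕ) (x : ℕ → ℂ) (z : ℂ) : ℂ := ∏ i ∈ Finset.Icc 1 n, (1 + x i * z)

/-- The function `(1 - u) / (1 - q u)`. -/
noncomputable def qKer (q u : ℂ) : ℂ := (1 - u) / (1 - q * u)

/-- The weight `∏_{i ≠ j} (1 - z_i / z_j) / (1 - q z_i / z_j)`. -/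
noncomputable def qWt (q : ℂ) {k : ℕ} (z : Fin k → ℂ) : ℂ :=
  ∏ i, ∏ j ∈ Finset.univ.erase i, qKer q (z i / z j)

theorem facX_update {n i : ℕ} (hi : i ∈ Finset.Icc 1 n) (x : ℕ → ℂ) (w z : ℂ) :
    facX n (Function.update x i w) z =
      (1 + w * z) * ∏ j ∈ (Finset.Icc 1 n).erase i, (1 + x j * z) := by
  rw [facX, ← Finset.mul_prod_erase _ _ hi, Function.update_self]
  congr 1
  refine Finset.prod_congr rfl fun j hj => ?_
  rw [Function.update_of_ne (Finset.ne_of_mem_erase hj)]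

theorem lagC_eq_div {n i : ℕ} (hi : i ∈ Finset.Icc 1 n) (x : ℕ → ℂ) :
    lagC x n i = x i ^ (n - 1) / ∏ j ∈ (Finset.Icc 1 n).erase i, (x i - x j) := by
  rw [lagC, ← Finset.mul_prod_erase _ _ hi, if_pos rfl, one_mul,
    Finset.prod_congr rfl fun j hj => if_neg (Finset.ne_of_mem_erase hj), Finset.prod_div_distrib,
    Finset.prod_const, Finset.card_erase_of_mem hi, Nat.card_Icc]
  simp

theorem erase_inl_disjSum {α β : Type*} [DecidableEq α] [DecidableEq β] (s : Finset α)
    (t : Finset β) (a : α) : (s.disjSum t).erase (Sum.inl a) = (s.erase a).disjSum t := by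
  ext (c | c) <;> simp

theorem erase_inr_disjSum {α β : Type*} [DecidableEq α] [DecidableEq β] (s : Finset α)
    (t : Finset β) (b : β) : (s.disjSum t).erase (Sum.inr b) = s.disjSum (t.erase b) := by
  ext (c | c) <;> simp

open Polynomial in
theorem coeff_X_pow_mul_prod (n : ℕ) {K : ℕ} (w : Fin K → ℂ) :
    (X ^ n * ∏ m, (1 + C (w m) * X)).coeff (n + K) = ∏ m, w m := by
  rw [add_comm, coeff_X_pow_mul]
  have h := coeff_prod_of_natDegree_le (s := Finset.univ) (fun m => 1 + C (w m) * X) 1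
    (fun m _ => by compute_degree)
  simpa [coeff_one] using h

open Polynomial in
theorem degree_X_pow_mul_prod_lt (n : ℕ) {K : ℕ} (w : Fin K → ℂ) :
    (X ^ n * ∏ m, (1 + C (w m) * X)).degree < ((n + K + 1 : ℕ) : WithBot ℕ) := by
  refine lt_of_le_of_lt degree_le_natDegree (WithBot.coe_lt_coe.2 (Nat.lt_succ_of_le ?_))
  refine natDegree_mul_le.trans (add_le_add (natDegree_X_pow_le _) ?_)
  refine (natDegree_prod_le _ _).trans ((Finset.sum_le_card_nsmul _ _ 1 fun m _ => ?_).trans ?_)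
  · compute_degree
  · simp

theorem qDiff_prod_facX_of_ne {n K : ℕ} (hn : 1 ≤ n) {q : ℂ} (hq : q ≠ 0) {x : ℕ → ℂ}
    (hx : Set.InjOn x (Finset.Icc 1 n)) {z : Fin K → ℂ} (hz : Function.Injective z)
    (hz0 : ∀ m, z m ≠ 0) (hxz : ∀ i ∈ Finset.Icc 1 n, ∀ m, 1 + x i * z m ≠ 0) :
    q ^ K * qDiff n q (fun x => ∏ m, facX n x (z m)) x =
      ∏ m, facX n x (z m) + q ^ K * (1 - q⁻¹) * ∑ m, ∏ l ∈ Finset.univ.erase m,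
        ((1 - z l / (q * z m)) / (1 - z l / z m) * facX n x (z l)) := by
  classical
  obtain ⟨n, rfl⟩ : ∃ r, n = r + 1 := ⟨n - 1, by omega⟩
  set s := (Finset.Icc 1 (n + 1)).disjSum (Finset.univ : Finset (Fin K)) with hs
  set v : ℕ ⊕ Fin K → ℂ := Sum.elim x fun m => -(z m)⁻¹ with hv
  have hne : ∀ i ∈ Finset.Icc 1 (n + 1), ∀ m, x i ≠ -(z m)⁻¹ := by
    intro i hi m h
    refine hxz i hi m ?_
    rw [h]; field_simp [hz0 m]; ring
  have hvs : Set.InjOn v s := by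
    rintro (i | m) hi (j | l) hj h
    · simp only [hv, Sum.elim_inl] at h
      rw [hx (by simpa [hs] using hi) (by simpa [hs] using hj) h]
    · simp only [hv, Sum.elim_inl, Sum.elim_inr] at h
      exact absurd h (hne i (by simpa [hs] using hi) l)
    · simp only [hv, Sum.elim_inl, Sum.elim_inr] at h
      exact absurd h.symm (hne j (by simpa [hs] using hj) m)
    · simp only [hv, Sum.elim_inr, neg_inj, inv_inj] at h
      rw [hz h]
  have hcard : s.card = n + K + 1 := by simp [hs]; omega
  have hA : ∏ m, facX (n + 1) x (z m) ≠ 0 := Finset.prod_ne_zero_iff.2 fun m _ =>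
    Finset.prod_ne_zero_iff.2 fun i hi => hxz i hi m
  have hZ : ∏ m, z m ≠ 0 := Finset.prod_ne_zero_iff.2 fun m _ => hz0 m
  have key := Lagrange.coeff_eq_sum hvs
    (hcard ▸ degree_X_pow_mul_prod_lt n fun m => z m / q)
  rw [hcard, Nat.add_sub_cancel, coeff_X_pow_mul_prod, hs, Finset.sum_disjSum,
    Finset.prod_div_distrib, Finset.prod_const, Finset.card_univ, Fintype.card_fin] at key
  simp only [erase_inl_disjSum, erase_inr_disjSum, Finset.prod_disjSum, hv, Sum.elim_inl,
    Sum.elim_inr, Polynomial.eval_mul, Polynomial.eval_pow, Polynomial.eval_X,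
    Polynomial.eval_prod, Polynomial.eval_add, Polynomial.eval_one, Polynomial.eval_C] at key
  have e1 : ∀ i ∈ Finset.Icc 1 (n + 1), (x i ^ n * ∏ m, (1 + z m / q * x i)) /
      ((∏ j ∈ (Finset.Icc 1 (n + 1)).erase i, (x i - x j)) * ∏ m, (x i - -(z m)⁻¹)) =
      lagC x (n + 1) i * (∏ m, facX (n + 1) (Function.update x i (x i / q)) (z m)) *
        ((∏ m, z m) / ∏ m, facX (n + 1) x (z m)) := by
    intro i hi
    rw [lagC_eq_div hi, Nat.add_sub_cancel]
    have e2 : ∀ m, facX (n + 1) (Function.update x i (x i / q)) (z m) * z m =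
        facX (n + 1) x (z m) * ((1 + z m / q * x i) / (x i - -(z m)⁻¹)) := by
      intro m
      have := hz0 m
      have h1 := hxz i hi m
      have h2 : x i - -(z m)⁻¹ = (1 + x i * z m) / z m := by field_simp; ring
      rw [facX_update hi, h2, facX, ← Finset.mul_prod_erase _ _ hi]
      field_simp
    have e3 := Finset.prod_congr (s₁ := Finset.univ) rfl fun m (_ : m ∈ Finset.univ) => e2 m
    simp only [Finset.prod_mul_distrib, Finset.prod_div_distrib] at e3
    rw [mul_assoc, ← mul_div_assoc, e3, mul_div_assoc, mul_div_cancel_left₀ _ hA]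
    ring
  have e4 : ∀ m, ((-(z m)⁻¹) ^ n * ∏ l, (1 + z l / q * -(z m)⁻¹)) /
      ((∏ j ∈ Finset.Icc 1 (n + 1), (-(z m)⁻¹ - x j)) *
        ∏ l ∈ Finset.univ.erase m, (-(z m)⁻¹ - -(z l)⁻¹)) =
      -(1 - q⁻¹) * (∏ l ∈ Finset.univ.erase m,
        ((1 - z l / (q * z m)) / (1 - z l / z m) * facX (n + 1) x (z l))) *
        ((∏ m, z m) / ∏ m, facX (n + 1) x (z m)) := by
    intro m
    have hm := hz0 m
    have h1 : ∏ j ∈ Finset.Icc 1 (n + 1), (-(z m)⁻¹ - x j) =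
        (-(z m)⁻¹) ^ (n + 1) * facX (n + 1) x (z m) := by
      have hc : (-(z m)⁻¹) ^ (n + 1) = ∏ _j ∈ Finset.Icc 1 (n + 1), -(z m)⁻¹ := by simp
      rw [facX, hc, ← Finset.prod_mul_distrib]
      refine Finset.prod_congr rfl fun j _ => ?_
      field_simp
      ring
    have h2 : ∏ l ∈ Finset.univ.erase m, (-(z m)⁻¹ - -(z l)⁻¹) =
        (∏ l ∈ Finset.univ.erase m, (1 - z l / z m)) / ∏ l ∈ Finset.univ.erase m, z l := by
      rw [← Finset.prod_div_distrib]
      refine Finset.prod_congr rfl fun l _ => ?_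
      have := hz0 l
      field_simp
      ring
    have h3 : ∏ l ∈ Finset.univ.erase m, (1 - z l / z m) ≠ 0 := by
      refine Finset.prod_ne_zero_iff.2 fun l hl => ?_
      rw [sub_ne_zero]
      intro h
      rw [eq_div_iff hm, one_mul] at h
      exact Finset.ne_of_mem_erase hl (hz h.symm)
    have h4 : ∏ l ∈ Finset.univ.erase m, z l ≠ 0 := Finset.prod_ne_zero_iff.2 fun m _ => hz0 m
    have h5 : ∏ l ∈ Finset.univ.erase m, facX (n + 1) x (z l) ≠ 0 :=
      Finset.prod_ne_zero_iff.2 fun l _ => Finset.prod_ne_zero_iff.2 fun i hi => hxz i hi l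
    have h6 : facX (n + 1) x (z m) ≠ 0 := Finset.prod_ne_zero_iff.2 fun i hi => hxz i hi m
    have h7 : ∏ l, (1 + z l / q * -(z m)⁻¹) =
        (1 - q⁻¹) * ∏ l ∈ Finset.univ.erase m, (1 - z l / (q * z m)) := by
      rw [← Finset.mul_prod_erase _ _ (Finset.mem_univ m)]
      congr 1
      · field_simp; ring
      · exact Finset.prod_congr rfl fun l _ => by field_simp; ring
    rw [h1, h2, h7, Finset.prod_mul_distrib, Finset.prod_div_distrib,
      ← Finset.mul_prod_erase _ z (Finset.mem_univ m),
      ← Finset.mul_prod_erase _ (fun m => facX (n + 1) x (z m)) (Finset.mem_univ m), pow_succ]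
    have h8 : (-(z m)⁻¹) ^ n ≠ 0 := pow_ne_zero _ (neg_ne_zero.2 (inv_ne_zero hm))
    generalize (-(z m)⁻¹) ^ n = c at *
    field_simp
  rw [Finset.sum_congr rfl e1, Finset.sum_congr rfl fun m _ => e4 m, ← Finset.sum_mul,
    ← Finset.sum_mul, ← Finset.mul_sum] at key
  change _ = qDiff (n + 1) q (fun x => ∏ m, facX (n + 1) x (z m)) x * _ + _ at key
  generalize (∑ m, ∏ l ∈ Finset.univ.erase m,
    ((1 - z l / (q * z m)) / (1 - z l / z m) * facX (n + 1) x (z l))) = S at *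
  generalize qDiff (n + 1) q (fun x => ∏ m, facX (n + 1) x (z m)) x = D at *
  generalize ∏ m, facX (n + 1) x (z m) = A at *
  generalize ∏ m, z m = Z at *
  field_simp at key ⊢
  linear_combination -key

open Filter Topology in
theorem qDiff_prod_facX {n K : ℕ} (hn : 1 ≤ n) {q : ℂ} (hq : q ≠ 0) {x : ℕ → ℂ}
    (hx : Set.InjOn x (Finset.Icc 1 n)) {z : Fin K → ℂ} (hz : Function.Injective z)
    (hz0 : ∀ m, z m ≠ 0) :
    q ^ K * qDiff n q (fun x => ∏ m, facX n x (z m)) x =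
      ∏ m, facX n x (z m) + q ^ K * (1 - q⁻¹) * ∑ m, ∏ l ∈ Finset.univ.erase m,
        ((1 - z l / (q * z m)) / (1 - z l / z m) * facX n x (z l)) := by
  set L : ℂ → ℂ := fun t => q ^ K * ∑ i ∈ Finset.Icc 1 n, lagC x n i *
    ∏ m, facX n (fun j => t * Function.update x i (x i / q) j) (z m) with hL
  set R : ℂ → ℂ := fun t => ∏ m, facX n (fun i => t * x i) (z m) +
    q ^ K * (1 - q⁻¹) * ∑ m, ∏ l ∈ Finset.univ.erase m,
      ((1 - z l / (q * z m)) / (1 - z l / z m) * facX n (fun i => t * x i) (z l)) with hR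
  have hLc : Continuous L := by unfold L facX; fun_prop
  have hRc : Continuous R := by unfold R facX; fun_prop
  have hLR : ∀ᶠ t in 𝓝[≠] (1 : ℂ), L t = R t := by
    have h0 : ∀ᶠ t in 𝓝[≠] (1 : ℂ), t ≠ 0 :=
      eventually_nhdsWithin_of_eventually_nhds (eventually_ne_nhds one_ne_zero)
    have h1 : ∀ᶠ t in 𝓝[≠] (1 : ℂ), ∀ i ∈ Finset.Icc 1 n, ∀ m : Fin K,
        1 + t * x i * z m ≠ 0 := by
      rw [Filter.eventually_all_finset]
      intro i _
      rw [Filter.eventually_all]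
      intro m
      by_cases h : 1 + x i * z m = 0
      · filter_upwards [self_mem_nhdsWithin] with t ht h'
        have : (t - 1) * (x i * z m) = 0 := by linear_combination h' - h
        rcases mul_eq_zero.1 this with h2 | h2
        · exact ht (sub_eq_zero.1 h2)
        · rw [h2] at h; norm_num at h
      · refine eventually_nhdsWithin_of_eventually_nhds ?_
        have hc : ContinuousAt (fun t : ℂ => 1 + t * x i * z m) 1 := by fun_prop
        exact hc.eventually_ne (by simpa using h)
    filter_upwards [h0, h1] with t ht ht1
    have h := qDiff_prod_facX_of_ne hn hq (x := fun i => t * x i)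
      (fun i hi j hj hij => hx hi hj (mul_left_cancel₀ ht hij)) hz hz0 ht1
    rw [hR]
    refine Eq.trans ?_ h
    simp only [hL, qDiff]
    congr 1
    refine Finset.sum_congr rfl fun i _ => ?_
    congr 1
    · refine Finset.prod_congr rfl fun j _ => ?_
      split_ifs
      · rfl
      · rw [← mul_sub, mul_div_mul_left _ _ ht]
    · congr! 3 with m _ j
      by_cases hj : j = i
      · subst hj; simp [mul_div_assoc]
      · simp [Function.update_of_ne hj]
  have h := tendsto_nhds_unique_of_eventuallyEq
    ((hLc.tendsto 1).mono_left nhdsWithin_le_nhds)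
    ((hRc.tendsto 1).mono_left nhdsWithin_le_nhds) hLR
  simpa only [hL, hR, one_mul, qDiff] using h

theorem prod_erase_eq_prod_ite {ι : Type*} [Fintype ι] [DecidableEq ι] (i : ι) (f : ι → ℂ) :
    ∏ j ∈ Finset.univ.erase i, f j = ∏ j, if j = i then 1 else f j := by
  rw [← Finset.mul_prod_erase Finset.univ _ (Finset.mem_univ i), if_pos rfl, one_mul]
  exact Finset.prod_congr rfl fun j hj => (if_neg (Finset.ne_of_mem_erase hj)).symm

theorem prod_erase_eq_prod_succAbove {k : ℕ} (m : Fin (k + 1)) (f : Fin (k + 1) → ℂ) :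
    ∏ j ∈ Finset.univ.erase m, f j = ∏ l, f (m.succAbove l) := by
  simp [prod_erase_eq_prod_ite, Fin.prod_univ_succAbove _ m]

theorem qWt_succAbove (q : ℂ) {k : ℕ} (z : Fin (k + 1) → ℂ) (m : Fin (k + 1)) :
    qWt q z = (∏ l, (qKer q (z (m.succAbove l) / z m) * qKer q (z m / z (m.succAbove l)))) *
      qWt q (fun l => z (m.succAbove l)) := by
  simp only [qWt, prod_erase_eq_prod_ite, Fin.prod_univ_succAbove _ m, if_true, one_mul,
    Fin.succAbove_ne, (Fin.succAbove_ne m _).symm, if_false, Finset.prod_mul_distrib,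
    Fin.succAbove_right_inj]
  ring

theorem qWt_eq_zero (q : ℂ) {k : ℕ} {z : Fin k → ℂ} (hz0 : ∀ m, z m ≠ 0)
    (hz : ¬ Function.Injective z) : qWt q z = 0 := by
  obtain ⟨i, j, h, hij⟩ := Function.not_injective_iff.1 hz
  refine Finset.prod_eq_zero (Finset.mem_univ i)
    (Finset.prod_eq_zero (Finset.mem_erase.2 ⟨hij.symm, Finset.mem_univ j⟩) ?_)
  rw [h, div_self (hz0 j), qKer, sub_self, zero_div]

theorem qDiff_prod_facX_mul_qWt {n k : ℕ} (hn : 1 ≤ n) {q : ℂ} (hq : q ≠ 0) {x : ℕ → ℂ}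
    (hx : Set.InjOn x (Finset.Icc 1 n)) {z : Fin (k + 1) → ℂ} (hz0 : ∀ m, z m ≠ 0)
    (hqz : ∀ i j, 1 - q * (z i / z j) ≠ 0) :
    q ^ (k + 1) * qDiff n q (fun x => ∏ m, facX n x (z m)) x * qWt q z =
      (∏ m, facX n x (z m)) * qWt q z + (q ^ (k + 1) * (1 - q⁻¹)) * ∑ m : Fin (k + 1),
        (∏ l, q⁻¹ * qKer q (z (m.succAbove l) / z m)) *
        ((∏ l, facX n x (z (m.succAbove l))) * qWt q (fun l => z (m.succAbove l))) := by
  by_cases hz : Function.Injective z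
  · rw [qDiff_prod_facX hn hq hx hz hz0, add_mul, mul_assoc (q ^ (k + 1) * (1 - q⁻¹)),
      Finset.sum_mul]
    congr 2
    refine Finset.sum_congr rfl fun m _ => ?_
    rw [prod_erase_eq_prod_succAbove, qWt_succAbove q z m, ← mul_assoc, ← mul_assoc,
      ← Finset.prod_mul_distrib, ← Finset.prod_mul_distrib]
    congr 1
    refine Finset.prod_congr rfl fun l _ => ?_
    have h2 := hqz m (m.succAbove l)
    have h3 := hqz (m.succAbove l) m
    have h4 := hz0 m
    have h5 := hz0 (m.succAbove l)
    have h6 : z m - z (m.succAbove l) ≠ 0 := sub_ne_zero.2 fun h => Fin.succAbove_ne m l (hz h).symm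
    generalize z m = a at *
    generalize z (m.succAbove l) = b at *
    have h7 : b - q * a ≠ 0 := by
      have : 1 - q * (a / b) = (b - q * a) / b := by field_simp
      rw [this] at h2; exact (div_ne_zero_iff.1 h2).1
    have h8 : a - q * b ≠ 0 := by
      have : 1 - q * (b / a) = (a - q * b) / a := by field_simp
      rw [this] at h3; exact (div_ne_zero_iff.1 h3).1
    have e1 : 1 - b / (q * a) = -(b - q * a) / (q * a) := by field_simp; ring
    have e2 : 1 - b / a = (a - b) / a := by field_simp
    have e3 : qKer q (b / a) = (a - b) / (a - q * b) := by
      rw [qKer, e2, show 1 - q * (b / a) = (a - q * b) / a by field_simp,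
        div_div_div_cancel_right₀ h4]
    have e4 : qKer q (a / b) = -(a - b) / (b - q * a) := by
      rw [qKer, show 1 - a / b = -(a - b) / b by field_simp; ring,
        show 1 - q * (a / b) = (b - q * a) / b by field_simp, div_div_div_cancel_right₀ h5]
    rw [e1, e2, e3, e4]
    field_simp
  · rw [qWt_eq_zero q hz0 hz, mul_zero, mul_zero, zero_add, Finset.sum_eq_zero, mul_zero]
    intro m _
    obtain ⟨i, j, h, hij⟩ := Function.not_injective_iff.1 hz
    have h0 : qKer q 1 = 0 := by rw [qKer, sub_self, zero_div]
    have hcase : ∀ i j : Fin (k + 1), i = m → z i = z j → i ≠ j →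
        ∏ l, q⁻¹ * qKer q (z (m.succAbove l) / z m) = 0 := by
      rintro i j rfl h hij
      obtain ⟨l, rfl⟩ := Fin.exists_succAbove_eq hij.symm
      refine Finset.prod_eq_zero (Finset.mem_univ l) ?_
      rw [← h, div_self (hz0 _), h0, mul_zero]
    by_cases hi : i = m
    · rw [hcase i j hi h hij, zero_mul]
    by_cases hj : j = m
    · rw [hcase j i hj h.symm (Ne.symm hij), zero_mul]
    obtain ⟨i, rfl⟩ := Fin.exists_succAbove_eq hi
    obtain ⟨j, rfl⟩ := Fin.exists_succAbove_eq hj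
    rw [qWt_eq_zero q (fun _ => hz0 _), mul_zero, mul_zero]
    exact fun hinj => hij (congrArg _ (hinj h))


/-- The normalized torus integral of `∏ g(z_m)` against the weight `qWt`. -/
noncomputable def torInt (q : ℂ) (k : ℕ) (g : ℂ → ℂ) : ℂ :=
  ((k.factorial : ℂ) * (1 - q) ^ k)⁻¹ * ∫ θ : Fin k → UnitAddCircle,
    (∏ m, g (circ (θ m))) * qWt q fun m => circ (θ m)

theorem one_sub_mul_ne_zero {q u : ℂ} (hq : ‖q‖ < 1) (hu : ‖u‖ ≤ 1) : 1 - q * u ≠ 0 := by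
  intro h
  have h1 : ‖q * u‖ = 1 := by rw [← sub_eq_zero.1 h, norm_one]
  rw [norm_mul] at h1
  nlinarith [norm_nonneg q, norm_nonneg u]

theorem norm_circ_div (s t : UnitAddCircle) : ‖circ s / circ t‖ = 1 := by
  rw [norm_div, norm_circ, norm_circ, div_one]

theorem continuous_qWt {q : ℂ} (hq : ‖q‖ < 1) (k : ℕ) :
    Continuous fun θ : Fin k → UnitAddCircle => qWt q fun m => circ (θ m) := by
  unfold qWt qKer
  refine continuous_finsetProd _ fun i _ => continuous_finsetProd _ fun j _ => ?_
  have h : Continuous fun θ : Fin k → UnitAddCircle => circ (θ i) / circ (θ j) :=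
    Continuous.div₀ (by fun_prop) (by fun_prop) fun θ => circ_ne_zero _
  exact Continuous.div₀ (by fun_prop) (by fun_prop)
    fun θ => one_sub_mul_ne_zero hq (norm_circ_div _ _).le

theorem torInt_zero (q : ℂ) (g : ℂ → ℂ) : torInt q 0 g = 1 := by
  simp only [torInt, qWt, Finset.univ_eq_empty, Finset.prod_empty, mul_one]
  rw [MeasureTheory.volume_pi, MeasureTheory.Measure.pi_of_empty, MeasureTheory.integral_dirac]
  simp

theorem torInt_inv (q : ℂ) (k : ℕ) (g : ℂ → ℂ) : torInt q k (fun z => g z⁻¹) = torInt q k g := by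
  unfold torInt
  rw [← integral_neg_torus]
  have h : ∀ θ : Fin k → UnitAddCircle,
      (qWt q fun m => circ ((-θ) m)) = qWt q fun m => circ (θ m) := fun θ => by
    simp only [qWt, prod_erase_eq_prod_ite, Pi.neg_apply, circ_neg]
    rw [Finset.prod_comm]
    refine Finset.prod_congr rfl fun i _ => Finset.prod_congr rfl fun j _ => ?_
    by_cases hij : i = j
    · simp [hij]
    · rw [if_neg hij, if_neg (Ne.symm hij)]
      congr 1
      field_simp [circ_ne_zero]
  simp only [h]
  simp only [Pi.neg_apply, circ_neg, inv_inv]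

theorem continuous_facX (n : ℕ) : Continuous fun p : (ℕ → ℂ) × ℂ => facX n p.1 p.2 := by
  unfold facX; fun_prop

theorem integral_qKer {q : ℂ} (hq : ‖q‖ < 1) {k : ℕ} (η : Fin k → UnitAddCircle) {H : ℂ → ℂ}
    (hH : Differentiable ℂ H) :
    ∫ t, (∏ l, q⁻¹ * qKer q (circ (η l) / circ t)) * H (circ t)⁻¹ = (q⁻¹) ^ k * H 0 := by
  have h1 : DifferentiableOn ℂ (fun u => (∏ l, q⁻¹ * qKer q (circ (η l) * u)) * H u)
      (Metric.closedBall 0 1) := by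
    refine DifferentiableOn.mul (DifferentiableOn.fun_finsetProd fun l _ => ?_)
      hH.differentiableOn
    unfold qKer
    refine (DifferentiableOn.div (by fun_prop) (by fun_prop) fun u hu => ?_).const_mul _
    refine one_sub_mul_ne_zero hq ?_
    rw [norm_mul, norm_circ, one_mul]
    simpa using hu
  have h2 := integral_circ (f := fun u => (∏ l, q⁻¹ * qKer q (circ (η l) * u)) * H u)
    (DifferentiableOn.diffContOnCl (by rwa [closure_ball _ one_ne_zero]))
  rw [← integral_circ_inv fun u => (∏ l, q⁻¹ * qKer q (circ (η l) * u)) * H u] at h2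
  simpa [div_eq_mul_inv, qKer] using h2

theorem qDiff_torInt {n k : ℕ} (hn : 1 ≤ n) {q : ℂ} (hq : q ≠ 0) (hq1 : ‖q‖ < 1) {x : ℕ → ℂ}
    (hx : Set.InjOn x (Finset.Icc 1 n)) {H : ℂ → ℂ} (hH : Differentiable ℂ H) :
    q ^ (k + 1) * qDiff n q (fun x => torInt q (k + 1) fun z => facX n x z * H z⁻¹) x =
      (torInt q (k + 1) fun z => facX n x z * H z⁻¹) -
        H 0 * torInt q k fun z => facX n x z * H z⁻¹ := by
  have hHc : Continuous fun t : UnitAddCircle => H (circ t)⁻¹ :=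
    hH.continuous.comp (continuous_circ.inv₀ circ_ne_zero)
  have hfc : ∀ x : ℕ → ℂ, Continuous fun t : UnitAddCircle => facX n x (circ t) := fun x =>
    (continuous_facX n).comp (continuous_const.prodMk continuous_circ)
  have hWc := continuous_qWt hq1
  have hint : ∀ x : ℕ → ℂ, MeasureTheory.Integrable fun θ : Fin (k + 1) → UnitAddCircle =>
      (∏ m, facX n x (circ (θ m)) * H (circ (θ m))⁻¹) * qWt q fun m => circ (θ m) := fun x =>
    integrable_of_continuous _ ((continuous_finsetProd _ fun m _ =>
      ((hfc x).comp (continuous_apply m)).mul (hHc.comp (continuous_apply m))).mul (hWc _))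
  have hKc : ∀ m : Fin (k + 1), Continuous fun θ : Fin (k + 1) → UnitAddCircle =>
      ((∏ l, q⁻¹ * qKer q (circ (θ (m.succAbove l)) / circ (θ m))) *
        ((∏ l, facX n x (circ (θ (m.succAbove l)))) *
          qWt q (fun l => circ (θ (m.succAbove l))))) * ∏ m, H (circ (θ m))⁻¹ := by
    intro m
    refine Continuous.mul (Continuous.mul (continuous_finsetProd _ fun l _ => ?_)
      (Continuous.mul (continuous_finsetProd _ fun l _ =>
        (hfc x).comp (continuous_apply (m.succAbove l)))
        ((hWc k).comp (f := fun θ : Fin (k + 1) → UnitAddCircle => fun l => θ (m.succAbove l))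
          (by fun_prop)))) (continuous_finsetProd _ fun m _ => hHc.comp (continuous_apply m))
    have h : Continuous fun θ : Fin (k + 1) → UnitAddCircle =>
        circ (θ (m.succAbove l)) / circ (θ m) :=
      Continuous.div₀ (by fun_prop) (by fun_prop) fun θ => circ_ne_zero _
    unfold qKer
    exact continuous_const.mul (Continuous.div₀ (by fun_prop) (by fun_prop)
      fun θ => one_sub_mul_ne_zero hq1 (norm_circ_div _ _).le)
  have hpt : ∀ θ : Fin (k + 1) → UnitAddCircle,
      q ^ (k + 1) * ∑ i ∈ Finset.Icc 1 n, lagC x n i *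
        ((∏ m, facX n (Function.update x i (x i / q)) (circ (θ m)) * H (circ (θ m))⁻¹) *
          qWt q fun m => circ (θ m)) =
      ((∏ m, facX n x (circ (θ m)) * H (circ (θ m))⁻¹) * qWt q fun m => circ (θ m)) +
      (q ^ (k + 1) * (1 - q⁻¹)) * ∑ m : Fin (k + 1),
        ((∏ l, q⁻¹ * qKer q (circ (θ (m.succAbove l)) / circ (θ m))) *
        ((∏ l, facX n x (circ (θ (m.succAbove l)))) *
          qWt q (fun l => circ (θ (m.succAbove l))))) * ∏ m, H (circ (θ m))⁻¹ := by
    intro θ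
    have h := qDiff_prod_facX_mul_qWt hn hq hx (z := fun m => circ (θ m))
      (fun m => circ_ne_zero _) fun i j => one_sub_mul_ne_zero hq1 (norm_circ_div _ _).le
    rw [qDiff] at h
    simp only [Finset.prod_mul_distrib]
    rw [← Finset.sum_mul]
    have h2 : ∑ i ∈ Finset.Icc 1 n, lagC x n i *
        ((∏ m, facX n (Function.update x i (x i / q)) (circ (θ m))) * (∏ m, H (circ (θ m))⁻¹) *
          qWt q fun m => circ (θ m)) = (∑ i ∈ Finset.Icc 1 n, lagC x n i *
        (∏ m, facX n (Function.update x i (x i / q)) (circ (θ m)))) *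
          (qWt q fun m => circ (θ m)) * (∏ m, H (circ (θ m))⁻¹) := by
      rw [Finset.sum_mul, Finset.sum_mul]
      exact Finset.sum_congr rfl fun i _ => by ring
    rw [h2]
    simp only [Finset.prod_mul_distrib] at h ⊢
    linear_combination (∏ m, H (circ (θ m))⁻¹) * h
  have hm : ∀ m : Fin (k + 1), ∫ θ : Fin (k + 1) → UnitAddCircle,
      ((∏ l, q⁻¹ * qKer q (circ (θ (m.succAbove l)) / circ (θ m))) *
        ((∏ l, facX n x (circ (θ (m.succAbove l)))) *
          qWt q (fun l => circ (θ (m.succAbove l))))) * ∏ m, H (circ (θ m))⁻¹ =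
      (q⁻¹) ^ k * H 0 * ∫ η : Fin k → UnitAddCircle,
        (∏ l, facX n x (circ (η l)) * H (circ (η l))⁻¹) * qWt q fun l => circ (η l) := by
    intro m
    rw [integral_insertNth m (hKc m), ← MeasureTheory.integral_const_mul]
    congr 1
    funext η
    rw [← integral_qKer hq1 η hH, ← MeasureTheory.integral_mul_const]
    congr 1
    funext t
    simp only [Fin.insertNth_apply_succAbove, Fin.insertNth_apply_same,
      Fin.prod_univ_succAbove _ m, Finset.prod_mul_distrib]
    ring
  have hI := MeasureTheory.integral_congr_ae (μ := MeasureTheory.volume)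
    (Filter.Eventually.of_forall hpt)
  rw [MeasureTheory.integral_const_mul, MeasureTheory.integral_finsetSum _
      (fun i _ => (hint _).const_mul _), MeasureTheory.integral_add (hint x)
      ((MeasureTheory.integrable_finsetSum _ fun m _ =>
        integrable_of_continuous _ (hKc m)).const_mul _), MeasureTheory.integral_const_mul,
    MeasureTheory.integral_finsetSum _ fun m _ => integrable_of_continuous _ (hKc m),
    Finset.sum_congr rfl fun m _ => hm m, Finset.sum_const, Finset.card_univ, Fintype.card_fin,
    nsmul_eq_mul] at hI
  simp only [MeasureTheory.integral_const_mul] at hI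
  have h1q : 1 - q ≠ 0 := by simpa using one_sub_mul_ne_zero hq1 (u := 1) (by simp)
  have hk : ((k : ℂ) + 1) ≠ 0 := by exact_mod_cast k.succ_ne_zero
  have hkf : (k.factorial : ℂ) ≠ 0 := by exact_mod_cast k.factorial_ne_zero
  simp only [qDiff, torInt]
  have h3 : ∀ (c : ℂ) (F : ℕ → ℂ), ∑ i ∈ Finset.Icc 1 n, lagC x n i * (c * F i) =
      c * ∑ i ∈ Finset.Icc 1 n, lagC x n i * F i := fun c F => by
    rw [Finset.mul_sum]; exact Finset.sum_congr rfl fun i _ => by ring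
  rw [h3, mul_left_comm, hI, Nat.factorial_succ]
  push_cast
  have hqk : q ^ k ≠ 0 := pow_ne_zero _ hq
  rw [inv_pow]
  field_simp
  ring


theorem torInt_congr {q : ℂ} {k : ℕ} {g g' : ℂ → ℂ} (h : ∀ z ≠ 0, g z = g' z) :
    torInt q k g = torInt q k g' := by
  unfold torInt
  simp only [h _ (circ_ne_zero _)]

theorem hasTop_torInt (n k : ℕ) {q : ℂ} (hq : ‖q‖ < 1) {h : ℂ → ℂ}
    (hh : Continuous fun t => h (circ t)) :
    HasTop (n + 1) k (fun x => torInt q k fun z => facX (n + 1) x z * h z)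
      (fun x => torInt q k fun z => facX n x z * (z * h z)) := by
  set c := ((k.factorial : ℂ) * (1 - q) ^ k)⁻¹ with hc
  set G : Finset (Fin k) → (ℕ → ℂ) → (Fin k → UnitAddCircle) → ℂ := fun A x θ =>
    (∏ m ∈ A, circ (θ m)) * ((∏ m, facX n x (circ (θ m)) * h (circ (θ m))) *
      qWt q fun m => circ (θ m)) with hG
  have hcont : ∀ A, Continuous (Function.uncurry (G A)) := fun A => by
    refine (continuous_finsetProd _ fun m _ => by fun_prop).mul
      ((continuous_finsetProd _ fun m _ => Continuous.mul ?_ ?_).mul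
        ((continuous_qWt hq k).comp continuous_snd))
    · exact (continuous_facX n).comp (continuous_fst.prodMk (by fun_prop))
    · exact hh.comp ((continuous_apply m).comp continuous_snd)
  have hA : ∀ A ∈ (Finset.univ : Finset (Fin k)).powerset, HasTop (n + 1) k
      (fun x => c * (x (n + 1) ^ A.card * ∫ θ, G A x θ))
      (fun x => c * (if A.card = k then ∫ θ, G A x θ else 0)) := fun A _ => by
    refine HasTop.const_mul (HasTop.pow_mul ?_
      (continuous_integral_param MeasureTheory.volume (hcont A)) fun x w => ?_) c
    · simpa using A.card_le_univ
    · have hf : ∀ z, facX n (Function.update x (n + 1) w) z = facX n x z := fun z =>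
        Finset.prod_congr rfl fun j hj => by
          rw [Function.update_of_ne (by rw [Finset.mem_Icc] at hj; omega)]
      simp only [hG, hf]
  refine (HasTop.sum hA).congr (fun x => ?_) fun x => ?_
  · rw [torInt, ← hc, ← Finset.mul_sum]
    congr 1
    have hint : ∀ A, MeasureTheory.Integrable (G A x) := fun A =>
      integrable_of_continuous _ ((hcont A).comp (continuous_const.prodMk continuous_id))
    simp only [← MeasureTheory.integral_const_mul]
    rw [← MeasureTheory.integral_finsetSum _ fun A _ => (hint A).const_mul _]
    congr 1
    funext θ
    have h1 : ∀ m, facX (n + 1) x (circ (θ m)) * h (circ (θ m)) =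
        (1 + x (n + 1) * circ (θ m)) * (facX n x (circ (θ m)) * h (circ (θ m))) := fun m => by
      rw [facX, Finset.prod_Icc_succ_top (by omega), facX]; ring
    simp only [h1]
    rw [Finset.prod_mul_distrib, Finset.prod_one_add, mul_assoc, Finset.sum_mul]
    refine Finset.sum_congr rfl fun A _ => ?_
    rw [Finset.prod_mul_distrib, Finset.prod_const, hG, mul_assoc]
  · rw [← Finset.mul_sum, Finset.sum_eq_single Finset.univ]
    · rw [if_pos (by simp), torInt, hG]
      simp only [← mul_assoc, ← Finset.prod_mul_distrib]
      simp only [mul_comm (circ _) (facX _ _ _)]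
      rfl
    · intro A _ hA
      rw [if_neg]
      intro h
      exact hA (Finset.eq_univ_of_card A (by simpa using h))
    · simp

theorem differentiable_facX (n : ℕ) (x : ℕ → ℂ) : Differentiable ℂ (facX n x) := by
  unfold facX; fun_prop

/-- The torus integral attached to two alphabets. -/
noncomputable def torXY (q : ℂ) (n m a k : ℕ) (x y : ℕ → ℂ) : ℂ :=
  torInt q k fun z => facX n x z * (facX m y z⁻¹ * z ^ a)

theorem torXY_eq_inv (q : ℂ) (n m a k : ℕ) (x y : ℕ → ℂ) :
    torXY q n m a k x y = torInt q k fun z => facX m y z * (facX n x z⁻¹ * (z⁻¹) ^ a) := by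
  rw [torXY, ← torInt_inv]
  simp only [inv_inv]
  congr 1
  funext z
  ring

theorem qDiff_torXY_left {q : ℂ} (hq : q ≠ 0) (hq1 : ‖q‖ < 1) (n m k : ℕ) (y : ℕ → ℂ)
    {x : ℕ → ℂ} (hx : Set.InjOn x (Finset.Icc 1 (n + 1))) :
    q ^ (k + 1) * qDiff (n + 1) q (torXY q (n + 1) m 0 (k + 1) · y) x =
      torXY q (n + 1) m 0 (k + 1) x y - torXY q (n + 1) m 0 k x y := by
  have h := qDiff_torInt (k := k) (by omega) hq hq1 hx (differentiable_facX m y)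
  have h0 : facX m y 0 = 1 := by simp [facX]
  simpa [torXY, h0] using h

theorem qDiff_torXY_right {q : ℂ} (hq : q ≠ 0) (hq1 : ‖q‖ < 1) (n m a k : ℕ) (x : ℕ → ℂ)
    {y : ℕ → ℂ} (hy : Set.InjOn y (Finset.Icc 1 (m + 1))) :
    q ^ (k + 1) * qDiff (m + 1) q (torXY q n (m + 1) (a + 1) (k + 1) x ·) y =
      torXY q n (m + 1) (a + 1) (k + 1) x y := by
  have h := qDiff_torInt (k := k) (by omega) hq hq1 hy
    (H := fun u => facX n x u * u ^ (a + 1)) ((differentiable_facX n x).mul (by fun_prop))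
  simpa [torXY_eq_inv] using h

theorem torXY_zero_left {q : ℂ} (hq : q ≠ 0) (hq1 : ‖q‖ < 1) (m k : ℕ) (x y : ℕ → ℂ) :
    torXY q 0 m 0 k x y = (qPoch q k)⁻¹ := by
  induction k with
  | zero => simp [torXY, torInt_zero, qPoch]
  | succ k ih =>
    have h := qDiff_torXY_left hq hq1 0 m k y (x := 0) (by simp)
    have h1 : ∀ k, torXY q (0 + 1) m 0 k 0 y = torXY q 0 m 0 k x y := fun k => by
      simp [torXY, facX]
    have h2 : Function.update (0 : ℕ → ℂ) 1 0 = 0 := Function.update_eq_self 1 (0 : ℕ → ℂ)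
    simp only [qDiff, zero_add, Finset.Icc_self, Finset.sum_singleton, lagC,
      Finset.prod_singleton, if_true, Pi.zero_apply, zero_div, h2, one_mul] at h
    rw [zero_add] at h1
    rw [h1, h1, ih] at h
    have h3 := one_sub_mul_ne_zero (u := q ^ k) hq1
      (by rw [norm_pow]; exact pow_le_one₀ (norm_nonneg q) hq1.le)
    rw [← pow_succ'] at h3
    rw [qPoch, Finset.prod_range_succ, ← qPoch, mul_inv, eq_mul_inv_iff_mul_eq₀ h3]
    linear_combination -h

theorem torXY_zero_right {q : ℂ} (hq : q ≠ 0) (hq1 : ‖q‖ < 1) (n a k : ℕ) (x y : ℕ → ℂ) :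
    torXY q n 0 (a + 1) (k + 1) x y = 0 := by
  have h := qDiff_torXY_right hq hq1 n 0 a k x (y := 0) (by simp)
  have h1 : torXY q n (0 + 1) (a + 1) (k + 1) x 0 = torXY q n 0 (a + 1) (k + 1) x y := by
    simp [torXY, facX]
  have h2 : Function.update (0 : ℕ → ℂ) 1 0 = 0 := Function.update_eq_self 1 (0 : ℕ → ℂ)
  simp only [qDiff, zero_add, Finset.Icc_self, Finset.sum_singleton, lagC,
    Finset.prod_singleton, if_true, Pi.zero_apply, zero_div, h2, one_mul] at h
  rw [zero_add] at h1
  rw [h1] at h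
  have h3 := one_sub_mul_ne_zero (u := q ^ k) hq1
    (by rw [norm_pow]; exact pow_le_one₀ (norm_nonneg q) hq1.le)
  rw [← pow_succ'] at h3
  exact (mul_eq_zero.1 (show (1 - q ^ (k + 1)) * _ = 0 by linear_combination -h)).resolve_left h3

theorem colSum_eq_torXY {q : ℂ} (hq : q ≠ 0) (hq1 : ‖q‖ < 1) {N n : ℕ} (hN : n ≤ N) (m a k : ℕ)
    (x y : ℕ → ℂ) : colSum q N n m a k x y = torXY q n m a k x y := by
  have hc : ∀ n y, Continuous fun t : UnitAddCircle => facX n y (circ t)⁻¹ := fun n y =>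
    (differentiable_facX n y).continuous.comp (continuous_circ.inv₀ circ_ne_zero)
  refine colSum_unique hq hq1 (fun _ _ _ _ _ => torInt_zero _ _)
    (fun m k x y => torXY_zero_left hq hq1 m k x y)
    (fun n a k x y => torXY_zero_right hq hq1 n a k x y) (fun n m k y => ?_)
    (fun n m a k x => ?_) (fun n m k y x hx => qDiff_torXY_left hq hq1 n m k y hx)
    (fun n m a k x y hy => qDiff_torXY_right hq hq1 n m a k x hy) hN m a k x y
  · refine (hasTop_torInt n k hq1 (h := fun z => facX m y z⁻¹ * z ^ 0) ?_).congr
      (fun x => rfl) fun x => torInt_congr fun z _ => by ring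
    simpa using hc m y
  · refine (hasTop_torInt m k hq1 (h := fun z => facX n x z⁻¹ * (z⁻¹) ^ (a + 1)) ?_).congr
      (fun y => torXY_eq_inv q n (m + 1) (a + 1) k x y) fun y => ?_
    · exact (hc n x).mul ((continuous_circ.inv₀ circ_ne_zero).pow _)
    · rw [torXY_eq_inv]
      exact torInt_congr fun z hz => by
        rw [pow_succ]
        linear_combination -(facX m y z * facX n x z⁻¹ * z⁻¹ ^ a) * mul_inv_cancel₀ hz


/-! ### Skew tableaux described by their columns -/

/-- The indicator function of a set of columns. -/
def colInd {k : ℕ} (A : Finset (Fin k)) (c : Fin k) : ℕ := if c ∈ A then 1 else 0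

/-- Semistandard skew tableaux with columns of outer heights `hl` and inner heights `hr`. -/
structure IsColTab {k : ℕ} (n : ℕ) (hl hr : Fin k → ℕ) (T : ℕ → Fin k → ℕ) : Prop where
  anti : Antitone hl
  le : ∀ c, hr c ≤ hl c
  support : ∀ r c, T r c ≠ 0 ↔ hr c ≤ r ∧ r < hl c
  entry_le : ∀ r c, T r c ≤ n
  row : ∀ r c c', c ≤ c' → T r c ≠ 0 → T r c' ≠ 0 → T r c ≤ T r c'
  col : ∀ r c, T r c ≠ 0 → T (r + 1) c ≠ 0 → T r c < T (r + 1) c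

/-- The skew Schur polynomial as a sum over column tableaux. -/
noncomputable def colSchur {k : ℕ} (n : ℕ) (x : ℕ → ℂ) (hl hr : Fin k → ℕ) : ℂ :=
  ∑' T : {T // IsColTab n hl hr T},
    ∏ a ∈ Finset.Icc 1 n, x a ^ Nat.card {p : ℕ × Fin k | T.val p.1 p.2 = a}

/-- Adjoin the largest entry `n + 1` at the bottom of the columns in `A`. -/
def addTop {k : ℕ} (n : ℕ) (hl : Fin k → ℕ) (A : Finset (Fin k)) (T : ℕ → Fin k → ℕ)
    (r : ℕ) (c : Fin k) : ℕ := if c ∈ A ∧ r + 1 = hl c then n + 1 else T r c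

theorem colInd_le_one {k : ℕ} (A : Finset (Fin k)) (c : Fin k) : colInd A c ≤ 1 := by
  unfold colInd; split_ifs <;> omega

theorem IsColTab.addTop_eq_iff {k n : ℕ} {hl μ hr : Fin k → ℕ} {A : Finset (Fin k)}
    {T : ℕ → Fin k → ℕ} (h : IsColTab n μ hr T) (r : ℕ) (c : Fin k) :
    addTop n hl A T r c = n + 1 ↔ c ∈ A ∧ r + 1 = hl c := by
  have := h.entry_le r c
  unfold addTop
  split_ifs with h1 <;> simp [h1]
  omega

theorem IsColTab.isColTab_addTop {k n : ℕ} {hl hr : Fin k → ℕ} (hhl : Antitone hl)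
    {A : Finset (Fin k)} (hA : ∀ c ∈ A, 0 < hl c) {T : ℕ → Fin k → ℕ}
    (h : IsColTab n (fun c => hl c - colInd A c) hr T) :
    IsColTab (n + 1) hl hr (addTop n hl A T) where
  anti := hhl
  le c := (h.le c).trans (Nat.sub_le _ _)
  support r c := by
    have h1 := h.support r c
    have h2 := h.le c
    unfold addTop
    simp only [colInd] at h1 h2
    by_cases hc : c ∈ A
    · have := hA c hc
      simp only [hc, if_true, true_and] at *
      split_ifs with h3
      · simp; omega
      · rw [h1]; omega
    · simpa [hc] using h1
  entry_le r c := by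
    have := h.entry_le r c
    unfold addTop
    split_ifs <;> omega
  row r c c' hcc h1 h2 := by
    have e1 := h.entry_le r c
    have a1 := h.anti hcc
    have s1 := h.support r c
    have s2 := h.support r c'
    have := h.row r c c' hcc
    have hh := hhl hcc
    have p1 := hA c
    have p2 := hA c'
    have l1 := h.le c
    have l2 := h.le c'
    unfold addTop at *
    simp only [colInd] at *
    grind
  col r c h1 h2 := by
    have e1 := h.entry_le r c
    have s1 := h.support r c
    have s2 := h.support (r + 1) c
    have := h.col r c
    have p1 := hA c
    have l1 := h.le c
    unfold addTop at *
    simp only [colInd] at *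
    grind

theorem IsColTab.exists_addTop {k n : ℕ} {hl hr : Fin k → ℕ} (hhr : Antitone hr)
    {T : ℕ → Fin k → ℕ} (h : IsColTab (n + 1) hl hr T) :
    ∃ A : Finset (Fin k), (∀ c ∈ A, 0 < hl c) ∧ ∃ T',
      IsColTab n (fun c => hl c - colInd A c) hr T' ∧ addTop n hl A T' = T := by
  classical
  set A : Finset (Fin k) := Finset.univ.filter fun c => ∃ r, T r c = n + 1 with hA
  have key0 : ∀ r c, T r c = n + 1 → r + 1 = hl c := by
    intro r c hr
    have h1 := (h.support r c).1 (by omega)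
    by_contra h2
    have h3 := (h.support (r + 1) c).2 (by omega)
    have h4 := h.col r c (by omega) h3
    have := h.entry_le (r + 1) c
    omega
  have key : ∀ r c, T r c = n + 1 ↔ c ∈ A ∧ r + 1 = hl c := by
    intro r c
    refine ⟨fun hr => ⟨by simpa [hA] using ⟨r, hr⟩, key0 r c hr⟩, fun ⟨h1, h2⟩ => ?_⟩
    obtain ⟨r', hr'⟩ : ∃ r, T r c = n + 1 := by simpa [hA] using h1
    have := key0 r' c hr'
    obtain rfl : r = r' := by omega
    exact hr'
  have hpos : ∀ c ∈ A, 0 < hl c ∧ hr c < hl c ∧ T (hl c - 1) c = n + 1 := by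
    intro c hc
    obtain ⟨r, hr⟩ : ∃ r, T r c = n + 1 := by simpa [hA] using hc
    have h1 := key0 r c hr
    have h2 := (h.support r c).1 (by omega)
    refine ⟨by omega, by omega, ?_⟩
    rw [← h1]; simpa using hr
  refine ⟨A, fun c hc => (hpos c hc).1, fun r c => if T r c = n + 1 then 0 else T r c, ?_, ?_⟩
  · refine ⟨?_, ?_, ?_, ?_, ?_, ?_⟩
    · intro c c' hcc
      have h1 := h.anti hcc
      have h2 := hhr hcc
      have h3 := hpos c
      have h4 := hpos c'
      have h5 := h.row (hl c - 1) c c' hcc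
      have h6 := h.support (hl c - 1) c'
      have h7 := h.entry_le (hl c - 1) c'
      have h8 := key (hl c - 1) c'
      simp only [colInd]
      grind
    · intro c
      have h1 := hpos c
      have h2 := h.le c
      simp only [colInd]
      grind
    · intro r c
      have h1 := hpos c
      have h2 := h.support r c
      have h3 := key r c
      simp only [colInd]
      grind
    · intro r c
      have := h.entry_le r c
      grind
    · intro r c c' hcc
      have := h.row r c c' hcc
      grind
    · intro r c
      have := h.col r c
      grind
  · funext r c
    have := key r c
    unfold addTop
    grind

/-- Tableaux with entries at most `n + 1`, in terms of the columns containing `n + 1`. -/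
noncomputable def colTabEquiv {k : ℕ} (n : ℕ) {hl hr : Fin k → ℕ} (hhl : Antitone hl)
    (hhr : Antitone hr) :
    (Σ A : {A : Finset (Fin k) // ∀ c ∈ A, 0 < hl c},
      {T // IsColTab n (fun c => hl c - colInd A.val c) hr T}) ≃
        {T // IsColTab (n + 1) hl hr T} :=
  Equiv.ofBijective
    (fun p => ⟨addTop n hl p.1.val p.2.val, p.2.property.isColTab_addTop hhl p.1.property⟩) <| by
    constructor
    · rintro ⟨⟨A, hA⟩, T, hT⟩ ⟨⟨B, hB⟩, T', hT'⟩ h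
      have h0 : addTop n hl A T = addTop n hl B T' := congrArg Subtype.val h
      have key : ∀ r c, (c ∈ A ∧ r + 1 = hl c) ↔ (c ∈ B ∧ r + 1 = hl c) := by
        intro r c
        rw [← hT.addTop_eq_iff, h0, hT'.addTop_eq_iff]
      obtain rfl : A = B := by
        ext c
        have := key (hl c - 1) c
        have := hA c
        have := hB c
        grind
      have : T = T' := by
        funext r c
        have h1 := congrFun (congrFun h0 r) c
        have h2 := hT.support r c
        have h3 := hT'.support r c
        unfold addTop at h1
        simp only [colInd] at *
        split_ifs at h1 with h4
        · grind
        · exact h1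
      subst this
      rfl
    · rintro ⟨T, hT⟩
      obtain ⟨A, hA, T', hT', rfl⟩ := hT.exists_addTop hhr
      exact ⟨⟨⟨A, hA⟩, T', hT'⟩, rfl⟩

theorem isColTab_zero_iff {k : ℕ} {hl hr : Fin k → ℕ} {T : ℕ → Fin k → ℕ} :
    IsColTab 0 hl hr T ↔ Antitone hl ∧ hl = hr ∧ T = 0 := by
  constructor
  · intro h
    have h0 : T = 0 := by
      funext r c
      exact Nat.le_zero.1 (h.entry_le r c)
    refine ⟨h.anti, funext fun c => le_antisymm ?_ (h.le c), h0⟩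
    have := h.support (hr c) c
    simp only [h0, Pi.zero_apply] at this
    simpa using this
  · rintro ⟨h1, rfl, rfl⟩
    exact ⟨h1, fun _ => le_rfl, fun r c => by simp, fun _ _ => le_rfl, by simp, by simp⟩

theorem finite_isColTab {k : ℕ} (n : ℕ) (hl : Fin k → ℕ) {hr : Fin k → ℕ} (hhr : Antitone hr) :
    Finite {T // IsColTab n hl hr T} := by
  induction n generalizing hl with
  | zero =>
    refine Finite.of_injective (fun _ => ()) fun a b _ => Subtype.ext ?_
    rw [(isColTab_zero_iff.1 a.2).2.2, (isColTab_zero_iff.1 b.2).2.2]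
  | succ n ih =>
    by_cases hhl : Antitone hl
    · have := ih
      exact Finite.of_equiv _ (colTabEquiv n hhl hhr)
    · have : IsEmpty {T // IsColTab (n + 1) hl hr T} := ⟨fun T => hhl T.2.anti⟩
      infer_instance

theorem colSchur_of_not_antitone {k : ℕ} (n : ℕ) (x : ℕ → ℂ) {hl : Fin k → ℕ}
    (hr : Fin k → ℕ) (hhl : ¬ Antitone hl) : colSchur n x hl hr = 0 := by
  have : IsEmpty {T // IsColTab n hl hr T} := ⟨fun T => hhl T.2.anti⟩
  exact tsum_empty

theorem colSchur_zero {k : ℕ} (x : ℕ → ℂ) (hl : Fin k → ℕ) {hr : Fin k → ℕ}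
    (hhr : Antitone hr) : colSchur 0 x hl hr = if hl = hr then 1 else 0 := by
  split_ifs with h
  · subst h
    rw [colSchur, tsum_eq_single ⟨0, isColTab_zero_iff.2 ⟨hhr, rfl, rfl⟩⟩]
    · simp
    · intro b hb
      exact absurd (Subtype.ext (isColTab_zero_iff.1 b.2).2.2) hb
  · have : IsEmpty {T // IsColTab 0 hl hr T} := ⟨fun T => h (isColTab_zero_iff.1 T.2).2.1⟩
    exact tsum_empty

theorem card_addTop_eq {k n : ℕ} {hl hr μ : Fin k → ℕ} {A : Finset (Fin k)}
    (hA : ∀ c ∈ A, 0 < hl c) {T : ℕ → Fin k → ℕ} (h : IsColTab n μ hr T) :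
    Nat.card {p : ℕ × Fin k | addTop n hl A T p.1 p.2 = n + 1} = A.card := by
  rw [← Nat.card_eq_finsetCard]
  refine Nat.card_congr ⟨fun p => ⟨p.1.2, ((h.addTop_eq_iff _ _).1 p.2).1⟩,
    fun c => ⟨(hl c - 1, c), (h.addTop_eq_iff _ _).2 ⟨c.2, ?_⟩⟩, ?_, ?_⟩
  · have := hA c c.2
    simp only
    omega
  · rintro ⟨⟨r, c⟩, hp⟩
    have := ((h.addTop_eq_iff _ _).1 hp).2
    simp only [Subtype.mk.injEq, Prod.mk.injEq, and_true] at this ⊢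
    omega
  · intro c
    rfl

theorem colSchur_succ {k : ℕ} (n : ℕ) (x : ℕ → ℂ) {hl hr : Fin k → ℕ} (hhl : Antitone hl)
    (hhr : Antitone hr) : colSchur (n + 1) x hl hr =
      ∑ A : Finset (Fin k), if ∀ c ∈ A, 0 < hl c then
        x (n + 1) ^ A.card * colSchur n x (fun c => hl c - colInd A c) hr else 0 := by
  classical
  have := fun μ => finite_isColTab n μ hhr
  rw [colSchur, ← (colTabEquiv n hhl hhr).tsum_eq, Summable.tsum_sigma (Summable.of_finite),
    tsum_fintype, ← Finset.sum_filter]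
  rw [Finset.sum_subtype (Finset.univ.filter fun A : Finset (Fin k) => ∀ c ∈ A, 0 < hl c)
    (p := fun A => ∀ c ∈ A, 0 < hl c) (fun A => by simp)]
  refine Finset.sum_congr rfl fun A _ => ?_
  rw [colSchur, ← tsum_mul_left]
  refine tsum_congr fun T => ?_
  change ∏ a ∈ Finset.Icc 1 (n + 1),
    x a ^ Nat.card {p : ℕ × Fin k | addTop n hl A.1 T.1 p.1 p.2 = a} = _
  rw [Finset.prod_Icc_succ_top (by omega), card_addTop_eq A.2 T.2, mul_comm]
  congr 1
  refine Finset.prod_congr rfl fun a ha => ?_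
  congr 1
  refine Nat.card_congr (Equiv.setCongr ?_)
  ext ⟨r, c⟩
  rw [Finset.mem_Icc] at ha
  have hs := T.2.support r c
  have hA := A.2 c
  simp only [Set.mem_ofPred_eq, addTop]
  simp only [colInd] at hs
  generalize T.1 r c = t at *
  clear this
  split_ifs with h
  · simp only [h.1, if_true] at hs hA
    omega
  · rfl


/-! ### Partitions and their column heights -/

theorem lt_conj_iff (f : YD) (r c : ℕ) : r < conj f.val c ↔ c < f.val r := by
  classical
  obtain ⟨f, hf, N, hN⟩ := f
  have hex : ∃ r, f r ≤ c := ⟨N, by omega⟩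
  have key : ∀ r, c + 1 ≤ f r ↔ r < Nat.find hex := by
    intro r
    rw [Nat.lt_find_iff]
    refine ⟨fun h m hm => ?_, fun h => ?_⟩
    · have := hf m r hm
      omega
    · have := h r le_rfl
      omega
  have hs : {r : ℕ | c + 1 ≤ f r} = ↑(Finset.range (Nat.find hex)) := by
    ext r
    simpa using key r
  have h1 : conj f c = Nat.find hex := by
    rw [conj, hs]
    simp
  rw [h1, ← key]
  exact Nat.succ_le_iff

theorem conj_antitone (f : YD) : Antitone (conj f.val) := by
  intro c d hcd
  by_contra! h
  have := (lt_conj_iff f _ _).1 h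
  have := (lt_conj_iff f (conj f.val c) c).2 (by omega)
  omega

/-- The heights of the first `k` columns of a partition. -/
noncomputable def colHeights (k : ℕ) (f : YD) (c : Fin k) : ℕ := conj f.val c

theorem colHeights_antitone (k : ℕ) (f : YD) : Antitone (colHeights k f) :=
  fun _ _ h => conj_antitone f h

/-- Partitions with first part at most `k` correspond to weakly decreasing `k`-tuples. -/
noncomputable def colHeightsEquiv (k : ℕ) :
    {f : YD // f.val 0 ≤ k} ≃ {h : Fin k → ℕ // Antitone h} :=
  Equiv.ofBijective (fun f => ⟨colHeights k f.val, colHeights_antitone k f.val⟩) <| by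
    constructor
    · rintro ⟨f, hf⟩ ⟨g, hg⟩ h
      have h0 : ∀ c : Fin k, conj f.val c = conj g.val c := fun c =>
        congrFun (congrArg Subtype.val h) c
      have key : ∀ c r, c < f.val r ↔ c < g.val r := by
        intro c r
        rcases lt_or_ge c k with hc | hc
        · rw [← lt_conj_iff, ← lt_conj_iff, h0 ⟨c, hc⟩]
        · have := f.2.1 0 r (Nat.zero_le _)
          have := g.2.1 0 r (Nat.zero_le _)
          omega
      refine Subtype.ext (Subtype.ext (funext fun r => ?_))
      have h1 := key (f.val r) r
      have h2 := key (g.val r) r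
      dsimp only
      omega
    · rintro ⟨h, hh⟩
      have hcard : ∀ (r : ℕ) (c : Fin k),
          (c : ℕ) < (Finset.univ.filter fun c => r < h c).card ↔ r < h c := by
        intro r c
        constructor
        · intro hc
          by_contra! hn
          have hs : (Finset.univ.filter fun c => r < h c) ⊆ Finset.Iio c := by
            intro d hd
            rw [Finset.mem_filter] at hd
            rw [Finset.mem_Iio]
            by_contra! hcd
            have := hh hcd
            omega
          have := Finset.card_le_card hs
          rw [Fin.card_Iio] at this
          omega
        · intro hc
          have hs : Finset.Iic c ⊆ Finset.univ.filter fun c => r < h c := by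
            intro d hd
            rw [Finset.mem_Iic] at hd
            rw [Finset.mem_filter]
            exact ⟨Finset.mem_univ _, lt_of_lt_of_le hc (hh hd)⟩
          have := Finset.card_le_card hs
          rw [Fin.card_Iic] at this
          omega
      set f : YD := ⟨fun r => (Finset.univ.filter fun c => r < h c).card, fun i j hij =>
        Finset.card_le_card fun c hc => by
          rw [Finset.mem_filter] at hc ⊢
          exact ⟨hc.1, hij.trans_lt hc.2⟩,
        ∑ c, h c, by
          rw [Finset.card_eq_zero, Finset.filter_eq_empty_iff]
          intro c _
          have := Finset.single_le_sum (f := h) (fun _ _ => Nat.zero_le _) (Finset.mem_univ c)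
          omega⟩
      refine ⟨⟨f, ?_⟩, Subtype.ext (funext fun c => ?_)⟩
      · exact (Finset.card_le_univ (Finset.univ.filter fun c => 0 < h c)).trans_eq
          (Fintype.card_fin k)
      · have key : ∀ r, r < colHeights k f c ↔ r < h c := fun r => by
          rw [← hcard, colHeights, lt_conj_iff]
        have h1 := key (colHeights k f c)
        have h2 := key (h c)
        dsimp only
        omega

theorem psize_eq_sum_colHeights {k : ℕ} (f : YD) (hf : f.val 0 ≤ k) :
    psize f.val = ∑ c, colHeights k f c := by
  obtain ⟨N, hN⟩ := f.2.2
  have h1 : psize f.val = ∑ r ∈ Finset.range N, f.val r := by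
    refine finsum_eq_sum_of_support_subset _ fun r hr => ?_
    by_contra h
    have := f.2.1 N r (by simpa using h)
    exact hr (by omega)
  have h2 : ∀ r, f.val r = ∑ c : Fin k, if (c : ℕ) < f.val r then 1 else 0 := by
    intro r
    have := f.2.1 0 r (Nat.zero_le _)
    rw [Fin.sum_univ_eq_sum_range (fun c => if c < f.val r then 1 else 0) k,
      ← Finset.sum_filter, Finset.sum_const, smul_eq_mul, mul_one,
      show (Finset.range k).filter (fun c => c < f.val r) = Finset.range (f.val r) by
        ext c; simp; omega, Finset.card_range]
  have h3 : ∀ c : Fin k, colHeights k f c =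
      ∑ r ∈ Finset.range N, if (c : ℕ) < f.val r then 1 else 0 := by
    intro c
    have hc : conj f.val c ≤ N := by
      by_contra! h
      have := (lt_conj_iff f N c).1 h
      omega
    simp only [← lt_conj_iff]
    rw [← Finset.sum_filter, Finset.sum_const, smul_eq_mul, mul_one,
      show (Finset.range N).filter (fun r => r < conj f.val c) = Finset.range (conj f.val c) by
        ext c; simp; omega, Finset.card_range]
    rfl
  rw [h1, Finset.sum_congr rfl fun r _ => h2 r, Finset.sum_comm]
  exact Finset.sum_congr rfl fun c _ => (h3 c).symm

theorem colHeights_le_iff {k : ℕ} {lam rho : YD} (hr : rho.val 0 ≤ k) :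
    colHeights k rho ≤ colHeights k lam ↔ ∀ r, rho.val r ≤ lam.val r := by
  constructor
  · intro h r
    by_contra! hlt
    have h0 := rho.2.1 0 r (Nat.zero_le _)
    have h1 := (lt_conj_iff rho r (lam.val r)).2 hlt
    have h2 := (lt_conj_iff lam r (lam.val r)).1
      (lt_of_lt_of_le h1 (h ⟨lam.val r, by omega⟩))
    omega
  · intro h c
    by_contra! hlt
    have h1 := (lt_conj_iff rho _ _).1 hlt
    have h2 := (lt_conj_iff lam (colHeights k lam c) c).2 (h1.trans_le (h _))
    exact lt_irrefl _ h2

/-- Skew tableaux described by rows and by columns. -/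
noncomputable def issytEquiv {k : ℕ} (n : ℕ) {lam rho : YD} (hl : lam.val 0 ≤ k)
    (hle : ∀ r, rho.val r ≤ lam.val r) :
    {T // issyt n lam.val rho.val T} ≃
      {T // IsColTab n (colHeights k lam) (colHeights k rho) T} where
  toFun T := ⟨fun r c => T.val r c, by
    obtain ⟨T, h1, h2, h3, h4⟩ := T
    refine ⟨colHeights_antitone _ _,
      (colHeights_le_iff ((hle 0).trans hl)).2 hle, fun r c => ?_, fun r c => h2 r c,
      fun r c c' hc ha hb => ?_, fun r c ha hb => ?_⟩
    · rw [h1, colHeights, colHeights, lt_conj_iff, ← not_lt, ← not_lt, lt_conj_iff]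
    · exact h3 r c c' ((h1 _ _).1 ha).1 hc ((h1 _ _).1 hb).2
    · exact h4 r c ((h1 _ _).1 ha).1 ((h1 _ _).1 ha).2 ((h1 _ _).1 hb).1 ((h1 _ _).1 hb).2⟩
  invFun T := ⟨fun r c => if h : c < k then T.val r ⟨c, h⟩ else 0, by
    obtain ⟨T, h⟩ := T
    have hs : ∀ r c, (if h : c < k then T r ⟨c, h⟩ else 0) ≠ 0 ↔
        rho.val r ≤ c ∧ c < lam.val r := by
      intro r c
      split_ifs with hc
      · rw [h.support, colHeights, colHeights, lt_conj_iff, ← not_lt, lt_conj_iff, not_lt]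
      · have := lam.2.1 0 r (Nat.zero_le _)
        simp only [ne_eq, not_true_eq_false, false_iff, not_and]
        omega
    refine ⟨hs, fun r c => ?_, fun r c c' ha hc hb => ?_, fun r c ha hb ha' hb' => ?_⟩
    · dsimp only
      split_ifs with hc
      · exact h.entry_le _ _
      · exact Nat.zero_le _
    · have h0 := lam.2.1 0 r (Nat.zero_le _)
      have h1 := (hs r c).2 ⟨ha, by omega⟩
      have h2 := (hs r c').2 ⟨by omega, hb⟩
      dsimp only
      rw [dif_pos (by omega)] at h1 h2 ⊢
      rw [dif_pos (by omega)]
      exact h.row _ _ _ hc h1 h2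
    · have h0 := lam.2.1 0 r (Nat.zero_le _)
      have h1 := (hs r c).2 ⟨ha, hb⟩
      have h2 := (hs (r + 1) c).2 ⟨ha', hb'⟩
      dsimp only
      rw [dif_pos (by omega)] at h1 h2 ⊢
      rw [dif_pos (by omega)]
      exact h.col _ _ h1 h2⟩
  left_inv T := by
    obtain ⟨T, h1, -⟩ := T
    refine Subtype.ext (funext fun r => funext fun c => ?_)
    dsimp only
    split_ifs with hc
    · rfl
    · by_contra hne
      have := (h1 r c).1 (Ne.symm hne)
      have := lam.2.1 0 r (Nat.zero_le _)
      omega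
  right_inv T := by
    refine Subtype.ext (funext fun r => funext fun c => ?_)
    simp

theorem skewSchur_eq_colSchur {k : ℕ} (n : ℕ) (x : ℕ → ℂ) {lam rho : YD} (hl : lam.val 0 ≤ k)
    (hle : ∀ r, rho.val r ≤ lam.val r) :
    skewSchur n x lam.val rho.val = colSchur n x (colHeights k lam) (colHeights k rho) := by
  rw [skewSchur, colSchur, ← (issytEquiv n hl hle).tsum_eq]
  refine tsum_congr fun T => Finset.prod_congr rfl fun a ha => ?_
  rw [Finset.mem_Icc] at ha
  congr 1
  refine Nat.card_congr ⟨fun p => ⟨(p.1.1, ⟨p.1.2, ?_⟩), p.2⟩, fun p => ⟨(p.1.1, p.1.2), p.2⟩,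
    fun p => rfl, fun p => rfl⟩
  have h1 := (T.2.1 p.1.1 p.1.2).1 (by have h2 : T.1 p.1.1 p.1.2 = a := p.2; omega)
  have := lam.2.1 0 p.1.1 (Nat.zero_le _)
  omega


/-! ### Alternants and the Pieri rule -/

/-- The alternant `det (z_i ^ p_j)`. -/
noncomputable def alternant {k : ℕ} (p : Fin k → ℕ) (z : Fin k → ℂ) : ℂ :=
  (Matrix.of fun i j => z i ^ p j).det

/-- The strictly decreasing tuple `(h_1 + k - 1, …, h_k)`. -/
def stair {k : ℕ} (h : Fin k → ℕ) (c : Fin k) : ℕ := h c + (k - 1 - c)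

theorem alternant_eq_sum {k : ℕ} (p : Fin k → ℕ) (z : Fin k → ℂ) :
    alternant p z = ∑ σ : Equiv.Perm (Fin k), ((Equiv.Perm.sign σ : ℤ) : ℂ) *
      ∏ i, z (σ i) ^ p i := by
  simp [alternant, Matrix.det_apply']

theorem alternant_eq_zero {k : ℕ} {p : Fin k → ℕ} (hp : ¬ Function.Injective p)
    (z : Fin k → ℂ) : alternant p z = 0 := by
  simp only [Function.Injective, not_forall] at hp
  obtain ⟨i, j, hij, hne⟩ := hp
  exact Matrix.det_zero_of_column_eq hne fun l => by simp [hij]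

theorem stair_strictAnti {k : ℕ} {h : Fin k → ℕ} (hh : Antitone h) : StrictAnti (stair h) := by
  intro i j hij
  have := hh hij.le
  have h1 : (i : ℕ) < j := hij
  have := j.2
  simp only [stair]
  omega

theorem not_injective_stair_add {k : ℕ} {h : Fin k → ℕ} (hh : Antitone h) {A : Finset (Fin k)}
    (hA : ¬ Antitone fun c => h c + colInd A c) :
    ¬ Function.Injective (stair fun c => h c + colInd A c) := by
  cases k with
  | zero => exact absurd (fun i => i.elim0) hA
  | succ k =>
    rw [Fin.antitone_iff_succ_le] at hA
    push Not at hA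
    obtain ⟨i, hi⟩ := hA
    have h1 := hh (Fin.castSucc_lt_succ (i := i)).le
    have h2 := colInd_le_one A i.succ
    intro hinj
    refine (Fin.castSucc_lt_succ (i := i)).ne (hinj ?_)
    simp only [stair, Fin.val_castSucc, Fin.val_succ]
    have := i.2
    omega

theorem prod_one_add_mul_alternant {k : ℕ} (t : ℂ) (p : Fin k → ℕ) (z : Fin k → ℂ) :
    (∏ i, (1 + t * z i)) * alternant p z =
      ∑ A : Finset (Fin k), t ^ A.card * alternant (fun c => p c + colInd A c) z := by
  simp only [alternant_eq_sum, Finset.mul_sum]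
  rw [Finset.sum_comm]
  refine Finset.sum_congr rfl fun σ _ => ?_
  rw [← Equiv.prod_comp σ fun i => 1 + t * z i, Finset.prod_one_add, Finset.powerset_univ,
    Finset.sum_mul]
  refine Finset.sum_congr rfl fun A _ => ?_
  have h : ∏ i, z (σ i) ^ (p i + colInd A i) = (∏ i, z (σ i) ^ p i) * ∏ i ∈ A, z (σ i) := by
    simp only [pow_add, Finset.prod_mul_distrib]
    congr 1
    rw [← Finset.prod_subset (Finset.subset_univ A) fun i _ hi => by simp [colInd, hi]]
    exact Finset.prod_congr rfl fun i hi => by simp [colInd, hi]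
  rw [h, Finset.prod_mul_distrib, Finset.prod_const]
  ring

theorem colSchur_eq_zero_of_lt {k : ℕ} (n : ℕ) (x : ℕ → ℂ) {hl hr : Fin k → ℕ}
    (hhr : Antitone hr) {c : Fin k} (hc : hr c + n < hl c) : colSchur n x hl hr = 0 := by
  induction n generalizing hl with
  | zero => rw [colSchur_zero x hl hhr, if_neg]; rintro rfl; omega
  | succ n ih =>
    by_cases hhl : Antitone hl
    · rw [colSchur_succ n x hhl hhr]
      refine Finset.sum_eq_zero fun A _ => ?_
      have := colInd_le_one A c
      rw [ih (by omega), mul_zero, ite_self]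
    · exact colSchur_of_not_antitone _ x hr hhl

theorem colSchur_eq_zero_of_not_le {k : ℕ} (n : ℕ) (x : ℕ → ℂ) {hl hr : Fin k → ℕ}
    (h : ¬ hr ≤ hl) : colSchur n x hl hr = 0 := by
  have : IsEmpty {T // IsColTab n hl hr T} := ⟨fun T => h T.2.le⟩
  exact tsum_empty

/-- Multiplying an alternant by `∏ (1 + x_i z_j)` produces skew Schur coefficients. -/
theorem prod_facX_mul_alternant {k : ℕ} (n : ℕ) (x : ℕ → ℂ) {hr : Fin k → ℕ}
    (hhr : Antitone hr) {M : ℕ} (hn : n ≤ M) (hM : ∀ c, hr c + n ≤ M) (z : Fin k → ℂ) :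
    (∏ i, facX n x (z i)) * alternant (stair hr) z =
      ∑ hl ∈ Fintype.piFinset fun _ => Finset.range (M + 1),
        colSchur n x hl hr * alternant (stair hl) z := by
  induction n generalizing M with
  | zero =>
    rw [Finset.sum_eq_single_of_mem hr (by simpa [Nat.lt_succ_iff] using hM)]
    · simp [facX, colSchur_zero x hr hhr]
    · intro hl _ hne
      rw [colSchur_zero x hl hhr, if_neg hne, zero_mul]
  | succ n ih =>
    obtain ⟨M, rfl⟩ : ∃ L, M = L + 1 := ⟨M - 1, by omega⟩
    have h1 : ∀ w, facX (n + 1) x w = (1 + x (n + 1) * w) * facX n x w := fun w => by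
      rw [facX, Finset.prod_Icc_succ_top (by omega), mul_comm, facX]
    simp only [h1]
    rw [Finset.prod_mul_distrib, mul_assoc, ih (M := M) (by omega) fun c => by have := hM c; omega,
      Finset.mul_sum]
    have h2 : ∀ μ : Fin k → ℕ, (∏ i, (1 + x (n + 1) * z i)) *
        (colSchur n x μ hr * alternant (stair μ) z) = ∑ A : Finset (Fin k),
          x (n + 1) ^ A.card * colSchur n x μ hr *
            alternant (stair fun c => μ c + colInd A c) z := by
      intro μ
      rw [mul_left_comm, prod_one_add_mul_alternant, Finset.mul_sum]
      refine Finset.sum_congr rfl fun A _ => ?_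
      have : (fun c => stair μ c + colInd A c) = stair fun c => μ c + colInd A c := by
        funext c; simp only [stair]; ring
      rw [this]
      ring
    have h3 : ∀ hl : Fin k → ℕ, colSchur (n + 1) x hl hr * alternant (stair hl) z =
        ∑ A : Finset (Fin k), if ∀ c ∈ A, 0 < hl c then
          x (n + 1) ^ A.card * colSchur n x (fun c => hl c - colInd A c) hr *
            alternant (stair hl) z else 0 := by
      intro hl
      by_cases hhl : Antitone hl
      · rw [colSchur_succ n x hhl hhr, Finset.sum_mul]
        exact Finset.sum_congr rfl fun A _ => by rw [ite_mul, zero_mul]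
      · rw [colSchur_of_not_antitone _ x hr hhl, zero_mul, eq_comm]
        refine Finset.sum_eq_zero fun A _ => ?_
        split_ifs with hA
        · by_cases hμ : Antitone fun c => hl c - colInd A c
          · have h4 : (fun c => hl c - colInd A c + colInd A c) = hl := by
              funext c
              have := hA c
              simp only [colInd]
              split_ifs <;> grind
            have := not_injective_stair_add (A := A) hμ (by rwa [h4])
            rw [h4] at this
            rw [alternant_eq_zero this, mul_zero]
          · rw [colSchur_of_not_antitone _ x hr hμ]
            ring
        · rfl
    simp only [h2, h3]
    rw [Finset.sum_comm, Finset.sum_comm (s := Fintype.piFinset _)]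
    refine Finset.sum_congr rfl fun A _ => ?_
    have hinj : Function.Injective fun (μ : Fin k → ℕ) c => μ c + colInd A c := by
      intro μ ν h
      funext c
      have := congrFun h c
      simp only at this
      omega
    refine Eq.trans ?_ (Finset.sum_subset (s₁ := (Fintype.piFinset fun _ : Fin k =>
      Finset.range (M + 1)).image fun μ c => μ c + colInd A c) ?_ ?_)
    · rw [Finset.sum_image hinj.injOn]
      refine Finset.sum_congr rfl fun μ _ => ?_
      rw [if_pos]
      · simp
      · intro c hc
        simp [colInd, hc]
    · intro hl h
      simp only [Finset.mem_image, Fintype.mem_piFinset, Finset.mem_range] at h ⊢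
      obtain ⟨μ, hμ, rfl⟩ := h
      intro c
      have := hμ c
      have := colInd_le_one A c
      dsimp only
      omega
    · intro hl h1 h2
      split_ifs with hA
      · have : ∃ c, M < hl c - colInd A c := by
          by_contra! h3
          refine h2 (Finset.mem_image.2 ⟨fun c => hl c - colInd A c,
            by simpa [Nat.lt_succ_iff] using h3, ?_⟩)
          funext c
          have := hA c
          simp only [colInd]
          split_ifs <;> grind
        obtain ⟨c, hc⟩ := this
        rw [colSchur_eq_zero_of_lt n x hhr (c := c) (by have := hM c; omega)]
        ring
      · rfl


/-! ### Orthogonality of alternants on the torus -/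

theorem integral_circ_pow (m : ℕ) : ∫ θ : UnitAddCircle, circ θ ^ m = if m = 0 then 1 else 0 := by
  rw [integral_circ (f := fun z => z ^ m) (Differentiable.diffContOnCl (by fun_prop)), zero_pow_eq]

theorem integral_circ_pow_mul_inv_pow (a b : ℕ) :
    ∫ θ : UnitAddCircle, circ θ ^ a * (circ θ)⁻¹ ^ b = if a = b then 1 else 0 := by
  rcases le_total b a with h | h
  · obtain ⟨m, rfl⟩ := Nat.exists_eq_add_of_le h
    have h1 : ∀ θ, circ θ ^ (b + m) * (circ θ)⁻¹ ^ b = circ θ ^ m := fun θ => by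
      have := circ_ne_zero θ
      rw [pow_add, inv_pow]
      field_simp
    simp only [h1, integral_circ_pow]
    simp
  · obtain ⟨m, rfl⟩ := Nat.exists_eq_add_of_le h
    have h1 : ∀ θ, circ θ ^ a * (circ θ)⁻¹ ^ (a + m) = (circ θ)⁻¹ ^ m := fun θ => by
      have := circ_ne_zero θ
      rw [pow_add, inv_pow, inv_pow]
      field_simp
    simp only [h1, integral_circ_inv fun z => z ^ m, integral_circ_pow]
    simp

theorem eq_one_of_strictAnti_comp {k : ℕ} {p p' : Fin k → ℕ} (hp : StrictAnti p)
    (hp' : StrictAnti p') {π : Equiv.Perm (Fin k)} (h : p ∘ π = p') : π = 1 := by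
  have hπ : ∀ {i j}, π i ≤ π j ↔ i ≤ j := fun {i j} => by
    rw [← hp.le_iff_ge, ← hp'.le_iff_ge, ← h]
    rfl
  have h1 := Subsingleton.elim (⟨π, hπ⟩ : Fin k ≃o Fin k) (OrderIso.refl _)
  ext i
  exact congrArg Fin.val (DFunLike.congr_fun h1 i)

@[fun_prop]
theorem continuous_alternant {k : ℕ} (p : Fin k → ℕ) : Continuous (alternant p) := by
  unfold alternant
  exact Continuous.matrix_det (by fun_prop)

theorem integral_alternant_mul {k : ℕ} {p p' : Fin k → ℕ} (hp : StrictAnti p)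
    (hp' : StrictAnti p') :
    ∫ θ : Fin k → UnitAddCircle, alternant p (fun i => circ (θ i)) *
      alternant p' (fun i => (circ (θ i))⁻¹) = if p = p' then (k.factorial : ℂ) else 0 := by
  have h1 : ∀ θ : Fin k → UnitAddCircle, alternant p (fun i => circ (θ i)) *
      alternant p' (fun i => (circ (θ i))⁻¹) = ∑ σ : Equiv.Perm (Fin k), ∑ τ : Equiv.Perm (Fin k),
        ((Equiv.Perm.sign σ : ℤ) : ℂ) * ((Equiv.Perm.sign τ : ℤ) : ℂ) *
          ∏ i, (circ (θ i) ^ p (σ.symm i) * (circ (θ i))⁻¹ ^ p' (τ.symm i)) := by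
    intro θ
    rw [alternant_eq_sum, alternant_eq_sum, Finset.sum_mul_sum]
    refine Finset.sum_congr rfl fun σ _ => Finset.sum_congr rfl fun τ _ => ?_
    rw [Finset.prod_mul_distrib, ← Equiv.prod_comp σ fun i => circ (θ i) ^ p (σ.symm i),
      ← Equiv.prod_comp τ fun i => (circ (θ i))⁻¹ ^ p' (τ.symm i)]
    simp only [Equiv.symm_apply_apply]
    ring
  have hc : ∀ σ τ : Equiv.Perm (Fin k), Continuous fun θ : Fin k → UnitAddCircle =>
      ((Equiv.Perm.sign σ : ℤ) : ℂ) * ((Equiv.Perm.sign τ : ℤ) : ℂ) *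
        ∏ i, (circ (θ i) ^ p (σ.symm i) * (circ (θ i))⁻¹ ^ p' (τ.symm i)) := fun σ τ => by
    have : ∀ i, Continuous fun θ : Fin k → UnitAddCircle => (circ (θ i))⁻¹ := fun i =>
      Continuous.inv₀ (by fun_prop) fun θ => circ_ne_zero _
    fun_prop
  have h2 : ∀ σ τ : Equiv.Perm (Fin k), ∫ θ : Fin k → UnitAddCircle,
      ((Equiv.Perm.sign σ : ℤ) : ℂ) * ((Equiv.Perm.sign τ : ℤ) : ℂ) *
        ∏ i, (circ (θ i) ^ p (σ.symm i) * (circ (θ i))⁻¹ ^ p' (τ.symm i)) =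
      if p = p' ∧ σ = τ then 1 else 0 := by
    intro σ τ
    rw [MeasureTheory.integral_const_mul, MeasureTheory.integral_fintype_prod_volume_eq_prod
      fun i t => circ t ^ p (σ.symm i) * (circ t)⁻¹ ^ p' (τ.symm i)]
    simp only [integral_circ_pow_mul_inv_pow]
    split_ifs with h
    · obtain ⟨rfl, rfl⟩ := h
      rw [Finset.prod_eq_one fun i _ => if_pos rfl, mul_one, ← Int.cast_mul,
        ← Units.val_mul, Int.units_mul_self]
      simp
    · by_cases hh : ∀ i, p (σ.symm i) = p' (τ.symm i)
      · have h3 : p ∘ (τ.trans σ.symm) = p' := by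
          funext i
          simpa using hh (τ i)
        have h4 := eq_one_of_strictAnti_comp hp hp' h3
        refine absurd ⟨?_, ?_⟩ h
        · rw [← h3, h4]; rfl
        · ext i
          have h5 := DFunLike.congr_fun h4 i
          simp only [Equiv.trans_apply, Equiv.Perm.coe_one, id_eq, Equiv.symm_apply_eq] at h5
          rw [h5]
      · push Not at hh
        obtain ⟨i, hi⟩ := hh
        rw [Finset.prod_eq_zero (Finset.mem_univ i) (if_neg hi), mul_zero]
  simp only [h1]
  rw [MeasureTheory.integral_finsetSum _ fun σ _ =>
    integrable_of_continuous _ (continuous_finsetSum _ fun τ _ => hc σ τ)]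
  have h3 : ∀ σ : Equiv.Perm (Fin k), ∫ θ : Fin k → UnitAddCircle, ∑ τ : Equiv.Perm (Fin k),
      ((Equiv.Perm.sign σ : ℤ) : ℂ) * ((Equiv.Perm.sign τ : ℤ) : ℂ) *
        ∏ i, (circ (θ i) ^ p (σ.symm i) * (circ (θ i))⁻¹ ^ p' (τ.symm i)) =
      if p = p' then 1 else 0 := by
    intro σ
    rw [MeasureTheory.integral_finsetSum _ fun τ _ => integrable_of_continuous _ (hc σ τ)]
    simp only [h2]
    by_cases hpp : p = p' <;> simp [hpp]
  simp only [h3]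
  split_ifs <;> simp [Fintype.card_perm]

theorem stair_injective (k : ℕ) : Function.Injective (stair (k := k)) := by
  intro h h' heq
  funext c
  have := congrFun heq c
  simp only [stair] at this
  omega

theorem sum_colSchur_mul {k : ℕ} (n : ℕ) (x y : ℕ → ℂ) {hr : Fin k → ℕ} (hhr : Antitone hr)
    {M : ℕ} (hn : n ≤ M) (hM : ∀ c, hr c + n ≤ M) :
    (k.factorial : ℂ) * ∑ hl ∈ Fintype.piFinset fun _ => Finset.range (M + 1),
        colSchur n x hl hr * colSchur n y hl hr =
      ∫ θ : Fin k → UnitAddCircle,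
        (∏ i, (facX n x (circ (θ i)) * facX n y (circ (θ i))⁻¹)) *
          (alternant (stair hr) (fun i => circ (θ i)) *
            alternant (stair hr) (fun i => (circ (θ i))⁻¹)) := by
  have hinv : Continuous fun θ : Fin k → UnitAddCircle => fun i => (circ (θ i))⁻¹ :=
    continuous_pi fun i => Continuous.inv₀ (by fun_prop) fun θ => circ_ne_zero _
  have hc : ∀ hl hl' : Fin k → ℕ, Continuous fun θ : Fin k → UnitAddCircle =>
      colSchur n x hl hr * alternant (stair hl) (fun i => circ (θ i)) *
        (colSchur n y hl' hr * alternant (stair hl') (fun i => (circ (θ i))⁻¹)) := fun hl hl' => by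
    have := (continuous_alternant (stair hl')).comp hinv
    simp only [Function.comp_def] at this
    fun_prop
  have h1 : ∀ θ : Fin k → UnitAddCircle,
      (∏ i, (facX n x (circ (θ i)) * facX n y (circ (θ i))⁻¹)) *
          (alternant (stair hr) (fun i => circ (θ i)) *
            alternant (stair hr) (fun i => (circ (θ i))⁻¹)) =
      ∑ hl ∈ Fintype.piFinset fun _ => Finset.range (M + 1),
        ∑ hl' ∈ Fintype.piFinset fun _ => Finset.range (M + 1),
          colSchur n x hl hr * alternant (stair hl) (fun i => circ (θ i)) *
            (colSchur n y hl' hr * alternant (stair hl') (fun i => (circ (θ i))⁻¹)) := by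
    intro θ
    rw [Finset.prod_mul_distrib, mul_mul_mul_comm, prod_facX_mul_alternant n x hhr hn hM,
      prod_facX_mul_alternant n y hhr hn hM, Finset.sum_mul_sum]
  simp only [h1]
  rw [MeasureTheory.integral_finsetSum _ fun hl _ =>
    integrable_of_continuous _ (continuous_finsetSum _ fun hl' _ => hc hl hl'), Finset.mul_sum]
  refine Finset.sum_congr rfl fun hl hmem => ?_
  rw [MeasureTheory.integral_finsetSum _ fun τ _ => integrable_of_continuous _ (hc hl τ)]
  have h2 : ∀ hl', ∫ θ : Fin k → UnitAddCircle,
      colSchur n x hl hr * alternant (stair hl) (fun i => circ (θ i)) *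
        (colSchur n y hl' hr * alternant (stair hl') (fun i => (circ (θ i))⁻¹)) =
      if hl = hl' then (k.factorial : ℂ) * (colSchur n x hl hr * colSchur n y hl' hr) else 0 := by
    intro hl'
    simp only [mul_mul_mul_comm (colSchur n x hl hr)]
    rw [MeasureTheory.integral_const_mul]
    by_cases h : Antitone hl
    · by_cases h' : Antitone hl'
      · rw [integral_alternant_mul (stair_strictAnti h) (stair_strictAnti h')]
        simp only [(stair_injective k).eq_iff]
        split_ifs <;> ring
      · rw [colSchur_of_not_antitone n y hr h']
        simp
    · rw [colSchur_of_not_antitone n x hr h]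
      simp
  simp only [h2]
  rw [Finset.sum_ite_eq, if_pos hmem]


/-! ### A Cauchy determinant and a Cauchy–Binet expansion -/

theorem det_one_sub_mul_inv_succ {k : ℕ} {a b : Fin (k + 1) → ℂ}
    (h : ∀ i j, 1 - a i * b j ≠ 0) :
    (Matrix.of fun i j => (1 - a i * b j)⁻¹).det =
      (1 - a 0 * b 0)⁻¹ * (∏ i : Fin k, ((a i.succ - a 0) * (b i.succ - b 0) /
        ((1 - a i.succ * b 0) * (1 - a 0 * b i.succ)))) *
          (Matrix.of fun i j : Fin k => (1 - a i.succ * b j.succ)⁻¹).det := by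
  set B : Matrix (Fin (k + 1)) (Fin (k + 1)) ℂ := Matrix.of fun i j =>
    Fin.cases (1 : ℂ) (fun i => b j * (1 - a i.succ * b j)⁻¹) i with hB
  set C : Matrix (Fin (k + 1)) (Fin (k + 1)) ℂ := Matrix.of fun i j =>
    Fin.cases (Fin.cases (1 : ℂ) (fun _ => 0) j) (fun i => Fin.cases (b 0 * (1 - a i.succ * b 0)⁻¹)
      (fun j => (1 - a i.succ * b 0)⁻¹ * ((b j.succ - b 0) * (1 - a i.succ * b j.succ)⁻¹)) j) i
    with hC
  have h1 : (Matrix.of fun i j => (1 - a i * b j)⁻¹).det =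
      (Matrix.of fun i j => (1 - a 0 * b j)⁻¹ * ((Fin.cases 1 (fun i => a i.succ - a 0) i : ℂ) *
        B i j)).det := by
    refine Matrix.det_eq_of_forall_row_eq_smul_add_const
      (fun i => Fin.cases 0 (fun _ => 1) i) 0 rfl fun i j => ?_
    refine Fin.cases ?_ (fun i => ?_) i
    · simp [hB]
    · have e1 := inv_mul_cancel₀ (h 0 j)
      have e2 := inv_mul_cancel₀ (h i.succ j)
      simp only [hB, Matrix.of_apply, Fin.cases_zero, Fin.cases_succ]
      linear_combination (1 - a 0 * b j)⁻¹ * e2 - (1 - a i.succ * b j)⁻¹ * e1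
  have h2 : B.det = C.det := by
    rw [← Matrix.det_transpose B, ← Matrix.det_transpose C]
    refine Matrix.det_eq_of_forall_row_eq_smul_add_const
      (fun i => Fin.cases 0 (fun _ => 1) i) 0 rfl fun j i => ?_
    simp only [Matrix.transpose_apply]
    refine Fin.cases ?_ (fun i => ?_) i <;> refine Fin.cases ?_ (fun j => ?_) j
    · simp [hB, hC]
    · simp [hB, hC]
    · simp [hB, hC]
    · have e1 := inv_mul_cancel₀ (h i.succ 0)
      have e2 := inv_mul_cancel₀ (h i.succ j.succ)
      simp only [hB, hC, Matrix.of_apply, Fin.cases_zero, Fin.cases_succ]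
      linear_combination b 0 * (1 - a i.succ * b 0)⁻¹ * e2 -
        b j.succ * (1 - a i.succ * b j.succ)⁻¹ * e1
  have h3 : C.det = (∏ i : Fin k, (1 - a i.succ * b 0)⁻¹) * ((∏ i : Fin k, (b i.succ - b 0)) *
      (Matrix.of fun i j : Fin k => (1 - a i.succ * b j.succ)⁻¹).det) := by
    rw [Matrix.det_succ_row_zero, Fin.sum_univ_succ, Finset.sum_eq_zero fun i _ => by simp [hC]]
    rw [← Matrix.det_mul_row, ← Matrix.det_mul_column]
    simp only [hC, Matrix.of_apply, Fin.cases_zero, Fin.val_zero, pow_zero, one_mul, add_zero]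
    rfl
  rw [h1]
  have h4 := Matrix.det_mul_row (fun j => (1 - a 0 * b j)⁻¹) (Matrix.of fun i j =>
    ((Fin.cases 1 (fun i => a i.succ - a 0) i : ℂ) * B i j))
  simp only [Matrix.of_apply] at h4
  rw [h4, Matrix.det_mul_column, h2, h3, Fin.prod_univ_succ, Fin.prod_univ_succ]
  simp only [Fin.cases_zero, Fin.cases_succ, div_eq_mul_inv, mul_inv, Finset.prod_mul_distrib]
  ring

/-- The staircase size `0 + 1 + ⋯ + (k - 1)`. -/
def stairSize (k : ℕ) : ℕ := ∑ c : Fin k, (k - 1 - (c : ℕ))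

theorem stairSize_succ (k : ℕ) : stairSize (k + 1) = k + stairSize k := by
  rw [stairSize, Fin.sum_univ_succ, stairSize]
  simp only [Fin.val_zero, Fin.val_succ]
  congr 1
  exact Finset.sum_congr rfl fun c _ => by omega

theorem det_one_sub_mul_div_inv {q : ℂ} {k : ℕ} {z : Fin k → ℂ} (hz : ∀ i, z i ≠ 0)
    (h : ∀ i j, 1 - q * (z i / z j) ≠ 0) :
    (Matrix.of fun i j => (1 - q * z i * (z j)⁻¹)⁻¹).det =
      q ^ stairSize k * ((1 - q) ^ k)⁻¹ * qWt q z := by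
  induction k with
  | zero => simp [stairSize, qWt]
  | succ k ih =>
    have h' : ∀ i j, 1 - q * z i * (z j)⁻¹ ≠ 0 := fun i j => by
      have := h i j
      rwa [mul_assoc, ← div_eq_mul_inv]
    rw [det_one_sub_mul_inv_succ h', ih (fun i => hz i.succ) (fun i j => h i.succ j.succ),
      qWt_succAbove q z 0, stairSize_succ, pow_add, pow_succ]
    have h1 : ∀ i : Fin k, (q * z i.succ - q * z 0) * ((z i.succ)⁻¹ - (z 0)⁻¹) /
        ((1 - q * z i.succ * (z 0)⁻¹) * (1 - q * z 0 * (z i.succ)⁻¹)) =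
        q * (qKer q (z i.succ / z 0) * qKer q (z 0 / z i.succ)) := by
      intro i
      have e1 := h i.succ 0
      have e2 := h 0 i.succ
      have e3 := hz 0
      have e4 := hz i.succ
      have e5 : (q * z i.succ - q * z 0) * ((z i.succ)⁻¹ - (z 0)⁻¹) =
          q * ((1 - z i.succ / z 0) * (1 - z 0 / z i.succ)) := by
        field_simp
      rw [e5, qKer, qKer, mul_assoc q, mul_assoc q, ← div_eq_mul_inv, ← div_eq_mul_inv]
      field_simp
    simp only [h1, Fin.zero_succAbove]
    rw [Finset.prod_mul_distrib, Finset.prod_const, Finset.card_fin, mul_assoc q,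
      mul_inv_cancel₀ (hz 0), mul_one]
    simp only [mul_inv]
    ring

theorem hasSum_prod_pow {k : ℕ} {u : Fin k → ℂ} (hu : ∀ i, ‖u i‖ < 1) :
    HasSum (fun p : Fin k → ℕ => ∏ i, u i ^ p i) (∏ i, (1 - u i)⁻¹) ∧
      Summable fun p : Fin k → ℕ => ‖∏ i, u i ^ p i‖ := by
  induction k with
  | zero => exact ⟨by simp, Summable.of_finite⟩
  | succ k ih =>
    obtain ⟨h1, h2⟩ := ih fun i => hu i.succ
    have h3 : Summable fun m : ℕ => ‖u 0 ^ m‖ := by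
      simpa using summable_geometric_of_lt_one (norm_nonneg _) (hu 0)
    have h5 : Summable fun x : ℕ × (Fin k → ℕ) => ‖u 0 ^ x.1 * ∏ i, u i.succ ^ x.2 i‖ :=
      Summable.mul_norm (f := fun m : ℕ => u 0 ^ m)
        (g := fun p : Fin k → ℕ => ∏ i, u i.succ ^ p i) h3 h2
    have h4 : HasSum (fun x : ℕ × (Fin k → ℕ) => u 0 ^ x.1 * ∏ i, u i.succ ^ x.2 i)
        ((1 - u 0)⁻¹ * ∏ i : Fin k, (1 - u i.succ)⁻¹) :=
      HasSum.mul (f := fun m : ℕ => u 0 ^ m) (g := fun p : Fin k → ℕ => ∏ i, u i.succ ^ p i)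
        (hasSum_geometric_of_norm_lt_one (hu 0)) h1 h5.of_norm
    constructor
    · rw [← (Fin.consEquiv fun _ => ℕ).hasSum_iff, Fin.prod_univ_succ]
      simpa [Function.comp_def, Fin.prod_univ_succ] using h4
    · rw [← (Fin.consEquiv fun _ => ℕ).summable_iff]
      simpa [Function.comp_def, Fin.prod_univ_succ] using h5

theorem exists_stair_of_strictAnti {k : ℕ} {s : Fin k → ℕ} (hs : StrictAnti s) :
    ∃ h : Fin k → ℕ, Antitone h ∧ stair h = s := by
  cases k with
  | zero => exact ⟨s, fun i => i.elim0, funext fun i => i.elim0⟩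
  | succ k =>
    have h1 : Antitone fun i => s i + (i : ℕ) := by
      rw [Fin.antitone_iff_succ_le]
      intro i
      have := hs (Fin.castSucc_lt_succ (i := i))
      simp only [Fin.val_succ, Fin.val_castSucc]
      omega
    have h2 : ∀ i, k ≤ s i + i := fun i => by
      have := h1 (Fin.le_last i)
      simp only [Fin.val_last] at this
      omega
    refine ⟨fun i => s i + i - k, fun i j hij => Nat.sub_le_sub_right (h1 hij) k, ?_⟩
    funext i
    have := h2 i
    have := i.2
    simp only [stair]
    omega

theorem alternant_comp {k : ℕ} (p : Fin k → ℕ) (π : Equiv.Perm (Fin k)) (z : Fin k → ℂ) :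
    alternant (p ∘ π) z = ((Equiv.Perm.sign π : ℤ) : ℂ) * alternant p z :=
  Matrix.det_permute' π (Matrix.of fun i j => z i ^ p j)

theorem alternant_eq_sum_comp {k : ℕ} (p : Fin k → ℕ) (w : Fin k → ℂ) :
    alternant p w = ∑ π : Equiv.Perm (Fin k), ((Equiv.Perm.sign π : ℤ) : ℂ) *
      ∏ i, w i ^ p (π i) := by
  rw [alternant_eq_sum, ← Equiv.sum_comp (Equiv.inv (Equiv.Perm (Fin k)))]
  refine Finset.sum_congr rfl fun π _ => ?_
  rw [Equiv.inv_apply, Equiv.Perm.sign_inv, ← Equiv.prod_comp π]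
  simp

/-- Strictly decreasing tuples together with a permutation parametrize injective tuples. -/
theorem range_stair_comp (k : ℕ) :
    Set.range (fun x : {h : Fin k → ℕ // Antitone h} × Equiv.Perm (Fin k) =>
      stair x.1.val ∘ x.2) = {p | Function.Injective p} := by
  ext p
  constructor
  · rintro ⟨⟨⟨h, hh⟩, π⟩, rfl⟩
    exact (stair_strictAnti hh).injective.comp π.injective
  · intro hp
    have h1 : Antitone (p ∘ Tuple.sort (OrderDual.toDual ∘ p)) :=
      Tuple.monotone_sort (OrderDual.toDual ∘ p)
    obtain ⟨h, hh, hs⟩ := exists_stair_of_strictAnti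
      (h1.strictAnti_of_injective (Function.Injective.comp hp (Equiv.injective _)))
    refine ⟨⟨⟨h, hh⟩, (Tuple.sort (OrderDual.toDual ∘ p))⁻¹⟩, ?_⟩
    dsimp only
    rw [hs]
    funext i
    simp

theorem stair_comp_injective (k : ℕ) :
    Function.Injective fun x : {h : Fin k → ℕ // Antitone h} × Equiv.Perm (Fin k) =>
      stair x.1.val ∘ x.2 := by
  rintro ⟨⟨h, hh⟩, π⟩ ⟨⟨h', hh'⟩, π'⟩ heq
  dsimp only at heq
  have h1 : stair h ∘ (π * π'⁻¹ : Equiv.Perm (Fin k)) = stair h' := by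
    funext i
    have := congrFun heq (π'⁻¹ i)
    simpa using this
  have h2 := eq_one_of_strictAnti_comp (stair_strictAnti hh) (stair_strictAnti hh') h1
  obtain rfl : π = π' := by simpa [mul_inv_eq_one] using h2
  rw [h2] at h1
  obtain rfl : h = h' := stair_injective k h1
  rfl

theorem hasSum_alternant_mul {q : ℂ} (hq : ‖q‖ < 1) {k : ℕ} {z w : Fin k → ℂ}
    (hz : ∀ i, ‖z i‖ = 1) (hw : ∀ i, ‖w i‖ = 1) :
    HasSum (fun h : {h : Fin k → ℕ // Antitone h} => q ^ (∑ i, stair h.val i) *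
      (alternant (stair h.val) z * alternant (stair h.val) w))
      (Matrix.of fun i j => (1 - q * z i * w j)⁻¹).det := by
  have h1 : HasSum (fun p : Fin k → ℕ => q ^ (∑ i, p i) * ((∏ i, w i ^ p i) * alternant p z))
      (Matrix.of fun i j => (1 - q * z i * w j)⁻¹).det := by
    rw [Matrix.det_apply']
    have h2 : ∀ p : Fin k → ℕ, q ^ (∑ i, p i) * ((∏ i, w i ^ p i) * alternant p z) =
        ∑ σ : Equiv.Perm (Fin k), ((Equiv.Perm.sign σ : ℤ) : ℂ) *
          ∏ i, (q * z (σ i) * w i) ^ p i := by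
      intro p
      simp only [alternant_eq_sum, Finset.mul_sum, mul_pow, Finset.prod_mul_distrib,
        Finset.prod_pow_eq_pow_sum]
      exact Finset.sum_congr rfl fun σ _ => by ring
    simp only [h2]
    refine hasSum_sum fun σ _ => HasSum.mul_left _ ?_
    exact (hasSum_prod_pow fun i => by simpa [hz, hw] using hq).1
  rw [← (stair_comp_injective k).hasSum_iff] at h1
  · have h3 := h1.prod_fiberwise fun h => hasSum_fintype _
    convert h3 using 2 with h
    simp only [Function.comp_apply]
    rw [alternant_eq_sum_comp (stair h.val) w, Finset.mul_sum, Finset.mul_sum]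
    refine Finset.sum_congr rfl fun π _ => ?_
    rw [alternant_comp, Equiv.sum_comp π (stair h.val)]
    ring
  · intro p hp
    rw [range_stair_comp] at hp
    rw [alternant_eq_zero hp, mul_zero, mul_zero]


/-! ### The generating function of products of skew Schur polynomials -/

theorem norm_alternant_le {k : ℕ} (p : Fin k → ℕ) {z : Fin k → ℂ} (hz : ∀ i, ‖z i‖ = 1) :
    ‖alternant p z‖ ≤ k.factorial := by
  rw [alternant_eq_sum]
  refine (norm_sum_le _ _).trans ?_
  have h1 : ∀ σ : Equiv.Perm (Fin k), ‖((Equiv.Perm.sign σ : ℤ) : ℂ) * ∏ i, z (σ i) ^ p i‖ = 1 := by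
    intro σ
    rw [norm_mul, norm_prod]
    simp [hz]
    rcases Int.units_eq_one_or (Equiv.Perm.sign σ) with h | h <;> simp [h]
  rw [Finset.sum_congr rfl fun σ _ => h1 σ, Finset.sum_const, Finset.card_univ, Fintype.card_perm,
    Fintype.card_fin, nsmul_one]

/-- The torus integrand for the sum of products of skew Schur polynomials with fixed inner
shape `h`. -/
noncomputable def schurIntegrand {k : ℕ} (n : ℕ) (x y : ℕ → ℂ) (h : Fin k → ℕ)
    (θ : Fin k → UnitAddCircle) : ℂ :=
  (∏ i, (facX n x (circ (θ i)) * facX n y (circ (θ i))⁻¹)) *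
    (alternant (stair h) (fun i => circ (θ i)) * alternant (stair h) (fun i => (circ (θ i))⁻¹))

theorem continuous_prod_facX_circ (k n : ℕ) (x y : ℕ → ℂ) :
    Continuous fun θ : Fin k → UnitAddCircle =>
      ∏ i, (facX n x (circ (θ i)) * facX n y (circ (θ i))⁻¹) := by
  unfold facX
  have h : ∀ i, Continuous fun θ : Fin k → UnitAddCircle => (circ (θ i))⁻¹ := fun i =>
    Continuous.inv₀ (by fun_prop) fun θ => circ_ne_zero _
  fun_prop

theorem continuous_schurIntegrand {k : ℕ} (n : ℕ) (x y : ℕ → ℂ) (h : Fin k → ℕ) :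
    Continuous (schurIntegrand n x y h) := by
  have h1 : Continuous fun θ : Fin k → UnitAddCircle => fun i => (circ (θ i))⁻¹ :=
    continuous_pi fun i => Continuous.inv₀ (by fun_prop) fun θ => circ_ne_zero _
  have h2 : Continuous fun θ : Fin k → UnitAddCircle => fun i => circ (θ i) := by fun_prop
  exact (continuous_prod_facX_circ k n x y).mul
    (((continuous_alternant _).comp h2).mul ((continuous_alternant _).comp h1))

theorem exists_norm_schurIntegrand_le (k n : ℕ) (x y : ℕ → ℂ) :
    ∃ C : ℝ, 0 ≤ C ∧ ∀ (h : Fin k → ℕ) (θ : Fin k → UnitAddCircle),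
      ‖schurIntegrand n x y h θ‖ ≤ C := by
  obtain ⟨B, hB⟩ := (isCompact_range (continuous_prod_facX_circ k n x y)).isBounded.exists_norm_le
  have hB0 : 0 ≤ B := (norm_nonneg _).trans (hB _ ⟨0, rfl⟩)
  refine ⟨B * (k.factorial * k.factorial), by positivity, fun h θ => ?_⟩
  rw [schurIntegrand, norm_mul, norm_mul]
  have h1 := hB _ ⟨θ, rfl⟩
  have h2 := norm_alternant_le (stair h) (z := fun i => circ (θ i)) fun i => norm_circ _
  have h3 := norm_alternant_le (stair h) (z := fun i => (circ (θ i))⁻¹) fun i => by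
    rw [norm_inv, norm_circ, inv_one]
  gcongr

theorem summable_pow_sum {r : ℝ} (hr0 : 0 ≤ r) (hr : r < 1) (k : ℕ) :
    Summable fun h : {h : Fin k → ℕ // Antitone h} => r ^ (∑ i, h.val i) := by
  have h1 := (hasSum_prod_pow (k := k) (u := fun _ => (r : ℂ)) fun _ => by
    simpa [abs_of_nonneg hr0] using hr).2
  refine (h1.subtype {h | Antitone h}).congr fun h => ?_
  simp [Finset.prod_pow_eq_pow_sum, abs_of_nonneg hr0]

theorem sum_stair {k : ℕ} (h : Fin k → ℕ) : ∑ i, stair h i = ∑ i, h i + stairSize k := by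
  simp only [stair, stairSize, Finset.sum_add_distrib]

theorem hasSum_integral_schurIntegrand {q : ℂ} (hq0 : q ≠ 0) (hq : ‖q‖ < 1) (k n : ℕ)
    (x y : ℕ → ℂ) :
    HasSum (fun h : {h : Fin k → ℕ // Antitone h} => q ^ (∑ i, h.val i) *
      ((k.factorial : ℂ)⁻¹ * ∫ θ, schurIntegrand n x y h.val θ)) (torXY q n n 0 k x y) := by
  obtain ⟨C, hC0, hC⟩ := exists_norm_schurIntegrand_le k n x y
  have h1 : HasSum (fun h : {h : Fin k → ℕ // Antitone h} =>
      ∫ θ, q ^ (∑ i, h.val i) * schurIntegrand n x y h.val θ)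
      (∫ θ : Fin k → UnitAddCircle, (∏ i, (facX n x (circ (θ i)) * facX n y (circ (θ i))⁻¹)) *
        (((1 - q) ^ k)⁻¹ * qWt q fun i => circ (θ i))) := by
    have hs := (summable_pow_sum (norm_nonneg q) hq k).mul_right C
    refine MeasureTheory.hasSum_integral_of_dominated_convergence
      (fun h _ => ‖q‖ ^ (∑ i, h.val i) * C) (fun h => ?_) (fun h => ?_) ?_ ?_ ?_
    · exact (continuous_const.mul (continuous_schurIntegrand n x y h.val)).aestronglyMeasurable
    · refine Filter.Eventually.of_forall fun θ => ?_
      rw [norm_mul, norm_pow]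
      exact mul_le_mul_of_nonneg_left (hC _ _) (by positivity)
    · exact Filter.Eventually.of_forall fun θ => hs
    · exact MeasureTheory.integrable_const _
    · refine Filter.Eventually.of_forall fun θ => ?_
      have h2 := hasSum_alternant_mul hq (z := fun i => circ (θ i))
        (w := fun i => (circ (θ i))⁻¹) (fun i => norm_circ _) fun i => by
          rw [norm_inv, norm_circ, inv_one]
      rw [det_one_sub_mul_div_inv (fun i => circ_ne_zero _) fun i j =>
        one_sub_mul_ne_zero hq (norm_circ_div _ _).le] at h2
      have h3 := (h2.mul_left (q ^ stairSize k)⁻¹).mul_left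
        (∏ i, (facX n x (circ (θ i)) * facX n y (circ (θ i))⁻¹))
      rw [mul_assoc (q ^ stairSize k), inv_mul_cancel_left₀ (pow_ne_zero _ hq0)] at h3
      refine (congrArg (HasSum · _) (funext fun h => ?_)).mp h3
      rw [sum_stair, pow_add, schurIntegrand]
      field_simp
  have h4 := h1.mul_left (k.factorial : ℂ)⁻¹
  have h5 : torXY q n n 0 k x y = (k.factorial : ℂ)⁻¹ * ∫ θ : Fin k → UnitAddCircle,
      (∏ i, (facX n x (circ (θ i)) * facX n y (circ (θ i))⁻¹)) *
        (((1 - q) ^ k)⁻¹ * qWt q fun i => circ (θ i)) := by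
    rw [torXY, torInt, mul_inv, mul_assoc, ← MeasureTheory.integral_const_mul]
    simp only [pow_zero, mul_one, mul_left_comm ((1 - q) ^ k)⁻¹]
  rw [h5]
  refine (congrArg (HasSum · _) (funext fun h => ?_)).mp h4
  rw [MeasureTheory.integral_const_mul]
  ring

theorem hasSum_colSchur_mul {k : ℕ} (n : ℕ) (x y : ℕ → ℂ) {hr : Fin k → ℕ} (hhr : Antitone hr) :
    HasSum (fun hl : {h : Fin k → ℕ // Antitone h} => colSchur n x hl.val hr *
      colSchur n y hl.val hr) ((k.factorial : ℂ)⁻¹ * ∫ θ, schurIntegrand n x y hr θ) := by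
  set M := ∑ c, hr c + n with hM
  have hc : ∀ c, hr c + n ≤ M := fun c => by
    have := Finset.single_le_sum (f := hr) (fun i _ => Nat.zero_le _) (Finset.mem_univ c)
    omega
  have h1 := sum_colSchur_mul n x y hhr (Nat.le_add_left n _) hc
  have h2 : HasSum (fun hl : Fin k → ℕ => colSchur n x hl hr * colSchur n y hl hr)
      ((k.factorial : ℂ)⁻¹ * ∫ θ, schurIntegrand n x y hr θ) := by
    unfold schurIntegrand
    rw [← h1, inv_mul_cancel_left₀ (Nat.cast_ne_zero.mpr k.factorial_ne_zero)]
    refine hasSum_sum_of_ne_finset_zero fun hl hhl => ?_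
    simp only [Fintype.mem_piFinset, Finset.mem_range, not_forall] at hhl
    obtain ⟨c, hcl⟩ := hhl
    have := hc c
    rw [colSchur_eq_zero_of_lt n x hhr (c := c) (by omega), zero_mul]
  rwa [← Subtype.val_injective.hasSum_iff (f := fun hl : Fin k → ℕ => _)] at h2
  intro hl hhl
  rw [Subtype.range_coe_subtype] at hhl
  rw [colSchur_of_not_antitone n x hr hhl, zero_mul]

theorem colSchur_norm_eq {k : ℕ} (n : ℕ) (x : ℕ → ℂ) (hl : Fin k → ℕ) {hr : Fin k → ℕ}
    (hhr : Antitone hr) :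
    colSchur n (fun i => (‖x i‖ : ℂ)) hl hr =
        ((‖colSchur n (fun i => (‖x i‖ : ℂ)) hl hr‖ : ℝ) : ℂ) ∧
      ‖colSchur n x hl hr‖ ≤ ‖colSchur n (fun i => (‖x i‖ : ℂ)) hl hr‖ := by
  have := finite_isColTab n hl hhr
  have := Fintype.ofFinite {T // IsColTab n hl hr T}
  have h1 : colSchur n (fun i => (‖x i‖ : ℂ)) hl hr = ((∑ T : {T // IsColTab n hl hr T},
      ∏ a ∈ Finset.Icc 1 n, ‖x a‖ ^ Nat.card {p : ℕ × Fin k | T.val p.1 p.2 = a} : ℝ) : ℂ) := by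
    rw [colSchur, tsum_fintype]
    push_cast
    rfl
  have h0 : 0 ≤ ∑ T : {T // IsColTab n hl hr T},
      ∏ a ∈ Finset.Icc 1 n, ‖x a‖ ^ Nat.card {p : ℕ × Fin k | T.val p.1 p.2 = a} := by positivity
  rw [h1, Complex.norm_real, Real.norm_of_nonneg h0]
  refine ⟨rfl, ?_⟩
  rw [colSchur, tsum_fintype]
  refine (norm_sum_le _ _).trans (Finset.sum_le_sum fun T _ => ?_)
  rw [norm_prod]
  simp only [norm_pow, le_refl]

theorem summable_prod_mul {α β : Type*} {a S : α → ℝ} {g : α → β → ℝ} {C : ℝ} (ha : ∀ i, 0 ≤ a i)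
    (hg : ∀ i j, 0 ≤ g i j) (hS : ∀ i, HasSum (g i) (S i)) (hC : ∀ i, S i ≤ C)
    (hsum : Summable a) : Summable fun p : α × β => a p.1 * g p.1 p.2 := by
  have h0 : (0 : α × β → ℝ) ≤ fun p => a p.1 * g p.1 p.2 := fun p => mul_nonneg (ha _) (hg _ _)
  have h1 : ∀ i, Summable fun j => a i * g i j := fun i => (hS i).summable.mul_left _
  have h2 : Summable fun i => ∑' j, a i * g i j := by
    simp only [tsum_mul_left, (hS _).tsum_eq]
    exact Summable.of_nonneg_of_le (fun i => mul_nonneg (ha i) ((hS i).nonneg (hg i)))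
      (fun i => mul_le_mul_of_nonneg_left (hC i) (ha i)) (hsum.mul_right C)
  exact (summable_prod_of_nonneg h0).mpr ⟨h1, h2⟩

theorem HasSum.of_prod_fiberwise {α β : Type*} {f : α × β → ℂ} {g : α → ℂ} {s : ℂ}
    (hf : Summable f) (hg : ∀ i, HasSum (fun j => f (i, j)) (g i)) (h : HasSum g s) :
    HasSum f s := by
  rw [← (hf.hasSum.prod_fiberwise hg).unique h]
  exact hf.hasSum

theorem summable_colSchur_mul {r : ℝ} (hr0 : 0 ≤ r) (hr : r < 1) (k n : ℕ) (x y : ℕ → ℂ) :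
    Summable fun p : {h : Fin k → ℕ // Antitone h} × {h : Fin k → ℕ // Antitone h} =>
      r ^ (∑ i, p.1.val i) * ‖colSchur n x p.2.val p.1.val * colSchur n y p.2.val p.1.val‖ := by
  obtain ⟨C, hC0, hC⟩ := exists_norm_schurIntegrand_le k n (fun i => (‖x i‖ : ℂ))
    fun i => (‖y i‖ : ℂ)
  have h1 : ∀ h : {h : Fin k → ℕ // Antitone h},
      HasSum (fun hl : {h : Fin k → ℕ // Antitone h} =>
        ‖colSchur n (fun i => (‖x i‖ : ℂ)) hl.val h.val‖ *
          ‖colSchur n (fun i => (‖y i‖ : ℂ)) hl.val h.val‖)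
        ((k.factorial : ℂ)⁻¹ * ∫ θ, schurIntegrand n (fun i => (‖x i‖ : ℂ))
          (fun i => (‖y i‖ : ℂ)) h.val θ).re := by
    intro h
    have h2 := Complex.hasSum_re (hasSum_colSchur_mul n (fun i => (‖x i‖ : ℂ))
      (fun i => (‖y i‖ : ℂ)) h.2)
    refine (congrArg (HasSum · _) (funext fun hl => ?_)).mp h2
    have e1 := (colSchur_norm_eq n x hl.val h.2).1
    have e2 := (colSchur_norm_eq n y hl.val h.2).1
    conv_lhs => rw [e1, e2, ← Complex.ofReal_mul, Complex.ofReal_re]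
  have h3 := summable_prod_mul (C := C * MeasureTheory.volume.real
    (Set.univ : Set (Fin k → UnitAddCircle))) (fun h => pow_nonneg hr0 _)
    (fun h hl => mul_nonneg (norm_nonneg _) (norm_nonneg _)) h1 (fun h => by
      refine (Complex.re_le_norm _).trans ?_
      rw [norm_mul, norm_inv, Complex.norm_natCast]
      have h4 := MeasureTheory.norm_integral_le_of_norm_le_const
        (μ := MeasureTheory.volume) (Filter.Eventually.of_forall (hC h.val))
      have h5 : ((k.factorial : ℝ))⁻¹ ≤ 1 :=
        inv_le_one_of_one_le₀ (by exact_mod_cast k.factorial_pos)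
      exact (mul_le_mul h5 h4 (norm_nonneg _) zero_le_one).trans (one_mul _).le)
        (summable_pow_sum hr0 hr k)
  refine Summable.of_nonneg_of_le (fun p => mul_nonneg (pow_nonneg hr0 _) (norm_nonneg _))
    (fun p => mul_le_mul_of_nonneg_left ?_ (pow_nonneg hr0 _)) h3
  rw [norm_mul]
  exact mul_le_mul (colSchur_norm_eq n x p.2.val p.1.2).2 (colSchur_norm_eq n y p.2.val p.1.2).2
    (norm_nonneg _) (norm_nonneg _)

theorem summable_pow_mul_colSchur {q : ℂ} (hq : ‖q‖ < 1) (k n : ℕ) (x y : ℕ → ℂ) :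
    Summable fun p : {h : Fin k → ℕ // Antitone h} × {h : Fin k → ℕ // Antitone h} =>
      q ^ (∑ i, p.1.val i) * (colSchur n x p.2.val p.1.val * colSchur n y p.2.val p.1.val) := by
  refine Summable.of_norm ((summable_colSchur_mul (norm_nonneg q) hq k n x y).congr fun p => ?_)
  rw [norm_mul (q ^ _), norm_pow]

theorem hasSum_pow_mul_colSchur {q : ℂ} (hq0 : q ≠ 0) (hq : ‖q‖ < 1) (k n : ℕ) (x y : ℕ → ℂ) :
    HasSum (fun p : {h : Fin k → ℕ // Antitone h} × {h : Fin k → ℕ // Antitone h} =>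
      q ^ (∑ i, p.1.val i) * (colSchur n x p.2.val p.1.val * colSchur n y p.2.val p.1.val))
      (torXY q n n 0 k x y) := by
  have h1 : ∀ h : {h : Fin k → ℕ // Antitone h},
      HasSum (fun hl : {h : Fin k → ℕ // Antitone h} => q ^ (∑ i, h.val i) *
        (colSchur n x hl.val h.val * colSchur n y hl.val h.val))
        (q ^ (∑ i, h.val i) * ((k.factorial : ℂ)⁻¹ * ∫ θ, schurIntegrand n x y h.val θ)) :=
    fun h => (hasSum_colSchur_mul n x y h.2).mul_left _
  exact HasSum.of_prod_fiberwise (summable_pow_mul_colSchur hq k n x y) h1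
    (hasSum_integral_schurIntegrand hq0 hq k n x y)


/-! ### Sums over pairs of partitions -/

/-- The summand `q^{|ρ|} s_{λ/ρ}(x) s_{λ/ρ}(y)`. -/
noncomputable def schurTerm (n : ℕ) (q : ℂ) (x y : ℕ → ℂ) (p : YD × YD) : ℂ :=
  q ^ psize p.2.val * skewSchur n x p.1.val p.2.val * skewSchur n y p.1.val p.2.val

/-- Column heights of a pair of nested partitions with first parts at most `k`. -/
noncomputable def pairHeights (k : ℕ)
    (p : {p : YD × YD // p.1.val 0 ≤ k ∧ ∀ i, p.2.val i ≤ p.1.val i}) :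
    {h : Fin k → ℕ // Antitone h} × {h : Fin k → ℕ // Antitone h} :=
  (⟨colHeights k p.val.2, colHeights_antitone k p.val.2⟩,
    ⟨colHeights k p.val.1, colHeights_antitone k p.val.1⟩)

theorem pairHeights_injective (k : ℕ) : Function.Injective (pairHeights k) := by
  rintro ⟨⟨l, r⟩, hl, hr⟩ ⟨⟨l', r'⟩, hl', hr'⟩ h
  simp only [pairHeights, Prod.mk.injEq, Subtype.mk.injEq] at h
  have h1 := (colHeightsEquiv k).injective (a₁ := ⟨r, (hr 0).trans hl⟩)
    (a₂ := ⟨r', (hr' 0).trans hl'⟩) (Subtype.ext h.1)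
  have h2 := (colHeightsEquiv k).injective (a₁ := ⟨l, hl⟩) (a₂ := ⟨l', hl'⟩) (Subtype.ext h.2)
  simp only [Subtype.mk.injEq] at h1 h2
  simp [h1, h2]

theorem exists_pairHeights {k : ℕ}
    (p : {h : Fin k → ℕ // Antitone h} × {h : Fin k → ℕ // Antitone h})
    (hp : p.1.val ≤ p.2.val) : p ∈ Set.range (pairHeights k) := by
  obtain ⟨⟨r, hr⟩, h1⟩ := (colHeightsEquiv k).surjective p.1
  obtain ⟨⟨l, hl⟩, h2⟩ := (colHeightsEquiv k).surjective p.2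
  have e1 : colHeights k r = p.1.val := congrArg Subtype.val h1
  have e2 : colHeights k l = p.2.val := congrArg Subtype.val h2
  refine ⟨⟨(l, r), hl, (colHeights_le_iff hr).1 (by rwa [e1, e2])⟩, ?_⟩
  exact Prod.ext (Subtype.ext e1) (Subtype.ext e2)

theorem schurTerm_eq {k : ℕ} (n : ℕ) (q : ℂ) (x y : ℕ → ℂ)
    (p : {p : YD × YD // p.1.val 0 ≤ k ∧ ∀ i, p.2.val i ≤ p.1.val i}) :
    schurTerm n q x y p.val = q ^ (∑ i, (pairHeights k p).1.val i) *
      (colSchur n x (pairHeights k p).2.val (pairHeights k p).1.val *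
        colSchur n y (pairHeights k p).2.val (pairHeights k p).1.val) := by
  obtain ⟨⟨l, r⟩, hl, hr⟩ := p
  simp only [schurTerm, pairHeights]
  rw [psize_eq_sum_colHeights r ((hr 0).trans hl), skewSchur_eq_colSchur n x hl hr,
    skewSchur_eq_colSchur n y hl hr, mul_assoc]

theorem hasSum_schurTerm {q : ℂ} (hq0 : q ≠ 0) (hq : ‖q‖ < 1) (k n : ℕ) (x y : ℕ → ℂ) :
    HasSum (fun p : {p : YD × YD // p.1.val 0 ≤ k ∧ ∀ i, p.2.val i ≤ p.1.val i} =>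
      schurTerm n q x y p.val) (torXY q n n 0 k x y) := by
  simp only [schurTerm_eq]
  refine ((pairHeights_injective k).hasSum_iff fun p hp => ?_).2
    (hasSum_pow_mul_colSchur hq0 hq k n x y)
  have h : ¬ p.1.val ≤ p.2.val := fun h => hp (exists_pairHeights p h)
  rw [colSchur_eq_zero_of_not_le n x h, zero_mul, mul_zero]

theorem tsum_schurTerm_zero {q : ℂ} (hq0 : q ≠ 0) (hq : ‖q‖ < 1) (n : ℕ) (x y : ℕ → ℂ) :
    ∑' p : {p : YD × YD // p.1.val 0 = 0 ∧ ∀ i, p.2.val i ≤ p.1.val i},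
      schurTerm n q x y p.val = torXY q n n 0 0 x y := by
  rw [← (hasSum_schurTerm hq0 hq 0 n x y).tsum_eq]
  exact (Equiv.subtypeEquivRight fun p => by simp).tsum_eq
    fun p : {p : YD × YD // p.1.val 0 ≤ 0 ∧ ∀ i, p.2.val i ≤ p.1.val i} =>
      schurTerm n q x y p.val

theorem tsum_eq_sub_of_or {T : Type*} {f : T → ℂ} {P Q R : T → Prop} {a c : ℂ}
    (hR : ∀ t, R t ↔ P t ∨ Q t) (hPQ : ∀ t, P t → ¬ Q t)
    (ha : HasSum (fun t : {t // P t} => f t) a) (hc : HasSum (fun t : {t // R t} => f t) c) :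
    ∑' t : {t // Q t}, f t = c - a := by
  have hQ : HasSum (fun t : {t // Q t} => f t) (∑' t : {t // Q t}, f t) :=
    (hc.summable.comp_injective (Subtype.map_injective (q := R) (f := id)
      (fun t ht => (hR t).2 (Or.inr ht)) Function.injective_id)).hasSum
  have h := HasSum.add_disjoint (s := {t | P t}) (t := {t | Q t})
    (Set.disjoint_left.2 fun t ht => hPQ t ht) ha hQ
  have hU : {t | P t} ∪ {t | Q t} = {t | R t} := Set.ext fun t => (hR t).symm
  rw [hU] at h
  exact eq_sub_of_add_eq' (h.unique hc)

theorem tsum_schurTerm_succ {q : ℂ} (hq0 : q ≠ 0) (hq : ‖q‖ < 1) (k n : ℕ) (x y : ℕ → ℂ) :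
    ∑' p : {p : YD × YD // p.1.val 0 = k + 1 ∧ ∀ i, p.2.val i ≤ p.1.val i},
      schurTerm n q x y p.val = torXY q n n 0 (k + 1) x y - torXY q n n 0 k x y :=
  tsum_eq_sub_of_or
    (P := fun p : YD × YD => p.1.val 0 ≤ k ∧ ∀ i, p.2.val i ≤ p.1.val i)
    (fun p => by rw [← or_and_right, Nat.le_succ_iff]) (fun p hp hp' => by omega)
    (hasSum_schurTerm hq0 hq k n x y) (hasSum_schurTerm hq0 hq (k + 1) n x y)

theorem continuousOn_tsum_schurTerm {r : ℝ} (hr0 : 0 ≤ r) (hr : r < 1) (k n : ℕ)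
    (x y : ℕ → ℂ) :
    ContinuousOn (fun q : ℂ => ∑' p : {p : YD × YD // p.1.val 0 = k ∧ ∀ i, p.2.val i ≤ p.1.val i},
      schurTerm n q x y p.val) (Metric.closedBall 0 r) := by
  have h1 := (summable_colSchur_mul hr0 hr k n x y).comp_injective (pairHeights_injective k)
  have hi : Function.Injective fun
      p : {p : YD × YD // p.1.val 0 = k ∧ ∀ i, p.2.val i ≤ p.1.val i} =>
      (⟨p.val, p.2.1.le, p.2.2⟩ :
        {p : YD × YD // p.1.val 0 ≤ k ∧ ∀ i, p.2.val i ≤ p.1.val i}) := by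
    intro p p' h
    simpa [Subtype.ext_iff] using h
  refine continuousOn_tsum (fun p => ?_) (h1.comp_injective hi) fun p q hq => ?_
  · unfold schurTerm
    fun_prop
  · rw [schurTerm_eq (k := k) n q x y ⟨p.val, p.2.1.le, p.2.2⟩, norm_mul (q ^ _), norm_pow]
    rw [mem_closedBall_zero_iff] at hq
    exact mul_le_mul_of_nonneg_right (pow_le_pow_left₀ (norm_nonneg _) hq _) (norm_nonneg _)


/-! ### Sums over partitions with prescribed first part -/

/-- The heights of the columns of a partition, from left to right. -/
noncomputable def colList (f : ℕ → ℕ) : List ℕ := List.ofFn fun c : Fin (f 0) => conj f c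

/-- Prepend a first part to a partition. -/
def consRow (r : ℕ) (f : ℕ → ℕ) (i : ℕ) : ℕ := Nat.casesOn i r f

/-- Deleting the first part of a partition. -/
def consRowEquiv (r : ℕ) : {f : YD // f.val 0 ≤ r} ≃ {f : YD // f.val 0 = r} where
  toFun f := ⟨⟨consRow r f.val.val, by
    intro i j hij
    cases j with
    | zero => rw [Nat.le_zero.1 hij]
    | succ j =>
      cases i with
      | zero => exact (f.val.2.1 0 j (Nat.zero_le _)).trans f.2
      | succ i => exact f.val.2.1 i j (by omega), by
    obtain ⟨N, hN⟩ := f.val.2.2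
    exact ⟨N + 1, hN⟩⟩, rfl⟩
  invFun f := ⟨⟨fun i => f.val.val (i + 1), fun i j hij => f.val.2.1 _ _ (by omega), by
    obtain ⟨N, hN⟩ := f.val.2.2
    have := f.val.2.1 N (N + 1) (by omega)
    exact ⟨N, Nat.le_zero.1 (this.trans_eq hN)⟩⟩, (f.val.2.1 0 1 (by omega)).trans f.2.le⟩
  left_inv f := rfl
  right_inv f := by
    refine Subtype.ext (Subtype.ext (funext fun i => ?_))
    cases i with
    | zero => exact f.2.symm
    | succ i => rfl

theorem bmu_consRowEquiv (q : ℂ) {r : ℕ} (f : {f : YD // f.val 0 ≤ r}) :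
    bmu q (consRowEquiv r f).val.val = (qPoch q (r - f.val.val 0))⁻¹ * bmu q f.val.val := by
  obtain ⟨N, hN⟩ := f.val.2.2
  have hz : ∀ i, N ≤ i → f.val.val i = 0 := fun i hi => by
    have := f.val.2.1 N i hi
    omega
  have h1 : bmu q f.val.val =
      ∏ i ∈ Finset.range N, (qPoch q (f.val.val i - f.val.val (i + 1)))⁻¹ := by
    refine finprod_eq_prod_of_mulSupport_subset _ fun i hi => ?_
    by_contra h
    refine hi ?_
    dsimp only
    rw [hz i (by simpa using h)]
    simp [qPoch]
  have h2 : bmu q (consRowEquiv r f).val.val = ∏ i ∈ Finset.range (N + 1),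
      (qPoch q (consRow r f.val.val i - consRow r f.val.val (i + 1)))⁻¹ := by
    refine finprod_eq_prod_of_mulSupport_subset _ fun i hi => ?_
    by_contra h
    refine hi ?_
    have h3 : N + 1 ≤ i := by simpa using h
    obtain ⟨i, rfl⟩ := Nat.exists_eq_add_of_le' (show 1 ≤ i by omega)
    change (qPoch q (f.val.val i - f.val.val (i + 1)))⁻¹ = 1
    rw [hz i (by omega)]
    simp [qPoch]
  rw [h1, h2, Finset.prod_range_succ', mul_comm]
  rfl

theorem conj_consRowEquiv {r : ℕ} (f : {f : YD // f.val 0 ≤ r}) {c : ℕ} (hc : c < r) :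
    conj (consRowEquiv r f).val.val c = conj f.val.val c + 1 := by
  have h : ∀ i, i < conj (consRowEquiv r f).val.val c ↔ i < conj f.val.val c + 1 := by
    intro i
    rw [lt_conj_iff]
    cases i with
    | zero => exact ⟨fun _ => by omega, fun _ => hc⟩
    | succ i => rw [Nat.succ_lt_succ_iff, lt_conj_iff]; rfl
  have h1 := h (conj (consRowEquiv r f).val.val c)
  have h2 := h (conj f.val.val c + 1)
  have h3 := h (conj f.val.val c)
  omega

theorem conj_eq_zero (f : YD) {c : ℕ} (hc : f.val 0 ≤ c) : conj f.val c = 0 := by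
  by_contra h
  have := (lt_conj_iff f 0 c).1 (by omega)
  omega

theorem colList_consRowEquiv {r : ℕ} (f : {f : YD // f.val 0 ≤ r}) :
    colList (consRowEquiv r f).val.val =
      (colList f.val.val).map (· + 1) ++ List.replicate (r - f.val.val 0) 1 := by
  have hr := f.2
  refine List.ext_getElem ?_ fun c h1 h2 => ?_
  · have h3 : (consRowEquiv r f).val.val 0 = r := rfl
    simp [colList, h3]
    omega
  · have hc : c < (consRowEquiv r f).val.val 0 := by simpa [colList] using h1
    replace hc : c < r := hc
    have h3 : (colList (consRowEquiv r f).val.val)[c] = conj (consRowEquiv r f).val.val c := by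
      simp [colList]
    rw [h3, conj_consRowEquiv f hc, List.getElem_append]
    split_ifs with h
    · simp [colList]
    · have h4 : f.val.val 0 ≤ c := by simpa [colList] using h
      simp [conj_eq_zero f.val h4]

theorem hasSum_subtype_first_part {F : YD → ℂ} {r : ℕ} {g : ℕ → ℂ}
    (h : ∀ j ∈ Finset.range (r + 1),
      HasSum (fun f : {f : YD // f.val 0 = r - j} => F f.val) (g j)) :
    HasSum (fun f : {f : YD // f.val 0 ≤ r} => F f.val) (∑ j ∈ Finset.range (r + 1), g j) := by
  have h1 := hasSum_sum fun j hj =>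
    (hasSum_subtype_iff_indicator (f := F) (s := {f : YD | f.val 0 = r - j})).1 (h j hj)
  refine (hasSum_subtype_iff_indicator (f := F) (s := {f : YD | f.val 0 ≤ r})).2
    ((congrArg (HasSum · _) (funext fun f => ?_)).mp h1)
  by_cases hf : f.val 0 ≤ r
  · rw [Set.indicator_of_mem (show f ∈ {f : YD | f.val 0 ≤ r} from hf),
      Finset.sum_eq_single_of_mem (r - f.val 0) (Finset.mem_range.2 (by omega))]
    · exact Set.indicator_of_mem (s := {f : YD | f.val 0 = r - (r - f.val 0)})
        (show f.val 0 = r - (r - f.val 0) by omega) F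
    · intro j hj hne
      rw [Finset.mem_range] at hj
      exact Set.indicator_of_notMem (s := {f : YD | f.val 0 = r - j})
        (fun (h : f.val 0 = r - j) => hne (by omega)) F
  · rw [Set.indicator_of_notMem (show f ∉ {f : YD | f.val 0 ≤ r} from hf)]
    exact Finset.sum_eq_zero fun j _ =>
      Set.indicator_of_notMem (s := {f : YD | f.val 0 = r - j})
        (fun (h : f.val 0 = r - j) => hf (by omega)) F

theorem hasSum_bmu_consRow {q : ℂ} {r : ℕ} {F : List ℕ → ℂ} {s : ℂ}
    (h : HasSum (fun f : {f : YD // f.val 0 ≤ r} => (qPoch q (r - f.val.val 0))⁻¹ *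
      (bmu q f.val.val *
        F ((colList f.val.val).map (· + 1) ++ List.replicate (r - f.val.val 0) 1))) s) :
    HasSum (fun f : {f : YD // f.val 0 = r} => bmu q f.val.val * F (colList f.val.val)) s := by
  rw [← (consRowEquiv r).hasSum_iff]
  refine (congrArg (HasSum · _) (funext fun f => ?_)).mp h
  rw [Function.comp_apply, bmu_consRowEquiv, colList_consRowEquiv, mul_assoc]

theorem hasSum_bmu_colList (q : ℂ) (N r : ℕ) {F : List ℕ → ℂ}
    (hF : ∀ s, ∀ h ∈ s, N + 1 < h → F s = 0) :
    HasSum (fun f : {f : YD // f.val 0 = r} => bmu q f.val.val * F (colList f.val.val))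
      (qSum q N r fun s => F (s.map (· + 1))) := by
  induction N generalizing r F with
  | zero =>
    refine hasSum_bmu_consRow ?_
    let e : {f : YD // f.val 0 ≤ r} := ⟨⟨fun _ => 0, fun _ _ _ => le_rfl, 0, rfl⟩, Nat.zero_le r⟩
    have h2 : bmu q e.val.val = 1 := finprod_eq_one_of_forall_eq_one fun i => by simp [e, qPoch]
    have h3 : colList e.val.val = [] := List.ofFn_zero
    have h4 := hasSum_single (f := fun f : {f : YD // f.val 0 ≤ r} =>
      (qPoch q (r - f.val.val 0))⁻¹ * (bmu q f.val.val *
        F ((colList f.val.val).map (· + 1) ++ List.replicate (r - f.val.val 0) 1))) e ?_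
    · have h5 : e.val.val 0 = 0 := rfl
      simpa [h2, h3, h5, qSum] using h4
    · intro f hf
      have h5 : 0 < f.val.val 0 := by
        by_contra h
        refine hf (Subtype.ext (Subtype.ext (funext fun i => ?_)))
        have := f.val.2.1 0 i (Nat.zero_le _)
        change f.val.val i = 0
        omega
      have h6 : 0 < conj f.val.val 0 := (lt_conj_iff f.val 0 0).2 h5
      have h7 : conj f.val.val 0 ∈ colList f.val.val := by
        rw [colList, List.mem_ofFn]
        exact ⟨⟨0, h5⟩, rfl⟩
      rw [hF _ (conj f.val.val 0 + 1) (by simp [h7]) (by omega), mul_zero, mul_zero]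
  | succ N ih =>
    refine hasSum_bmu_consRow (hasSum_subtype_first_part
      (F := fun f => (qPoch q (r - f.val 0))⁻¹ * (bmu q f.val *
        F ((colList f.val).map (· + 1) ++ List.replicate (r - f.val 0) 1))) fun j hj => ?_)
    rw [Finset.mem_range] at hj
    have h2 := ih (r - j) (F := fun s => F (s.map (· + 1) ++ List.replicate j 1))
      (fun s h hs hN => hF _ (h + 1) (by simp [hs]) (by omega))
    have h3 := h2.mul_left (qPoch q j)⁻¹
    simp only [List.map_append, List.map_replicate]
    refine (congrArg (HasSum · _) (funext fun f => ?_)).mp h3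
    have h4 : r - f.val.val 0 = j := by rw [f.2]; omega
    rw [h4]


/-! ### The summation identity -/

theorem mon_eq_prod_pow_cnt (n : ℕ) (x : ℕ → ℂ) {V : List (Finset ℕ)}
    (hV : ∀ v ∈ V, v ⊆ Finset.Icc 1 n) : ∏ a ∈ Finset.Icc 1 n, x a ^ cnt V a = mon x V := by
  induction V with
  | nil => simp [cnt]
  | cons v V ih =>
    rw [List.forall_mem_cons] at hV
    have h : ∀ a, cnt (v :: V) a = (if a ∈ v then 1 else 0) + cnt V a := fun a => by simp [cnt]
    simp only [h, pow_add, Finset.prod_mul_distrib, ih hV.2, mon_cons, pow_ite, pow_one, pow_zero]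
    rw [Finset.prod_ite_mem, Finset.inter_eq_right.2 hV.1]

theorem mem_colsOf_colList {n : ℕ} {f : ℕ → ℕ} {L : List (Finset ℕ)} :
    (L.length = f 0 ∧ ∀ j : Fin L.length,
      (L.get j).card = conj f (j : ℕ) ∧ ∀ a ∈ L.get j, 1 ≤ a ∧ a ≤ n) ↔
    L ∈ colsOf n (colList f) := by
  rw [mem_colsOf]
  constructor
  · rintro ⟨h0, h⟩
    refine ⟨fun v hv a ha => ?_, List.ext_getElem (by simp [colList, h0]) fun j h1 h2 => ?_⟩
    · obtain ⟨j, rfl⟩ := List.get_of_mem hv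
      exact Finset.mem_Icc.2 ((h j).2 a ha)
    · simpa [colList] using (h ⟨j, by simpa using h1⟩).1
  · rintro ⟨h, h0⟩
    have h1 : L.length = f 0 := by simpa [colList] using congrArg List.length h0
    refine ⟨h1, fun j => ⟨?_, fun a ha => Finset.mem_Icc.1 (h _ (List.get_mem L j) ha)⟩⟩
    have h2 : (L.map Finset.card)[(j : ℕ)]'(by simp) =
        (colList f)[(j : ℕ)]'(by simp [colList, ← h1]) := by simp only [h0]
    simpa [colList] using h2

theorem qWhit_eq_wsum (n : ℕ) (x : ℕ → ℂ) (q : ℂ) (f : ℕ → ℕ) :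
    qWhit n x q f = wsum n q (colList f) x := by
  rw [qWhit, wsum, ← Finset.tsum_subtype,
    ← (Equiv.subtypeEquivRight fun L => mem_colsOf_colList (n := n) (f := f) (L := L)).tsum_eq]
  refine tsum_congr fun V => ?_
  have hV := (mem_colsOf.1 (mem_colsOf_colList.1 V.2)).1
  rw [mon_eq_prod_pow_cnt n x hV]
  rfl

theorem wsum_eq_zero_of_lt {n : ℕ} (q : ℂ) {s : List ℕ} (x : ℕ → ℂ) {h : ℕ} (hs : h ∈ s)
    (hn : n < h) : wsum n q s x = 0 := by
  refine Finset.sum_eq_zero fun V hV => ?_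
  obtain ⟨h1, rfl⟩ := mem_colsOf.1 hV
  obtain ⟨v, hv, rfl⟩ := List.mem_map.1 hs
  have := Finset.card_le_card (h1 v hv)
  rw [Nat.card_Icc] at this
  omega

theorem tsum_qWhit_eq_posSum (n : ℕ) (q : ℂ) (x y : ℕ → ℂ) (r : ℕ) :
    ∑' μ : {μ : YD // μ.val 0 = r},
        bmu q μ.val.val * qWhit n x q μ.val.val * qWhit n y q μ.val.val =
      posSum q n n n r x y := by
  have h := hasSum_bmu_colList q n r (F := fun s => wsum n q s x * wsum n q s y)
    fun s h hs hn => by rw [wsum_eq_zero_of_lt q x hs (by omega), zero_mul]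
  refine Eq.trans (tsum_congr fun μ => ?_) h.tsum_eq
  rw [qWhit_eq_wsum, qWhit_eq_wsum, mul_assoc]

theorem sum_posSum_eq_tsum_schurTerm {q : ℂ} (hq0 : q ≠ 0) (hq : ‖q‖ < 1) (n : ℕ)
    (x y : ℕ → ℂ) (k : ℕ) :
    ∑ l ∈ Finset.range (k + 1), q ^ l / qPoch q l * posSum q n n n (k - l) x y =
      ∑' p : {p : YD × YD // p.1.val 0 = k ∧ ∀ i, p.2.val i ≤ p.1.val i},
        schurTerm n q x y p.val := by
  have h : ∀ k, ∑ j ∈ Finset.range (k + 1), (qPoch q j)⁻¹ * posSum q n n n (k - j) x y =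
      torXY q n n 0 k x y := fun k => by
    rw [← colSum_eq_posSum, colSum_eq_torXY hq0 hq (Nat.le_succ n)]
  cases k with
  | zero =>
    rw [tsum_schurTerm_zero hq0 hq, ← h]
    simp
  | succ k =>
    rw [tsum_schurTerm_succ hq0 hq, ← h, ← h]
    exact (qPoch_conv hq (fun r => posSum q n n n r x y) k).symm

theorem continuousOn_qPoch_inv {r : ℝ} (hr : r < 1) (m : ℕ) :
    ContinuousOn (fun q : ℂ => (qPoch q m)⁻¹) (Metric.closedBall 0 r) := by
  refine ContinuousOn.inv₀ (Continuous.continuousOn ?_) fun q hq => qPoch_ne_zero ?_ m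
  · unfold qPoch
    fun_prop
  · exact (mem_closedBall_zero_iff.1 hq).trans_lt hr

theorem continuousOn_qSum {r : ℝ} (hr : r < 1) (N k : ℕ) {f : ℂ → List ℕ → ℂ}
    (hf : ∀ s, Continuous fun q => f q s) :
    ContinuousOn (fun q => qSum q N k (f q)) (Metric.closedBall 0 r) := by
  induction N generalizing k f with
  | zero => exact (continuousOn_qPoch_inv hr k).mul (hf _).continuousOn
  | succ N ih =>
    exact continuousOn_finsetSum _ fun j _ =>
      (continuousOn_qPoch_inv hr j).mul (ih (k - j) fun s => hf _)

theorem continuousOn_sum_posSum {r : ℝ} (hr : r < 1) (n : ℕ) (x y : ℕ → ℂ) (k : ℕ) :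
    ContinuousOn (fun q => ∑ l ∈ Finset.range (k + 1),
      q ^ l / qPoch q l * posSum q n n n (k - l) x y) (Metric.closedBall 0 r) := by
  refine continuousOn_finsetSum _ fun l _ => ContinuousOn.mul ?_ ?_
  · simp only [div_eq_mul_inv]
    exact (continuous_pow l).continuousOn.mul (continuousOn_qPoch_inv hr l)
  · refine continuousOn_qSum hr n (k - l) fun s => ?_
    unfold wsum
    fun_prop

theorem sum_posSum_eq_tsum_schurTerm_of_norm_lt_one {q : ℂ} (hq : ‖q‖ < 1) (n : ℕ)
    (x y : ℕ → ℂ) (k : ℕ) :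
    ∑ l ∈ Finset.range (k + 1), q ^ l / qPoch q l * posSum q n n n (k - l) x y =
      ∑' p : {p : YD × YD // p.1.val 0 = k ∧ ∀ i, p.2.val i ≤ p.1.val i},
        schurTerm n q x y p.val := by
  by_cases hq0 : q = 0
  · subst hq0
    have hr : (1 / 2 : ℝ) < 1 := by norm_num
    have hb : Metric.closedBall (0 : ℂ) (1 / 2) ∈ nhds 0 :=
      Metric.closedBall_mem_nhds 0 (by norm_num)
    have h1 := ((continuousOn_sum_posSum hr n x y k).continuousAt hb).tendsto.mono_left
      (nhdsWithin_le_nhds (s := {0}ᶜ))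
    have h2 := ((continuousOn_tsum_schurTerm (by norm_num) hr k n x y).continuousAt
      hb).tendsto.mono_left (nhdsWithin_le_nhds (s := {0}ᶜ))
    refine tendsto_nhds_unique_of_eventuallyEq h1 h2 ?_
    filter_upwards [nhdsWithin_le_nhds hb, self_mem_nhdsWithin] with q hq hq0
    exact sum_posSum_eq_tsum_schurTerm hq0 ((mem_closedBall_zero_iff.1 hq).trans_lt hr) n x y k
  · exact sum_posSum_eq_tsum_schurTerm hq0 hq n x y k

/-- For all `k ≥ 0`:
`∑_{l=0}^k q^l/(q;q)_l ∑_{μ : μ₁ = k-l} b_μ(q) P_μ(x;q) P_μ(y;q)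
   = ∑_{ρ ⊆ λ, λ₁ = k} q^{|ρ|} s_{λ/ρ}(x) s_{λ/ρ}(y)`. -/
theorem qWhittaker_skewSchur_summation (n : ℕ) (q : ℂ) (hq : ‖q‖ < 1)
    (x y : ℕ → ℂ) (k : ℕ) :
    ∑ l ∈ Finset.range (k + 1),
        q ^ l / qPoch q l *
          ∑' μ : {μ : YD // μ.val 0 = k - l},
            bmu q μ.val.val * qWhit n x q μ.val.val * qWhit n y q μ.val.val
      = ∑' lr : {p : YD × YD // p.1.val 0 = k ∧ ∀ i, p.2.val i ≤ p.1.val i},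
          q ^ psize lr.val.2.val * skewSchur n x lr.val.1.val lr.val.2.val *
            skewSchur n y lr.val.1.val lr.val.2.val := by
  simp only [tsum_qWhit_eq_posSum]
  exact sum_posSum_eq_tsum_schurTerm_of_norm_lt_one hq n x y k
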